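/- arXiv:1607.01765 — 7 statements merged into one kernel-verified Lean document; each statement's English description precedes it below -/
import Mathlib

section
/- For every positive integer n and every nonnegative integer N, the number of lecture hall partitions λ ∈ L_n with |λ| = N equals the number of partitions of N all of whose parts are odd and less than 2n. -/
/-- `lam` (0-based) is a lecture hall partition in `L_n`:
`0 ≤ lam₀/1 ≤ lam₁/2 ≤ ⋯ ≤ lam_{n-1}/n`, expressed by cross-multiplying
consecutive inequalities. -/
def IsLectureHall (n : ℕ) (lam : Fin n → ℕ) : Prop :=
  ∀ i j : Fin n, (j : ℕ) = (i : ℕ) + 1 →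
    lam i * ((j : ℕ) + 1) ≤ lam j * ((i : ℕ) + 1)

def lhUp (k a : ℕ) : ℕ := a * (k - 1) / k
def lhLo (k a : ℕ) : ℕ := 2 * a - lhUp k a

lemma lhUp_le (k a : ℕ) : lhUp k a ≤ a := by
  unfold lhUp
  rcases Nat.eq_zero_or_pos k with rfl | hk
  · simp
  · apply Nat.div_le_of_le_mul
    rw [mul_comm]
    exact Nat.mul_le_mul_right _ (by omega)

lemma lhLo_add (k a : ℕ) : lhLo k a + lhUp k a = 2 * a := by
  have := lhUp_le k a
  unfold lhLo; omega

lemma le_lhUp (i a b : ℕ) : a * (i + 1) ≤ b * i ↔ a ≤ lhUp (i + 1) b := by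
  unfold lhUp
  rw [Nat.le_div_iff_mul_le (by omega)]; simp

lemma lhLo_le (i a b : ℕ) (h : i = 0 → a = 0) : a * (i + 1) ≤ b * i ↔ lhLo i a ≤ b := by
  rcases Nat.eq_zero_or_pos i with rfl | hi
  · simp [h rfl, lhLo]
  · have h1 := lhLo_add i a
    have h2 : lhLo i a ≤ b ↔ 2 * a - b ≤ lhUp i a := by omega
    rw [h2, lhUp, Nat.le_div_iff_mul_le hi]
    obtain ⟨k, rfl⟩ : ∃ k, i = k + 1 := ⟨i - 1, by omega⟩
    simp only [Nat.add_sub_cancel]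
    rcases le_total (2 * a) b with h | h
    · rw [Nat.sub_eq_zero_of_le h]
      constructor
      · intro; simp
      · intro; nlinarith
    · obtain ⟨c, hc⟩ := Nat.exists_eq_add_of_le h
      rw [hc, Nat.add_sub_cancel_left]
      constructor <;> intro <;> nlinarith

structure LHF (n : ℕ) (f : ℕ → ℕ) : Prop where
  out : ∀ i, n < i → f i = 0
  le : ∀ i, i < n → f i * (i + 1) ≤ f (i + 1) * i
  zero : f 0 = 0

lemma LHF.up {n f} (h : LHF n f) (i : ℕ) (hi : i < n) : f i ≤ lhUp (i + 1) (f (i + 1)) :=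
  (le_lhUp _ _ _).1 (h.le i hi)

lemma LHF.lo {n f} (h : LHF n f) (i : ℕ) (hi : i < n) : lhLo i (f i) ≤ f (i + 1) :=
  (lhLo_le _ _ _ (by rintro rfl; exact h.zero)).1 (h.le i hi)

lemma LHF.lo' {n f} (h : LHF n f) (i : ℕ) (hi : i ≤ n) : lhLo (i - 1) (f (i - 1)) ≤ f i := by
  cases i with
  | zero => simp [h.zero, lhLo]
  | succ i => exact h.lo i hi

def lhR (n : ℕ) (f : ℕ → ℕ) (i : ℕ) : ℕ :=
  if i ≤ n then
    if i % 2 = n % 2 then f i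
    else lhLo (i - 1) (f (i - 1)) + lhUp (i + 1) (f (i + 1)) - f i
  else 0

lemma lhR_same {n f i} (h : i ≤ n) (h' : i % 2 = n % 2) : lhR n f i = f i := by
  simp [lhR, h, h']

lemma lhR_diff {n f i} (h : i ≤ n) (h' : i % 2 ≠ n % 2) :
    lhR n f i = lhLo (i - 1) (f (i - 1)) + lhUp (i + 1) (f (i + 1)) - f i := by
  simp [lhR, h, h']

lemma lhR_out {n f i} (h : n < i) : lhR n f i = 0 := by
  simp [lhR, h]

lemma lhR_zero {n f} (h : f 0 = 0) : lhR n f 0 = 0 := by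
  by_cases h' : 0 % 2 = n % 2
  · rw [lhR_same (by omega) h', h]
  · rw [lhR_diff (by omega) h']
    simp [h, lhLo, lhUp]

lemma LHF.trunc {n f} (h : LHF (n + 1) f) : LHF n (fun i => if i ≤ n then f i else 0) where
  out i hi := by simp [hi]
  le i hi := by
    have := h.le i (by omega)
    simp only [show i ≤ n by omega, show i + 1 ≤ n by omega, if_true, this]
  zero := by simp [h.zero]

lemma lhR_trunc (n f) : lhR n (fun i => if i ≤ n then f i else 0) = lhR n f := by
  funext i
  unfold lhR
  split_ifs with h1 h2
  · simp [h1]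
  · simp only [show i - 1 ≤ n by omega, show i + 1 ≤ n by omega, h1, if_true]
  · rfl

lemma LHF.R {n f} (h : LHF n f) : LHF n (lhR n f) where
  out i hi := lhR_out hi
  zero := lhR_zero h.zero
  le i hi := by
    by_cases h' : i % 2 = n % 2
    · rw [lhLo_le _ _ _ (by rintro rfl; exact lhR_zero h.zero),
        lhR_same (by omega) h', lhR_diff (by omega) (by omega)]
      have := h.up (i + 1) (by omega)
      simp only [Nat.add_sub_cancel]
      omega
    · rw [le_lhUp, lhR_same (i := i + 1) (by omega) (by omega), lhR_diff (by omega) h']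
      have := h.lo' i (by omega)
      omega

lemma LHF.RR {n f} (h : LHF n f) : lhR n (lhR n f) = f := by
  funext i
  by_cases hi : i ≤ n
  · by_cases h' : i % 2 = n % 2
    · rw [lhR_same hi h', lhR_same hi h']
    · rw [lhR_diff hi h', lhR_diff hi h', lhR_same (i := i + 1) (by omega) (by omega)]
      have h1 := h.up i (by omega)
      have h3 : lhLo (i - 1) (lhR n f (i - 1)) = lhLo (i - 1) (f (i - 1)) := by
        rcases Nat.eq_zero_or_pos i with rfl | h0
        · simp [lhR_zero h.zero, h.zero]
        · rw [lhR_same (i := i - 1) (by omega) (by omega)]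
      rw [h3]
      omega
  · rw [lhR_out (by omega), h.out i (by omega)]

def lhExt (n s : ℕ) (f : ℕ → ℕ) (i : ℕ) : ℕ :=
  if i = n + 1 then lhLo n (f n) + s else lhR n f i

lemma LHF.ext {n f} (h : LHF n f) (s : ℕ) : LHF (n + 1) (lhExt n s f) where
  out i hi := by
    rw [lhExt, if_neg (by omega), lhR_out (by omega)]
  zero := by rw [lhExt, if_neg (by omega), lhR_zero h.zero]
  le i hi := by
    rw [lhExt, if_neg (by omega), lhExt]
    split_ifs with h1
    · obtain rfl : i = n := by omega
      rw [lhR_same le_rfl rfl, lhLo_le _ _ _ (by rintro rfl; exact h.zero)]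
      omega
    · exact h.R.le i (by omega)

def lhEquiv (n : ℕ) : ℕ × {f // LHF n f} ≃ {f // LHF (n + 1) f} where
  toFun p := ⟨lhExt n p.1 p.2.1, p.2.2.ext p.1⟩
  invFun f := (f.1 (n + 1) - lhLo n (f.1 n), ⟨lhR n f.1, by
    rw [← lhR_trunc]; exact f.2.trunc.R⟩)
  left_inv := by
    rintro ⟨s, f, h⟩
    have h1 : lhExt n s f n = f n := by
      rw [lhExt, if_neg (by omega), lhR_same le_rfl rfl]
    have h2 : lhExt n s f (n + 1) = lhLo n (f n) + s := by simp [lhExt]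
    have h3 : lhR n (lhExt n s f) = f := by
      rw [← lhR_trunc]
      rw [← h.RR]
      congr 1
      funext i
      split_ifs with hi
      · rw [lhExt, if_neg (by omega), h.RR]
      · rw [lhR_out (by omega)]
    simp only [h1, h2, h3, Nat.add_sub_cancel_left]
  right_inv := by
    rintro ⟨f, h⟩
    apply Subtype.ext
    funext i
    simp only [lhExt]
    split_ifs with hi
    · subst hi
      rw [lhR_same le_rfl rfl]
      have := h.lo n (by omega)
      omega
    · rw [← lhR_trunc n f, h.trunc.RR]
      beta_reduce
      split_ifs with h1
      · rfl
      · rw [h.out i (by omega)]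

open Finset in
def lhO (n : ℕ) (f : ℕ → ℕ) : ℕ := ∑ i ∈ range (n + 1), if i % 2 = n % 2 then f i else 0
open Finset in
def lhE (n : ℕ) (f : ℕ → ℕ) : ℕ := ∑ i ∈ range (n + 1), if i % 2 = n % 2 then 0 else f i

open Finset in
lemma lh_tele (p : ℕ) (g h : ℕ → ℕ) (h0 : h 0 = 0) (g0 : g 0 = 0) (hp : p < 2) (m : ℕ) :
    (∑ i ∈ range m, if i % 2 = p then 0 else (g (i - 1) + h (i + 1)))
      + (if m % 2 = p then g m else g (m - 1))
    = ∑ i ∈ range (m + 1), if i % 2 = p then g i + h i else 0 := by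
  induction m with
  | zero => simp [h0, g0]
  | succ m ih =>
    rw [sum_range_succ, sum_range_succ _ (m + 1), ← ih]
    by_cases hm : m % 2 = p
    · have : (m + 1) % 2 ≠ p := by omega
      simp [hm, this]
    · have : (m + 1) % 2 = p := by omega
      simp [hm, this]; ring

open Finset in
lemma lhE_ext {n f} (s : ℕ) : lhE (n + 1) (lhExt n s f) = lhO n f := by
  unfold lhE lhO
  rw [sum_range_succ]
  simp only [if_true, add_zero]
  apply sum_congr rfl
  intro i hi
  rw [mem_range] at hi
  by_cases h' : i % 2 = n % 2
  · rw [if_neg (by omega), if_pos h', lhExt, if_neg (by omega), lhR_same (by omega) h']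
  · rw [if_pos (by omega), if_neg h']

open Finset in
lemma lhO_ext {n f} (h : LHF n f) (s : ℕ) :
    lhO (n + 1) (lhExt n s f) + lhE n f = s + 2 * lhO n f := by
  have key := lh_tele (n % 2) (fun i => lhLo i (f i)) (fun i => lhUp i (f i))
    (by simp [lhUp]) (by simp [lhLo, h.zero]) (by omega) n
  simp only [if_true, lhLo_add] at key
  have e1 : 2 * lhO n f = ∑ i ∈ range (n + 1), if i % 2 = n % 2 then 2 * f i else 0 := by
    rw [lhO, mul_sum]; apply sum_congr rfl; intros; split_ifs <;> simp
  rw [e1, ← key]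
  unfold lhO lhE
  rw [sum_range_succ, sum_range_succ, sum_range_succ _ n]
  have e2 : ((n + 1) % 2 = (n + 1) % 2) = True := by simp
  have e3 : (n % 2 = (n + 1) % 2) = False := by simp; omega
  simp only [e3, if_true, if_false, add_zero]
  have e4 : lhExt n s f (n + 1) = lhLo n (f n) + s := by simp [lhExt]
  have e5 : (∑ i ∈ range n, if i % 2 = (n + 1) % 2 then lhExt n s f i else 0)
      + (∑ i ∈ range n, if i % 2 = n % 2 then 0 else f i)
      = ∑ i ∈ range n, if i % 2 = n % 2 then 0
        else lhLo (i - 1) (f (i - 1)) + lhUp (i + 1) (f (i + 1)) := by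
    rw [← sum_add_distrib]
    apply sum_congr rfl
    intro i hi
    rw [mem_range] at hi
    by_cases h' : i % 2 = n % 2
    · rw [if_neg (by omega), if_pos h', if_pos h']
    · rw [if_pos (by omega), if_neg h', if_neg h', lhExt, if_neg (by omega),
        lhR_diff (by omega) h']
      have := h.up i (by omega)
      omega
  rw [← e5, e4]
  ring

lemma lh_param (n : ℕ) : ∃ e : (Fin n → ℕ) ≃ {f // LHF n f},
    ∀ m, lhO n (e m).1 = ∑ i : Fin n, ((i : ℕ) + 1) * m i ∧ lhE n (e m).1 = ∑ i : Fin n, (i : ℕ) * m i := by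
  induction n with
  | zero =>
    have hz : LHF 0 (fun _ => 0) := ⟨fun _ _ => rfl, fun _ _ => by simp, rfl⟩
    have : Unique {f // LHF 0 f} := ⟨⟨⟨_, hz⟩⟩, by
      rintro ⟨f, h⟩
      apply Subtype.ext
      funext i
      rcases Nat.eq_zero_or_pos i with rfl | hi
      · exact h.zero
      · exact h.out i hi⟩
    refine ⟨Equiv.ofUnique _ _, fun m => ?_⟩
    have := (Equiv.ofUnique (Fin 0 → ℕ) {f // LHF 0 f} m).2.zero
    simp [lhO, lhE]
    exact this
  | succ n ih =>
    obtain ⟨e, he⟩ := ih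
    refine ⟨(Fin.consEquiv (fun _ : Fin (n + 1) => ℕ)).symm.trans
      ((Equiv.prodCongr (Equiv.refl ℕ) e).trans (lhEquiv n)), fun m => ?_⟩
    obtain ⟨h1, h2⟩ := he (Fin.tail m)
    have hv : ((Fin.consEquiv (fun _ : Fin (n + 1) => ℕ)).symm.trans
      ((Equiv.prodCongr (Equiv.refl ℕ) e).trans (lhEquiv n)) m).1
      = lhExt n (m 0) (e (Fin.tail m)).1 := rfl
    rw [hv, lhE_ext, h1]
    have h3 := lhO_ext (e (Fin.tail m)).2 (m 0)
    rw [h1, h2] at h3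
    rw [Fin.sum_univ_succ, Fin.sum_univ_succ]
    simp only [Fin.val_zero, Fin.val_succ, zero_add, one_mul, zero_mul]
    refine ⟨?_, rfl⟩
    have h4 : (∑ i : Fin n, ((i : ℕ) + 1 + 1) * m i.succ) + ∑ i : Fin n, (i : ℕ) * m i.succ
        = 2 * ∑ i : Fin n, ((i : ℕ) + 1) * m i.succ := by
      rw [Finset.mul_sum, ← Finset.sum_add_distrib]
      apply Finset.sum_congr rfl; intros; ring
    simp only [Fin.tail] at h3 ⊢
    omega

def lhFin (n : ℕ) : {f // LHF n f} ≃ {lam : Fin n → ℕ // IsLectureHall n lam} where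
  toFun f := ⟨fun i => f.1 (i + 1), by
    intro i j hij
    have h := f.2.le (i + 1) (by omega)
    simp only [hij]
    exact h⟩
  invFun lam := ⟨fun i => if h : 0 < i ∧ i ≤ n then lam.1 ⟨i - 1, by omega⟩ else 0, by
    refine ⟨fun i hi => dif_neg (by omega), fun i hi => ?_, by simp⟩
    rcases Nat.eq_zero_or_pos i with rfl | h0
    · simp
    · rw [dif_pos (by omega), dif_pos (by omega)]
      have := lam.2 ⟨i - 1, by omega⟩ ⟨i, hi⟩ (by simp; omega)
      simp only [Nat.sub_add_cancel h0] at this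
      exact this⟩
  left_inv := by
    rintro ⟨f, h⟩
    apply Subtype.ext
    funext i
    simp only
    split_ifs with hi
    · rw [Nat.sub_add_cancel hi.1]
    · rcases Nat.eq_zero_or_pos i with rfl | h0
      · exact h.zero.symm
      · exact (h.out i (by omega)).symm
  right_inv := by
    rintro ⟨lam, h⟩
    apply Subtype.ext
    funext i
    simp

lemma lhFin_sum (n : ℕ) (f : {f // LHF n f}) :
    ∑ i, (lhFin n f).1 i = lhO n f.1 + lhE n f.1 := by
  have : lhO n f.1 + lhE n f.1 = ∑ i ∈ Finset.range (n + 1), f.1 i := by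
    rw [lhO, lhE, ← Finset.sum_add_distrib]
    apply Finset.sum_congr rfl; intros; split_ifs <;> simp
  rw [this, Finset.sum_range_succ', f.2.zero, add_zero, Finset.sum_range]
  rfl

def lhMult (n : ℕ) (m : Fin n → ℕ) : Multiset ℕ :=
  ∑ i, Multiset.replicate (m i) (2 * (i : ℕ) + 1)

lemma lhMult_count (n : ℕ) (m : Fin n → ℕ) (i : Fin n) :
    (lhMult n m).count (2 * (i : ℕ) + 1) = m i := by
  simp [lhMult, Multiset.count_sum', Multiset.count_replicate, Fin.val_inj]

lemma lhMult_mem (n : ℕ) (m : Fin n → ℕ) (x : ℕ) (h : x ∈ lhMult n m) :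
    Odd x ∧ x < 2 * n := by
  rw [lhMult, Multiset.mem_sum] at h
  obtain ⟨i, -, hi⟩ := h
  rw [Multiset.eq_of_mem_replicate hi]
  exact ⟨⟨i, rfl⟩, by omega⟩

lemma lhMult_sum (n : ℕ) (m : Fin n → ℕ) :
    (lhMult n m).sum = ∑ i : Fin n, (2 * (i : ℕ) + 1) * m i := by
  rw [lhMult, ← Multiset.coe_sumAddMonoidHom, map_sum]
  simp [mul_comm]

lemma lhMult_of (n : ℕ) (s : Multiset ℕ) (h : ∀ x ∈ s, Odd x ∧ x < 2 * n) :
    lhMult n (fun i => s.count (2 * (i : ℕ) + 1)) = s := by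
  ext x
  by_cases hx : Odd x ∧ x < 2 * n
  · obtain ⟨⟨k, rfl⟩, hk⟩ := hx
    exact lhMult_count n _ ⟨k, by omega⟩
  · rw [Multiset.count_eq_zero_of_notMem (fun h' => hx (lhMult_mem _ _ _ h')),
      Multiset.count_eq_zero_of_notMem (fun h' => hx (h _ h'))]

def lhPart (n N : ℕ) : {m : Fin n → ℕ // ∑ i : Fin n, (2 * (i : ℕ) + 1) * m i = N} ≃
    {p : N.Partition // ∀ x ∈ p.parts, Odd x ∧ x < 2 * n} where
  toFun m := ⟨⟨lhMult n m.1, fun {x} hx => (lhMult_mem _ _ _ hx).1.pos, by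
    rw [lhMult_sum, m.2]⟩, lhMult_mem n m.1⟩
  invFun p := ⟨fun i => p.1.parts.count (2 * (i : ℕ) + 1), by
    rw [← lhMult_sum, lhMult_of _ _ p.2, p.1.parts_sum]⟩
  left_inv m := by
    apply Subtype.ext
    funext i
    exact lhMult_count _ _ _
  right_inv p := by
    apply Subtype.ext
    apply Nat.Partition.ext
    exact lhMult_of _ _ p.2

/-- **The lecture hall theorem**: the number of lecture hall partitions in `L_n`
with sum `N` equals the number of partitions of `N` into odd parts less than `2n`. -/
theorem lecture_hall_theorem (n N : ℕ) (hn : 0 < n) :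
    Nat.card {lam : Fin n → ℕ // IsLectureHall n lam ∧ ∑ i, lam i = N} =
    Nat.card {p : N.Partition // ∀ x ∈ p.parts, Odd x ∧ x < 2 * n} := by
  obtain ⟨e, he⟩ := lh_param n
  rw [← Nat.card_congr (lhPart n N)]
  rw [← Nat.card_congr (Equiv.subtypeSubtypeEquivSubtypeInter (IsLectureHall n)
    (fun lam => ∑ i, lam i = N))]
  symm
  apply Nat.card_congr
  refine (e.trans (lhFin n)).subtypeEquiv fun m => ?_
  rw [Equiv.trans_apply, lhFin_sum, (he m).1, (he m).2, ← Finset.sum_add_distrib]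
  apply Eq.congr _ rfl
  apply Finset.sum_congr rfl; intros; ring
end

section
/- For every positive integer n, in the ring of formal power series ℤ[[q]] one has (∑_{λ ∈ A_n} q^{|λ|}) · ∏_{i=1}^{n} (1 − q^{i+1}) = ∏_{i=1}^{n} (1 + q^{i}), i.e. the generating function of anti-lecture hall compositions in A_n is ∏_{i=1}^{n} (1+q^i)/(1−q^{i+1}). -/
/-- `lam` (0-based) is an anti-lecture hall composition in `A_n`:
`lam₀/1 ≥ lam₁/2 ≥ ⋯ ≥ lam_{n-1}/n ≥ 0`, expressed by cross-multiplying
consecutive inequalities. -/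
def IsAntiLectureHall (n : ℕ) (lam : Fin n → ℕ) : Prop :=
  ∀ i j : Fin n, (j : ℕ) = (i : ℕ) + 1 →
    lam j * ((i : ℕ) + 1) ≤ lam i * ((j : ℕ) + 1)

open PowerSeries

namespace ALH

section alg
variable {R : Type*} [CommRing R]

def qb (q : R) : ℕ → ℕ → R
  | _, 0 => 1
  | 0, (_ + 1) => 0
  | (n + 1), (m + 1) => q ^ (m + 1) * qb q n (m + 1) + qb q n m

lemma qb_zero (q : R) (n : ℕ) : qb q n 0 = 1 := by cases n <;> simp [qb]

lemma qb_succ (q : R) (n m : ℕ) :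
    qb q (n + 1) (m + 1) = q ^ (m + 1) * qb q n (m + 1) + qb q n m := by simp [qb]

lemma qb_gt (q : R) (n : ℕ) : ∀ m, n < m → qb q n m = 0 := by
  induction n with
  | zero => intro m hm; obtain ⟨k, rfl⟩ := Nat.exists_eq_succ_of_ne_zero (by omega : m ≠ 0); simp [qb]
  | succ n ih =>
    intro m hm
    obtain ⟨k, rfl⟩ := Nat.exists_eq_succ_of_ne_zero (by omega : m ≠ 0)
    rw [Nat.succ_eq_add_one, qb_succ, ih _ (by omega), ih _ (by omega)]; simp

lemma qb_self (q : R) (n : ℕ) : qb q n n = 1 := by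
  induction n with
  | zero => simp [qb]
  | succ n ih => rw [qb_succ, qb_gt q n (n+1) (by omega), ih]; simp

def pc (q c : R) (k : ℕ) : R := ∏ i ∈ Finset.range k, (1 - c * q ^ i)

lemma pc_succ' (q c : R) (k : ℕ) : pc q c (k + 1) = (1 - c) * pc q (c * q) k := by
  unfold pc
  rw [Finset.prod_range_succ', mul_comm]
  simp only [pow_zero, mul_one]
  congr 1
  apply Finset.prod_congr rfl
  intro i _
  ring

lemma pc_succ (q c : R) (k : ℕ) : pc q c (k + 1) = pc q c k * (1 - c * q ^ k) := by
  unfold pc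
  rw [Finset.prod_range_succ]

lemma pc_add (q c : R) (m k : ℕ) : pc q c (m + k) = pc q c m * pc q (c * q ^ m) k := by
  unfold pc
  rw [Finset.prod_range_add]
  congr 1
  apply Finset.prod_congr rfl
  intro i _
  ring

def pm (q b : R) (m : ℕ) : R := ∏ i ∈ Finset.range m, (-b * q ^ i)

lemma pm_scale (q b : R) (m : ℕ) : pm q (b * q) m = q ^ m * pm q b m := by
  unfold pm
  rw [← Finset.card_range m, ← Finset.prod_const, Finset.card_range, ← Finset.prod_mul_distrib]
  apply Finset.prod_congr rfl
  intro i _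
  ring

lemma pm_succ (q b : R) (m : ℕ) : pm q b (m + 1) = -b * pm q (b * q) m := by
  rw [pm_scale]
  unfold pm
  rw [Finset.prod_range_succ]
  ring

theorem qcv (q a : R) (n : ℕ) : ∀ b : R,
    ∑ m ∈ Finset.range (n + 1), qb q n m * pm q b m * pc q a m * pc q (a * b * q ^ m) (n - m)
      = pc q b n := by
  induction n with
  | zero => intro b; simp [qb, pm, pc]
  | succ n ih =>
    intro b
    rw [pc_succ', ← ih (b * q), Finset.sum_range_succ']
    let g : ℕ → R := fun m =>
      q ^ m * qb q n m * pm q b m * pc q a m * pc q (a * b * q ^ m) (n + 1 - m)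
    let t : ℕ → R := fun m =>
      qb q n m * pm q (b * q) m * pc q a m * pc q (a * (b * q) * q ^ m) (n - m)
    have h1 : ∀ m, qb q (n + 1) (m + 1) * pm q b (m + 1) * pc q a (m + 1) *
        pc q (a * b * q ^ (m + 1)) (n + 1 - (m + 1)) = g (m + 1) + -b * (1 - a * q ^ m) * t m := by
      intro m
      simp only [g, t]
      rw [qb_succ, show a * (b * q) * q ^ m = a * b * q ^ (m + 1) by ring,
        show n + 1 - (m + 1) = n - m by omega, add_mul, add_mul, add_mul]
      congr 1
      rw [pm_succ, pc_succ]
      ring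
    have h0 : qb q (n + 1) 0 * pm q b 0 * pc q a 0 *
        pc q (a * b * q ^ 0) (n + 1 - 0) = g 0 := by
      simp [g, qb_zero]
    have h2 : ∀ m ∈ Finset.range (n + 1), g m = (1 - a * b * q ^ m) * t m := by
      intro m hm
      simp only [g, t]
      rw [show n + 1 - m = (n - m) + 1 by have := Finset.mem_range.1 hm; omega, pc_succ', pm_scale,
        show a * (b * q) * q ^ m = a * b * q ^ m * q by ring]
      ring
    rw [Finset.sum_congr rfl (fun m _ => h1 m), h0, Finset.sum_add_distrib, add_right_comm,
      ← Finset.sum_range_succ' g, Finset.sum_range_succ]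
    have h3 : g (n + 1) = 0 := by simp [g, qb_gt q n (n+1) (by omega)]
    rw [h3, add_zero, Finset.sum_congr rfl h2, ← Finset.sum_add_distrib, Finset.mul_sum]
    apply Finset.sum_congr rfl
    intro m _
    simp only [t]
    ring

end alg

section gf
variable {α β : Type*}

noncomputable def GF (S : Set α) (w : α → ℕ) : PowerSeries ℤ :=
  PowerSeries.mk fun N => (((S ∩ {x | w x = N}).ncard : ℕ) : ℤ)

def FF (S : Set α) (w : α → ℕ) : Prop := ∀ N, (S ∩ {x | w x = N}).Finite

lemma GF_image (S : Set α) (w' : α → ℕ) (φ : α → β) (w : β → ℕ) (c : ℕ)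
    (hφ : Set.InjOn φ S) (hw : ∀ x ∈ S, w (φ x) = w' x + c) :
    GF (φ '' S) w = X ^ c * GF S w' := by
  ext N
  rw [PowerSeries.coeff_X_pow_mul']
  simp only [GF, PowerSeries.coeff_mk]
  split_ifs with h
  · have : φ '' S ∩ {x | w x = N} = φ '' (S ∩ {x | w' x = N - c}) := by
      ext y
      constructor
      · rintro ⟨⟨x, hx, rfl⟩, hy⟩
        refine ⟨x, ⟨hx, ?_⟩, rfl⟩
        have := hw x hx
        simp only [Set.mem_ofPred_eq] at hy ⊢
        omega
      · rintro ⟨x, ⟨hx, hy⟩, rfl⟩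
        refine ⟨⟨x, hx, rfl⟩, ?_⟩
        have := hw x hx
        simp only [Set.mem_ofPred_eq] at hy ⊢
        omega
    rw [this, Set.InjOn.ncard_image (hφ.mono Set.inter_subset_left)]
  · have : φ '' S ∩ {x | w x = N} = ∅ := by
      ext y
      simp only [Set.mem_inter_iff, Set.mem_ofPred_eq, Set.mem_empty_iff_false, iff_false]
      rintro ⟨⟨x, hx, rfl⟩, hy⟩
      have := hw x hx
      omega
    rw [this]; simp

lemma GF_union (S T : Set α) (w : α → ℕ) (hS : FF S w) (hT : FF T w) (h : Disjoint S T) :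
    GF (S ∪ T) w = GF S w + GF T w := by
  ext N
  simp only [GF, PowerSeries.coeff_mk, map_add]
  rw [Set.union_inter_distrib_right, Set.ncard_union_eq _ (hS N) (hT N)]
  · push_cast; rfl
  · exact h.mono Set.inter_subset_left Set.inter_subset_left

lemma GF_fiber (S : Set α) (w : α → ℕ) (hS : FF S w) (st : α → ℕ) (n : ℕ)
    (hst : ∀ x ∈ S, st x < n) :
    GF S w = ∑ m ∈ Finset.range n, GF (S ∩ {x | st x = m}) w := by
  classical
  ext N
  rw [map_sum]
  simp only [GF, PowerSeries.coeff_mk]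
  rw [← Nat.cast_sum]
  congr 1
  rw [Set.ncard_eq_toFinset_card _ (hS N),
    Finset.card_eq_sum_card_fiberwise (f := st) (t := Finset.range n)]
  · apply Finset.sum_congr rfl
    intro m _
    rw [← Set.ncard_coe_finset]
    congr 1
    ext x
    simp
    tauto
  · intro x hx
    simp at hx
    simpa using hst x hx.1

lemma GF_prod (S : Set α) (T : Set β) (w : α → ℕ) (v : β → ℕ) (hS : FF S w) (hT : FF T v) :
    GF (S ×ˢ T) (fun p => w p.1 + v p.2) = GF S w * GF T v := by
  classical
  ext N
  rw [PowerSeries.coeff_mul]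
  simp only [GF, PowerSeries.coeff_mk]
  have hfin : ∀ p : ℕ × ℕ, ((S ∩ {x | w x = p.1}) ×ˢ (T ∩ {x | v x = p.2})).Finite :=
    fun p => (hS p.1).prod (hT p.2)
  have : S ×ˢ T ∩ {x | w x.1 + v x.2 = N} =
      (((Finset.HasAntidiagonal.antidiagonal N).biUnion fun p => (hfin p).toFinset : Finset (α × β)) : Set _) := by
    ext ⟨x, y⟩
    simp only [Set.mem_inter_iff, Set.mem_prod, Set.mem_ofPred_eq, Finset.coe_biUnion,
      Finset.mem_coe, Finset.HasAntidiagonal.mem_antidiagonal, Set.Finite.coe_toFinset, Set.mem_iUnion]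
    constructor
    · rintro ⟨⟨h1, h2⟩, h3⟩
      exact ⟨(w x, v y), h3, ⟨h1, rfl⟩, ⟨h2, rfl⟩⟩
    · rintro ⟨p, hp, ⟨h1, h2⟩, ⟨h3, h4⟩⟩
      exact ⟨⟨h1, h3⟩, by simp only [h2, h4, hp]⟩
  rw [this, Set.ncard_coe_finset, Finset.card_biUnion]
  · push_cast
    apply Finset.sum_congr rfl
    intro p _
    rw [← Set.ncard_eq_toFinset_card _ (hfin p), Set.ncard_prod]
    push_cast; rfl
  · intro p _ p' _ hne
    rw [Function.onFun, Finset.disjoint_left]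
    rintro ⟨x, y⟩ h1 h2
    simp at h1 h2
    apply hne
    ext <;> omega

end gf

def wt (n : ℕ) (f : ℕ → ℕ) : ℕ := ∑ i ∈ Finset.range n, f i

lemma FF_of (S : Set (ℕ → ℕ)) (n : ℕ) (h : ∀ f ∈ S, ∀ i, n ≤ i → f i = 0) : FF S (wt n) := by
  intro N
  apply Set.Finite.of_finite_image (f := fun (g : ℕ → ℕ) (i : Fin n) => g i)
  · apply (Set.Finite.pi' (fun _ : Fin n => Set.finite_Iic N)).subset
    rintro _ ⟨g, ⟨hg, hw⟩, rfl⟩ i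
    simp only [Set.mem_Iic]
    rw [← (hw : wt n g = N)]
    exact Finset.single_le_sum (f := g) (fun _ _ => Nat.zero_le _) (Finset.mem_range.2 i.2)
  · rintro f ⟨hf, _⟩ g ⟨hg, _⟩ hfg
    funext i
    by_cases hi : i < n
    · exact congrFun hfg ⟨i, hi⟩
    · rw [h f hf i (by omega), h g hg i (by omega)]

def P (k m : ℕ) : Set (ℕ → ℕ) :=
  {g | (∀ i, k ≤ i → g i = 0) ∧ (∀ i, g (i + 1) ≤ g i) ∧ g 0 ≤ m}

lemma FF_P (k m : ℕ) : FF (P k m) (wt k) := FF_of _ _ fun _ hf => hf.1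

lemma GF_single (k : ℕ) : GF {(0 : ℕ → ℕ)} (wt k) = 1 := by
  ext N
  simp only [GF, PowerSeries.coeff_mk, PowerSeries.coeff_one]
  split_ifs with h
  · subst h
    have : ({(0 : ℕ → ℕ)} ∩ {x | wt k x = 0} : Set (ℕ → ℕ)) = {0} := by
      ext x; simp; rintro rfl; simp [wt]
    rw [this]; simp
  · have : ({(0 : ℕ → ℕ)} ∩ {x | wt k x = N} : Set (ℕ → ℕ)) = ∅ := by
      ext x; simp; rintro rfl; simp [wt]; omega
    rw [this]; simp

lemma P_le {k m : ℕ} {g : ℕ → ℕ} (hg : g ∈ P k m) (i : ℕ) : g i ≤ m := by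
  induction i with
  | zero => exact hg.2.2
  | succ i ih => exact (hg.2.1 i).trans ih

lemma GF_P (k m : ℕ) : GF (P k m) (wt k) = qb (X : PowerSeries ℤ) (k + m) m := by
  induction k generalizing m with
  | zero =>
    have : P 0 m = {0} := by
      ext g
      simp only [Set.mem_singleton_iff]
      constructor
      · intro h; funext i; exact h.1 i (by omega)
      · rintro rfl; simp [P]
    rw [this, GF_single, Nat.zero_add, qb_self]
  | succ k ih =>
    induction m with
    | zero =>
      have : P (k + 1) 0 = {0} := by
        ext g
        simp only [Set.mem_singleton_iff]
        constructor
        · intro h; funext i; exact Nat.le_zero.1 (P_le h i)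
        · rintro rfl; simp [P]
      rw [this, GF_single, qb_zero]
    | succ m ihm =>
      let φ : (ℕ → ℕ) → ℕ → ℕ := fun g i => Nat.casesOn i (m + 1) g
      have hP : P (k + 1) (m + 1) = P (k + 1) m ∪ φ '' P k (m + 1) := by
        ext g
        constructor
        · intro hg
          by_cases h : g 0 ≤ m
          · exact Or.inl ⟨hg.1, hg.2.1, h⟩
          · right
            refine ⟨fun i => g (i + 1), ⟨fun i hi => hg.1 _ (by omega), fun i => hg.2.1 _, P_le hg _⟩, ?_⟩
            funext i
            cases i with
            | zero => have := hg.2.2; change m + 1 = g 0; omega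
            | succ i => rfl
        · rintro (hg | ⟨g, hg, rfl⟩)
          · exact ⟨hg.1, hg.2.1, hg.2.2.trans (by omega)⟩
          · refine ⟨?_, ?_, le_refl _⟩
            · intro i hi
              cases i with
              | zero => omega
              | succ i => exact hg.1 i (by omega)
            · intro i
              cases i with
              | zero => exact hg.2.2
              | succ i => exact hg.2.1 i
      have hsub : φ '' P k (m + 1) ⊆ P (k + 1) (m + 1) := by rw [hP]; exact Set.subset_union_right
      rw [hP, GF_union _ _ _ (FF_P _ _), ihm, GF_image (P k (m+1)) (wt k) φ (wt (k+1)) (m + 1), ih,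
        show k + 1 + (m + 1) = (k + 1 + m) + 1 by ring, qb_succ,
        show k + (m + 1) = k + 1 + m by ring, add_comm]
      · intro f _ g _ hfg
        funext i
        exact congrFun hfg (i + 1)
      · intro g _
        simp only [wt]
        rw [Finset.sum_range_succ']
        rfl
      · exact FF_of _ _ fun f hf => (hsub hf).1
      · rw [Set.disjoint_left]
        rintro _ hf ⟨g, hg, rfl⟩
        have : m + 1 ≤ m := hf.2.2
        omega

def A (n : ℕ) : Set (ℕ → ℕ) :=
  {f | (∀ i, n ≤ i → f i = 0) ∧ ∀ i, f (i + 1) * (i + 1) ≤ f i * (i + 2)}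

lemma FF_A (n : ℕ) : FF (A n) (wt n) := FF_of _ _ fun _ hf => hf.1

noncomputable def st (f : ℕ → ℕ) : ℕ := sInf {i | f i ≤ i}

lemma step1 {x y i : ℕ} (h : y * (i + 1) ≤ x * (i + 2)) (hx : x ≤ i) : y ≤ x := by
  by_contra hc
  have : (x + 1) * (i + 1) ≤ y * (i + 1) := Nat.mul_le_mul_right _ (by omega)
  nlinarith

lemma st_A {n : ℕ} {f : ℕ → ℕ} (hf : f ∈ A n) : st f < n + 1 := by
  have : st f ≤ n := Nat.sInf_le (by simp [hf.1 n le_rfl])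
  omega

lemma A_tail {n : ℕ} {f : ℕ → ℕ} (hf : f ∈ A n) (j : ℕ) :
    f (st f + j) ≤ st f + j := by
  induction j with
  | zero =>
    exact Nat.sInf_mem (s := {i | f i ≤ i}) ⟨n, by simp [hf.1 n le_rfl]⟩
  | succ j ih =>
    have := step1 (hf.2 (st f + j)) ih
    rw [← add_assoc]; omega

lemma A_tail_mono {n : ℕ} {f : ℕ → ℕ} (hf : f ∈ A n) (j : ℕ) :
    f (st f + (j + 1)) ≤ f (st f + j) := step1 (hf.2 (st f + j)) (A_tail hf j)

lemma A_head {f : ℕ → ℕ} {i : ℕ} (h : i < st f) : i + 1 ≤ f i := by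
  have := Nat.notMem_of_lt_sInf h
  simp at this
  omega

def ψ (m : ℕ) (p : (ℕ → ℕ) × (ℕ → ℕ)) : ℕ → ℕ :=
  fun i => if i < m then p.1 i + (i + 1) else p.2 (i - m)

lemma ψ_lt {m : ℕ} (p) {i : ℕ} (h : i < m) : ψ m p i = p.1 i + (i + 1) := by simp [ψ, h]
lemma ψ_add (m : ℕ) (p) (i : ℕ) : ψ m p (m + i) = p.2 i := by simp [ψ]

lemma A_eq {n m : ℕ} (hm : m ≤ n) :
    A n ∩ {f | st f = m} = ψ m '' (A m ×ˢ P (n - m) m) := by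
  ext f
  constructor
  · rintro ⟨hf, hm'⟩
    have hm' : st f = m := hm'
    subst hm'
    refine ⟨(fun i => f i - (i + 1) * (if i < st f then 1 else 0) - f i * (if i < st f then 0 else 1),
      fun j => f (st f + j)), ⟨⟨?_, ?_⟩, ?_, ?_, ?_⟩, ?_⟩
    · intro i hi
      simp [show ¬ i < st f by omega]
    · intro i
      by_cases h : i + 1 < st f
      · simp only [h, show i < st f by omega, if_true]
        have h1 := A_head h
        have h2 := A_head (show i < st f by omega)
        have h3 := hf.2 i
        obtain ⟨x, hx⟩ := Nat.exists_eq_add_of_le h1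
        obtain ⟨y, hy⟩ := Nat.exists_eq_add_of_le h2
        rw [hx, hy] at h3
        rw [hx, hy]
        simp only [mul_one, mul_zero, Nat.add_sub_cancel_left, Nat.sub_zero]
        nlinarith
      · simp [h]
    · intro i hi
      exact hf.1 _ (by omega)
    · intro i
      exact A_tail_mono hf i
    · exact A_tail hf 0
    · funext i
      by_cases h : i < st f
      · rw [ψ_lt _ h]
        have := A_head h
        simp [h]
        omega
      · obtain ⟨j, rfl⟩ := Nat.exists_eq_add_of_le (not_lt.1 h)
        rw [ψ_add]
  · rintro ⟨⟨μ, ρ⟩, ⟨hμ, hρ⟩, rfl⟩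
    simp only at hμ hρ
    refine ⟨⟨?_, ?_⟩, ?_⟩
    · intro i hi
      obtain ⟨j, rfl⟩ := Nat.exists_eq_add_of_le (hm.trans hi)
      rw [ψ_add]
      exact hρ.1 j (by omega)
    · intro i
      rcases lt_trichotomy (i + 1) m with h | h | h
      · rw [ψ_lt _ h, ψ_lt _ (by omega)]
        have := hμ.2 i
        simp only
        nlinarith
      · rw [ψ_lt _ (show i < m by omega), h]
        have h1 := ψ_add m (μ, ρ) 0
        have h2 := P_le hρ 0
        simp only [add_zero] at h1
        rw [h1]
        simp only
        subst h
        nlinarith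
      · obtain ⟨j, rfl⟩ := Nat.exists_eq_add_of_le (show m ≤ i by omega)
        rw [add_assoc m, ψ_add, ψ_add]
        have := hρ.2.1 j
        simp only
        exact Nat.mul_le_mul this (by omega)
    · apply le_antisymm
      · apply Nat.sInf_le
        have h1 := ψ_add m (μ, ρ) 0
        simp only [add_zero] at h1
        simp only [Set.mem_ofPred_eq, h1]
        exact hρ.2.2
      · apply le_csInf
        · refine ⟨m, ?_⟩
          have h1 := ψ_add m (μ, ρ) 0
          simp only [add_zero] at h1
          simp only [Set.mem_ofPred_eq, h1]
          exact hρ.2.2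
        · intro i hi
          by_contra hc
          simp only [Set.mem_ofPred_eq] at hi
          rw [ψ_lt _ (by omega)] at hi
          omega

lemma GF_A (n : ℕ) : GF (A n) (wt n) = ∑ m ∈ Finset.range (n + 1),
    X ^ (∑ i ∈ Finset.range m, (i + 1)) * (GF (A m) (wt m) * qb (X : PowerSeries ℤ) n m) := by
  rw [GF_fiber _ _ (FF_A n) st (n + 1) (fun f hf => st_A hf)]
  apply Finset.sum_congr rfl
  intro m hm
  have hm : m ≤ n := by have := Finset.mem_range.1 hm; omega
  rw [A_eq hm, GF_image _ (fun p => wt m p.1 + wt (n - m) p.2) _ _ (∑ i ∈ Finset.range m, (i + 1)),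
    GF_prod _ _ _ _ (FF_A m) (FF_P _ _), GF_P, Nat.sub_add_cancel hm]
  · rintro ⟨μ, ρ⟩ ⟨hμ, hρ⟩ ⟨μ', ρ'⟩ ⟨hμ', hρ'⟩ h
    simp only at hμ hρ hμ' hρ'
    ext i
    · simp only
      by_cases hi : i < m
      · have := congrFun h i
        rw [ψ_lt _ hi, ψ_lt _ hi] at this
        simpa using this
      · rw [hμ.1 i (by omega), hμ'.1 i (by omega)]
    · have := congrFun h (m + i)
      rw [ψ_add, ψ_add] at this
      exact this
  · rintro ⟨μ, ρ⟩ _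
    simp only [wt]
    conv_lhs => rw [← Nat.add_sub_cancel' hm]
    rw [Finset.sum_range_add, Finset.sum_congr rfl
      (fun i hi => ψ_lt (μ, ρ) (Finset.mem_range.1 hi)), Finset.sum_add_distrib]
    simp only [ψ_add]
    ring

lemma main (n : ℕ) : GF (A n) (wt n) * pc (X : PowerSeries ℤ) (X ^ 2) n = pc X (-X) n := by
  induction n using Nat.strong_induction_on with
  | _ n ih =>
  rcases Nat.eq_zero_or_pos n with rfl | hn
  · have : A 0 = {0} := by
      ext g
      simp only [Set.mem_singleton_iff]
      constructor
      · intro h; funext i; exact h.1 i (by omega)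
      · rintro rfl; simp [A]
    rw [this, GF_single]; simp [pc]
  have hpm : ∀ m, pm (X : PowerSeries ℤ) (-X) m = X ^ (∑ i ∈ Finset.range m, (i + 1)) := by
    intro m
    unfold pm
    rw [← Finset.prod_pow_eq_pow_sum]
    apply Finset.prod_congr rfl
    intro i _
    ring
  have hq := qcv (X : PowerSeries ℤ) (-X) n (-X)
  have hA := GF_A n
  rw [Finset.sum_range_succ, qb_self] at hq hA
  simp only [hpm] at hq
  have hs : (∑ m ∈ Finset.range n,
      X ^ (∑ i ∈ Finset.range m, (i + 1)) * (GF (A m) (wt m) * qb (X : PowerSeries ℤ) n m)) *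
      pc (X : PowerSeries ℤ) (X ^ 2) n = ∑ m ∈ Finset.range n, qb X n m *
        X ^ (∑ i ∈ Finset.range m, (i + 1)) * pc X (-X) m *
        pc X (-X * -X * X ^ m) (n - m) := by
    rw [Finset.sum_mul]
    apply Finset.sum_congr rfl
    intro m hm
    have hm := Finset.mem_range.1 hm
    rw [← ih m hm, show (-X * -X : PowerSeries ℤ) = X ^ 2 by ring]
    conv_lhs => rw [show pc (X : PowerSeries ℤ) (X ^ 2) n = pc X (X ^ 2) (m + (n - m)) by
      rw [Nat.add_sub_cancel' hm.le], pc_add]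
    ring
  have hne : (1 - X ^ (∑ i ∈ Finset.range n, (i + 1)) : PowerSeries ℤ) ≠ 0 := by
    intro h
    have := congrArg (PowerSeries.constantCoeff (R := ℤ)) h
    have hpos : (∑ i ∈ Finset.range n, (i + 1)) ≠ 0 := by
      have := Finset.single_le_sum (f := fun i => i + 1) (fun _ _ => Nat.zero_le _)
        (Finset.mem_range.2 hn)
      omega
    simp only [map_sub, map_one, map_pow, PowerSeries.constantCoeff_X, map_zero] at this
    rw [zero_pow hpos] at this
    simp at this
  apply mul_left_cancel₀ hne
  have h0 : pc (X : PowerSeries ℤ) (-X * -X * X ^ n) (n - n) = 1 := by simp [pc]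
  rw [h0] at hq
  rw [← hs] at hq
  linear_combination (pc (X : PowerSeries ℤ) (X ^ 2) n) * hA + hq

lemma card_eq (n N : ℕ) : Nat.card {lam : Fin n → ℕ //
    IsAntiLectureHall n lam ∧ ∑ i, lam i = N} = (A n ∩ {f | wt n f = N}).ncard := by
  rw [← Nat.card_coe_set_eq]
  symm
  refine Nat.card_eq_of_bijective
    (fun f => ⟨fun i : Fin n => f.1 i, ?_, ?_⟩) ⟨?_, ?_⟩
  · intro i j hij
    have := f.2.1.2 i
    simp only [hij]; exact this
  · have : wt n f.1 = N := f.2.2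
    rw [wt, Finset.sum_range] at this
    exact this
  · rintro ⟨f, hf, _⟩ ⟨g, hg, _⟩ h
    ext i
    simp only [Subtype.mk.injEq] at h ⊢
    by_cases hi : i < n
    · exact congrFun h ⟨i, hi⟩
    · rw [hf.1 i (by omega), hg.1 i (by omega)]
  · rintro ⟨lam, h1, h2⟩
    refine ⟨⟨fun i => if h : i < n then lam ⟨i, h⟩ else 0, ⟨?_, ?_⟩, ?_⟩, ?_⟩
    · intro i hi
      simp [show ¬ i < n by omega]
    · intro i
      by_cases h : i + 1 < n
      · have := h1 ⟨i, by omega⟩ ⟨i + 1, h⟩ rfl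
        simpa [h, show i < n by omega] using this
      · simp [h]
    · simp only [Set.mem_ofPred_eq, wt]
      rw [Finset.sum_range, ← h2]
      simp
    · simp

end ALH



open PowerSeries in
/-- **The anti-lecture hall theorem**: in `ℤ[[q]]`,
`(∑_{λ ∈ A_n} q^{|λ|}) ⬝ ∏_{i=1}^n (1 - q^{i+1}) = ∏_{i=1}^n (1 + q^i)`. -/
theorem anti_lecture_hall_theorem (n : ℕ) (hn : 0 < n) :
    (PowerSeries.mk fun N =>
        (Nat.card {lam : Fin n → ℕ //
            IsAntiLectureHall n lam ∧ ∑ i, lam i = N} : ℤ)) *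
      ∏ i ∈ Finset.range n, (1 - (X : PowerSeries ℤ) ^ (i + 2)) =
    ∏ i ∈ Finset.range n, (1 + (X : PowerSeries ℤ) ^ (i + 1)) := by
  have h := ALH.main n
  simp only [ALH.GF, ALH.pc, ← ALH.card_eq] at h
  have e1 : ∀ i : ℕ, (1 - (X : PowerSeries ℤ) ^ 2 * X ^ i) = 1 - X ^ (i + 2) := by
    intro i; ring
  have e2 : ∀ i : ℕ, (1 - -(X : PowerSeries ℤ) * X ^ i) = 1 + X ^ (i + 1) := by
    intro i; ring
  simp only [e1, e2] at h
  exact h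
end

section
/- For all integers n ≥ 1 and 0 ≤ k ≤ n, the following two formal power series identities hold in ℤ[[q]]: (i) ∑_{λ ∈ L̄_{n,k}} q^{|λ|} · (q^{2n−k+1};q)_k = q^{\binom{k+1}{2}} · \binom{n}{k}_q · (−q^{n−k+1};q)_k, where L̄_{n,k} is the set of λ ∈ L_n with exactly k positive parts; and (ii) ∑_{λ ∈ A_{n,k}} q^{|λ|} · (q^{2(n−k+1)};q)_k = \binom{n}{k}_q · (−q^{n−k+1};q)_k, where A_{n,k} = {λ ∈ ℤ^k : 0 ≤ λ_1/n ≤ λ_2/(n−1) ≤ ⋯ ≤ λ_k/(n−k+1)}. -/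
open PowerSeries

/-- `lam` (0-based, length `k`) is a truncated anti-lecture hall composition in
`A_{n,k} = L_k^{(n, n-1, …, n-k+1)}`: `0 ≤ lam₁/n ≤ lam₂/(n-1) ≤ ⋯ ≤ lam_k/(n-k+1)`. -/
def IsTruncAnti (n k : ℕ) (lam : Fin k → ℕ) : Prop :=
  ∀ i j : Fin k, (j : ℕ) = (i : ℕ) + 1 →
    lam i * (n - (j : ℕ)) ≤ lam j * (n - (i : ℕ))

/-- The `q`-integer `[m]_q = 1 + q + ⋯ + q^{m-1}` in `ℤ[[q]]`. -/
noncomputable def qInt (m : ℕ) : PowerSeries ℤ := ∑ i ∈ Finset.range m, X ^ i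

/-- The `q`-factorial `[m]_q! = ∏_{i=1}^m [i]_q` in `ℤ[[q]]`. -/
noncomputable def qFact (m : ℕ) : PowerSeries ℤ := ∏ j ∈ Finset.range m, qInt (j + 1)


lemma qInt_mul (m : ℕ) : qInt m * (1 - X) = 1 - X ^ m := by
  unfold qInt
  have := geom_sum_mul_neg (X : PowerSeries ℤ) m
  simpa using this

lemma one_sub_X_pow_ne (m : ℕ) (hm : m ≠ 0) : (1 - (X : PowerSeries ℤ) ^ m) ≠ 0 := by
  intro h
  have := congrArg (PowerSeries.constantCoeff (R := ℤ)) h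
  simp [hm] at this

lemma qInt_ne (m : ℕ) : qInt (m+1) ≠ 0 := by
  intro h
  have := qInt_mul (m+1)
  rw [h, zero_mul] at this
  exact one_sub_X_pow_ne (m+1) (by omega) this.symm

lemma qFact_succ (m : ℕ) : qFact (m+1) = qFact m * qInt (m+1) := by
  simp [qFact, Finset.prod_range_succ]

lemma qFact_zero : qFact 0 = 1 := by simp [qFact]

lemma qFact_ne (m : ℕ) : qFact m ≠ 0 := by
  unfold qFact
  exact Finset.prod_ne_zero_iff.mpr fun i _ => qInt_ne i

lemma qInt_add (a b : ℕ) : qInt (a + b) = X ^ b * qInt a + qInt b := by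
  have h : (1 - (X : PowerSeries ℤ)) ≠ 0 := by simpa using one_sub_X_pow_ne 1 (by omega)
  apply mul_right_cancel₀ h
  rw [add_mul, mul_assoc, qInt_mul, qInt_mul, qInt_mul]
  ring

noncomputable def qb : ℕ → ℕ → PowerSeries ℤ
  | _, 0 => 1
  | 0, _ + 1 => 0
  | d + 1, j + 1 => X ^ (j+1) * qb d (j+1) + qb d j

lemma qb_zero (d : ℕ) : qb d 0 = 1 := by cases d <;> simp [qb]
lemma qb_succ (d j : ℕ) : qb (d+1) (j+1) = X ^ (j+1) * qb d (j+1) + qb d j := by simp [qb]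

lemma qb_lt (d : ℕ) : ∀ j, d < j → qb d j = 0 := by
  induction d with
  | zero => intro j hj; obtain ⟨j, rfl⟩ := Nat.exists_eq_succ_of_ne_zero (by omega : j ≠ 0); simp [qb]
  | succ d ih =>
    intro j hj; obtain ⟨j, rfl⟩ := Nat.exists_eq_succ_of_ne_zero (by omega : j ≠ 0)
    rw [Nat.succ_eq_add_one, qb_succ, ih _ (by omega), ih _ (by omega)]; simp

lemma qb_self (d : ℕ) : qb d d = 1 := by
  induction d with
  | zero => simp [qb]
  | succ d ih => rw [qb_succ, qb_lt _ _ (by omega), ih]; simp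

lemma qb_fact (m j : ℕ) : qb (m + j) j * (qFact j * qFact m) = qFact (m + j) := by
  suffices H : ∀ s m j, m + j = s → qb (m + j) j * (qFact j * qFact m) = qFact (m + j) from
    H _ m j rfl
  intro s
  induction s with
  | zero =>
    intro m j h
    obtain rfl : m = 0 := by omega
    obtain rfl : j = 0 := by omega
    simp [qb, qFact]
  | succ s ih =>
    intro m j h
    rcases j with _ | j
    · simp [qb_zero, qFact_zero]
    rcases m with _ | m
    · simp [qb_self, qFact_zero]
    have h1 := ih m (j+1) (by omega)
    have h2 := ih (m+1) j (by omega)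
    have e : m + 1 + (j + 1) = (m + (j+1)) + 1 := by omega
    have e2 : m + 1 + j = m + (j+1) := by omega
    rw [e2] at h2
    rw [e, qb_succ, qFact_succ (m + (j+1)), show m + (j+1) + 1 = (m+1) + (j+1) by omega,
      qInt_add, mul_add (qFact (m + (j+1)))]
    nth_rw 1 [← h1]
    rw [← h2, qFact_succ j, qFact_succ m]
    ring

lemma qb_succ' (m j : ℕ) : qb (m + j + 1) (j+1) = qb (m + j) (j+1) + X ^ m * qb (m+j) j := by
  rcases m with _ | m
  · simp [qb_self, qb_lt]
  have h0 := qb_fact (m+1) (j+1)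
  have h1 := qb_fact m (j+1)
  have h2 := qb_fact (m+1) j
  apply mul_right_cancel₀ (mul_ne_zero (qFact_ne (j+1)) (qFact_ne (m+1)))
  rw [show m + 1 + j + 1 = m + 1 + (j+1) by omega, h0]
  rw [show m + 1 + j = m + (j+1) by omega] at *
  rw [show m + 1 + (j+1) = m + (j+1) + 1 by omega, qFact_succ (m + (j+1)),
    show m + (j+1) + 1 = (j+1) + (m+1) by omega, qInt_add, mul_add (qFact (m + (j+1)))]
  nth_rw 1 [← h2]
  rw [← h1, qFact_succ j, qFact_succ m]
  ring

lemma qb_mul (m j t : ℕ) :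
    qb (m + (j + t)) j * qb (m + t) t = qb (m + (j + t)) (j + t) * qb (j + t) t := by
  apply mul_right_cancel₀ (mul_ne_zero (mul_ne_zero (qFact_ne t) (qFact_ne m)) (mul_ne_zero (qFact_ne j) (qFact_ne (j+t))))
  have h1 := qb_fact m t
  have h2 := qb_fact m (j+t)
  have h3 := qb_fact j t
  have h4 := qb_fact (m + t) j
  rw [show m + t + j = m + (j + t) by omega] at h4
  calc _ = qb (m + (j + t)) j * (qFact j * (qb (m + t) t * (qFact t * qFact m))) * qFact (j+t) := by ring
    _ = qb (m + (j + t)) (j + t) * (qFact (j+t) * qFact m) * (qb (j+t) t * (qFact t * qFact j)) := by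
      rw [h1, h4, h2, h3]
    _ = _ := by ring

lemma qb_mul' (m j t : ℕ) :
    qb (m + j) j * qb (m + (j + t)) t = qb (m + (j + t)) (j + t) * qb (j + t) t := by
  apply mul_right_cancel₀ (mul_ne_zero (mul_ne_zero (qFact_ne t) (qFact_ne m)) (mul_ne_zero (qFact_ne j) (qFact_ne (j+t))))
  have h1 := qb_fact m j
  have h2 := qb_fact m (j+t)
  have h3 := qb_fact j t
  have h4 := qb_fact (m + j) t
  rw [show m + j + t = m + (j + t) by omega] at h4
  calc _ = qb (m + (j + t)) t * (qFact t * (qb (m + j) j * (qFact j * qFact m))) * qFact (j+t) := by ring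
    _ = qb (m + (j + t)) (j + t) * (qFact (j+t) * qFact m) * (qb (j+t) t * (qFact t * qFact j)) := by
      rw [h1, h4, h2, h3]
    _ = _ := by ring

open Finset in
lemma anti_split (k : ℕ) (H H1 H2 : ℕ → ℕ → PowerSeries ℤ)
    (h : ∀ s t, s + t = k + 1 → H s t = H1 s t + H2 s t)
    (h1 : H1 0 (k+1) = 0) (h2 : H2 (k+1) 0 = 0) :
    ∑ x ∈ antidiagonal (k+1), H x.1 x.2 =
      ∑ x ∈ antidiagonal k, (H1 (x.1+1) x.2 + H2 x.1 (x.2+1)) := by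
  rw [sum_congr rfl (fun x hx => h x.1 x.2 (mem_antidiagonal.mp hx)), sum_add_distrib,
    sum_add_distrib, Finset.Nat.sum_antidiagonal_succ]
  congr 1
  · simp [h1]
  · rw [Finset.Nat.sum_antidiagonal_succ']; simp [h2]

lemma choose_two_succ (t : ℕ) : (t+1).choose 2 = t.choose 2 + t := by
  rw [Nat.choose_succ_succ' t 1]; simp; omega

open Finset in
lemma CV2 (k : ℕ) : ∀ b d : PowerSeries ℤ,
    ∑ x ∈ antidiagonal k, qb k x.2 * X ^ (x.2.choose 2) * d ^ x.2 *
      (∏ i ∈ range x.2, (1 + b * X ^ i)) * (∏ i ∈ range x.1, (1 - b * d * X ^ (x.2 + i)))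
     = ∏ i ∈ range k, (1 + d * X ^ i) := by
  induction k with
  | zero => intro b d; simp [qb]
  | succ k ih =>
    intro b d
    rw [anti_split k (fun s t => qb (k+1) t * X ^ (t.choose 2) * d ^ t *
      (∏ i ∈ range t, (1 + b * X ^ i)) * (∏ i ∈ range s, (1 - b * d * X ^ (t + i))))
      (fun s t => X ^ t * qb k t * X ^ (t.choose 2) * d ^ t *
      (∏ i ∈ range t, (1 + b * X ^ i)) * (∏ i ∈ range s, (1 - b * d * X ^ (t + i))))
      (fun s t => (if t = 0 then 0 else qb k (t-1)) * X ^ (t.choose 2) * d ^ t *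
      (∏ i ∈ range t, (1 + b * X ^ i)) * (∏ i ∈ range s, (1 - b * d * X ^ (t + i))))]
    · rw [prod_range_succ', prod_congr rfl (fun i _ => (by ring : 1 + d * X ^ (i+1) = 1 + (d * X) * X ^ i)),
        ← ih b (d * X), sum_mul]
      apply sum_congr rfl
      rintro ⟨s, t⟩ hx
      simp only [Nat.add_eq_zero_iff, one_ne_zero, and_false, if_false, Nat.add_sub_cancel]
      rw [prod_range_succ' _ s, prod_range_succ _ t, choose_two_succ,
        prod_congr rfl (fun i _ => (by ring : 1 - b * d * X ^ (t + (i+1)) = 1 - b * (d * X) * X ^ (t + i))),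
        prod_congr rfl (fun i _ => (by ring : 1 - b * d * X ^ (t + 1 + i) = 1 - b * (d * X) * X ^ (t + i)))]
      ring
    · intro s t hst
      rcases t with _ | t
      · simp [qb_zero]
      · simp only [Nat.add_eq_zero_iff, one_ne_zero, and_false, if_false, Nat.add_sub_cancel]
        rw [qb_succ]; ring
    · simp [qb_lt]
    · simp

open Finset in
lemma CV1 (k : ℕ) : ∀ b d : PowerSeries ℤ,
    ∑ x ∈ antidiagonal k, qb k x.2 * X ^ (x.2.choose 2) * d ^ x.2 *
      (∏ i ∈ range x.2, (1 + b * X ^ (x.1 + i))) * (∏ i ∈ range x.1, (1 - b * d * X ^ (k - 1 + i)))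
     = ∏ i ∈ range k, (1 + d * X ^ i) := by
  induction k with
  | zero => intro b d; simp [qb]
  | succ k ih =>
    intro b d
    rw [anti_split k (fun s t => qb (k+1) t * X ^ (t.choose 2) * d ^ t *
      (∏ i ∈ range t, (1 + b * X ^ (s + i))) * (∏ i ∈ range s, (1 - b * d * X ^ (k + 1 - 1 + i))))
      (fun s t => qb k t * X ^ (t.choose 2) * d ^ t *
      (∏ i ∈ range t, (1 + b * X ^ (s + i))) * (∏ i ∈ range s, (1 - b * d * X ^ (k + i))))
      (fun s t => (if t = 0 then 0 else X ^ s * qb k (t-1)) * X ^ (t.choose 2) * d ^ t *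
      (∏ i ∈ range t, (1 + b * X ^ (s + i))) * (∏ i ∈ range s, (1 - b * d * X ^ (k + i))))]
    · rw [prod_range_succ, ← ih (b * X) d, sum_mul]
      apply sum_congr rfl
      rintro ⟨s, t⟩ hx
      have hk : s + t = k := by simpa using hx
      simp only [Nat.add_eq_zero_iff, one_ne_zero, and_false, if_false, Nat.add_sub_cancel]
      rw [prod_range_succ _ s, prod_range_succ' _ t, choose_two_succ,
        prod_congr rfl (fun i _ => (by ring : 1 + b * X ^ (s + 1 + i) = 1 + b * X * X ^ (s + i))),
        prod_congr rfl (fun i _ => (by ring : 1 + b * X ^ (s + (i+1)) = 1 + b * X * X ^ (s + i)))]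
      have e : ∏ i ∈ range s, (1 - b * X * d * X ^ (k - 1 + i)) = ∏ i ∈ range s, (1 - b * d * X ^ (k + i)) := by
        apply prod_congr rfl
        intro i hi
        have : i < s := by simpa using hi
        rw [show k + i = (k - 1 + i) + 1 by omega]; ring
      rw [e]
      subst hk
      ring
    · intro s t hst
      rcases t with _ | t
      · simp [qb_zero]
      · simp only [Nat.add_eq_zero_iff, one_ne_zero, and_false, if_false, Nat.add_sub_cancel]
        obtain rfl : k = s + t := by omega
        rw [qb_succ']; ring
    · simp [qb_lt]
    · simp

/-! generating functions -/

noncomputable def gf {k : ℕ} (S : Set (Fin k → ℕ)) : PowerSeries ℤ :=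
  PowerSeries.mk fun N => (Set.ncard {f : Fin k → ℕ | f ∈ S ∧ ∑ i, f i = N} : ℤ)

lemma fin_sum (k N : ℕ) (S : Set (Fin k → ℕ)) : {f : Fin k → ℕ | f ∈ S ∧ ∑ i, f i = N}.Finite := by
  apply (Set.finite_Iic (fun _ : Fin k => N)).subset
  rintro f ⟨-, hf⟩ i
  rw [← hf]
  exact Finset.single_le_sum (f := f) (fun _ _ => Nat.zero_le _) (Finset.mem_univ i)

lemma gf_union {k : ℕ} (S T : Set (Fin k → ℕ)) (h : ∀ f ∈ S, f ∉ T) :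
    gf (S ∪ T) = gf S + gf T := by
  ext N
  simp only [gf, coeff_mk, map_add]
  rw [← Nat.cast_add, ← Set.ncard_union_eq _ (fin_sum _ _ _) (fin_sum _ _ _)]
  · congr 2
    ext f
    simp only [Set.mem_union, Set.mem_ofPred_eq]; tauto
  · rw [Set.disjoint_left]
    rintro f ⟨h1, -⟩ ⟨h2, -⟩
    exact h f h1 h2

lemma gf_image {k l : ℕ} (S : Set (Fin k → ℕ)) (φ : (Fin k → ℕ) → (Fin l → ℕ)) (e : ℕ)
    (hi : Function.Injective φ) (he : ∀ f, ∑ i, φ f i = ∑ i, f i + e) :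
    gf (φ '' S) = X ^ e * gf S := by
  ext N
  rw [coeff_X_pow_mul']
  simp only [gf, coeff_mk]
  split_ifs with h
  · rw [← Set.ncard_image_of_injective _ hi]
    congr 2
    ext f
    simp only [Set.mem_image, Set.mem_ofPred_eq]
    constructor
    · rintro ⟨⟨g, hg, rfl⟩, h2⟩
      exact ⟨g, ⟨hg, by rw [he] at h2; omega⟩, rfl⟩
    · rintro ⟨g, ⟨hg, h2⟩, rfl⟩
      exact ⟨⟨g, hg, rfl⟩, by rw [he]; omega⟩
  · rw [Nat.cast_eq_zero]
    convert Set.ncard_empty (Fin l → ℕ)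
    ext f
    simp only [Set.mem_image, Set.mem_ofPred_eq, Set.mem_empty_iff_false, iff_false]
    rintro ⟨⟨g, hg, rfl⟩, h2⟩
    rw [he] at h2; omega

def SL (m k c : ℕ) : Set (Fin k → ℕ) :=
  {f | (∀ i j : Fin k, (j : ℕ) = i + 1 → f i * (m + j + 1) ≤ f j * (m + i + 1)) ∧
    ∀ i : Fin k, (i : ℕ) = 0 → c ≤ f i}

def SA (n k c : ℕ) : Set (Fin k → ℕ) :=
  {f | (∀ i j : Fin k, (j : ℕ) = i + 1 → f i * (n - j) ≤ f j * (n - i)) ∧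
    ∀ i : Fin k, (i : ℕ) = 0 → c ≤ f i}

lemma gf_zero (S : Set (Fin 0 → ℕ)) (h : ∀ f, f ∈ S) : gf S = 1 := by
  ext N
  simp only [gf, coeff_mk, coeff_one]
  split_ifs with hN
  · subst hN
    norm_cast
    rw [Set.ncard_eq_one]
    refine ⟨fun _ => 0, ?_⟩
    ext f
    simp [h, eq_iff_true_of_subsingleton]
  · norm_cast
    convert Set.ncard_empty (Fin 0 → ℕ)
    ext f
    simp; omega

lemma gf_SL_step (m k c : ℕ) (hc : c ≤ m + 1) (hc1 : 1 ≤ c) :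
    gf (SL m (k+1) c) = gf (SL m (k+1) (c+1)) + X ^ c * gf (SL (m+1) k (c+1)) := by
  rw [← gf_image (SL (m+1) k (c+1)) (fun g => (Fin.cons c g : Fin (k+1) → ℕ)) c
    (Fin.cons_right_injective (α := fun _ => ℕ) c)
    (by intro f; rw [Fin.sum_univ_succ]; simp; omega), ← gf_union]
  · congr 1
    ext f
    constructor
    · rintro ⟨h1, h2⟩
      have h20 := h2 0 rfl
      by_cases h : c + 1 ≤ f 0
      · left
        refine ⟨h1, fun i hi => ?_⟩
        obtain rfl : i = 0 := Fin.ext hi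
        exact h
      · right
        have h0 : f 0 = c := by omega
        refine ⟨Fin.tail f, ⟨?_, ?_⟩, ?_⟩
        · intro i j hij
          have := h1 i.succ j.succ (by simp [hij])
          simp only [Fin.val_succ] at this
          simp only [Fin.tail]
          convert this using 2 <;> ring
        · intro i hi
          have := h1 0 i.succ (by simp [hi])
          simp only [Fin.val_succ, Fin.val_zero, hi, h0] at this
          simp only [Fin.tail]
          by_contra hlt
          have : f i.succ ≤ c := by omega
          nlinarith
        · simp only [← h0]; exact Fin.cons_self_tail f
    · rintro (⟨h1, h2⟩ | ⟨g, ⟨h1, h2⟩, rfl⟩)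
      · exact ⟨h1, fun i hi => by have := h2 i hi; omega⟩
      · refine ⟨?_, ?_⟩
        · intro i j hij
          refine Fin.cases ?_ (fun j => ?_) j hij
          · intro h; simp at h
          · intro hij
            refine Fin.cases ?_ (fun i => ?_) i hij
            · intro h
              have h' : (j : ℕ) = 0 := by simpa using h
              have := h2 j h'
              simp only [Fin.cons_zero, Fin.cons_succ, Fin.val_zero, Fin.val_succ, h']
              nlinarith
            · intro h
              have := h1 i j (by simpa using h)
              simp only [Fin.cons_succ, Fin.val_succ]
              convert this using 2 <;> ring
        · intro i hi
          obtain rfl : i = 0 := Fin.ext hi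
          simp
  · rintro f ⟨h1, h2⟩ ⟨g, hg, rfl⟩
    have := h2 0 rfl
    simp at this

lemma gf_SA_step (n k c : ℕ) (hc : c < n) (hk : k + 1 ≤ n) :
    gf (SA n (k+1) c) = gf (SA n (k+1) (c+1)) + X ^ c * gf (SA (n-1) k c) := by
  obtain ⟨n, rfl⟩ : ∃ n', n = n' + 1 := ⟨n - 1, by omega⟩
  simp only [Nat.add_sub_cancel]
  rw [← gf_image (SA n k c) (fun g => (Fin.cons c g : Fin (k+1) → ℕ)) c
    (Fin.cons_right_injective (α := fun _ => ℕ) c)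
    (by intro f; rw [Fin.sum_univ_succ]; simp; omega), ← gf_union]
  · congr 1
    ext f
    constructor
    · rintro ⟨h1, h2⟩
      have h20 := h2 0 rfl
      by_cases h : c + 1 ≤ f 0
      · left
        refine ⟨h1, fun i hi => ?_⟩
        obtain rfl : i = 0 := Fin.ext hi
        exact h
      · right
        have h0 : f 0 = c := by omega
        refine ⟨Fin.tail f, ⟨?_, ?_⟩, ?_⟩
        · intro i j hij
          have := h1 i.succ j.succ (by simp [hij])
          simp only [Fin.val_succ, Nat.add_sub_add_right] at this
          exact this
        · intro i hi
          have := h1 0 i.succ (by simp [hi])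
          simp only [Fin.val_succ, Fin.val_zero, hi, h0, Nat.add_sub_add_right, Nat.sub_zero] at this
          simp only [Fin.tail]
          by_contra hlt
          have : f i.succ + 1 ≤ c := by omega
          nlinarith
        · simp only [← h0]; exact Fin.cons_self_tail f
    · rintro (⟨h1, h2⟩ | ⟨g, ⟨h1, h2⟩, rfl⟩)
      · exact ⟨h1, fun i hi => by have := h2 i hi; omega⟩
      · refine ⟨?_, ?_⟩
        · intro i j hij
          refine Fin.cases ?_ (fun j => ?_) j hij
          · intro h; simp at h
          · intro hij
            refine Fin.cases ?_ (fun i => ?_) i hij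
            · intro h
              have h' : (j : ℕ) = 0 := by simpa using h
              have := h2 j h'
              simp only [Fin.cons_zero, Fin.cons_succ, Fin.val_zero, Fin.val_succ, h', Nat.add_sub_add_right, Nat.sub_zero]
              nlinarith
            · intro h
              have := h1 i j (by simpa using h)
              simp only [Fin.cons_succ, Fin.val_succ, Nat.add_sub_add_right]
              exact this
        · intro i hi
          obtain rfl : i = 0 := Fin.ext hi
          simp
  · rintro f ⟨h1, h2⟩ ⟨g, hg, rfl⟩
    have := h2 0 rfl
    simp at this

def EL (m k : ℕ) : ℕ := ∑ i : Fin k, (m + (i : ℕ) + 1)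
def EA (n k : ℕ) : ℕ := ∑ i : Fin k, (n - (i : ℕ))

lemma gf_SL_shift (m k : ℕ) : gf (SL m k (m+2)) = X ^ (EL m k) * gf (SL m k 1) := by
  rw [← gf_image (SL m k 1) (fun g i => g i + (m + (i : ℕ) + 1)) (EL m k)]
  · congr 1
    ext f
    constructor
    · rintro ⟨h1, h2⟩
      have hf : ∀ a (ha : a < k), m + a + 1 ≤ f ⟨a, ha⟩ := by
        intro a
        induction a with
        | zero => intro ha; have := h2 ⟨0, ha⟩ rfl; omega
        | succ a ih =>
          intro ha
          have h3 := ih (by omega)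
          have h4 := h1 ⟨a, by omega⟩ ⟨a+1, ha⟩ rfl
          simp only at h4
          by_contra hlt
          have h5 : f ⟨a+1, ha⟩ + 1 ≤ m + (a+1) + 1 := by omega
          nlinarith
      have hf' : ∀ i : Fin k, m + (i : ℕ) + 1 ≤ f i := fun i => hf i i.2
      refine ⟨fun i => f i - (m + (i : ℕ) + 1), ⟨?_, ?_⟩, ?_⟩
      · intro i j hij
        have h3 := h1 i j hij
        obtain ⟨x, hx⟩ := Nat.exists_eq_add_of_le (hf' i)
        obtain ⟨y, hy⟩ := Nat.exists_eq_add_of_le (hf' j)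
        simp only [hx, hy, Nat.add_sub_cancel_left]
        rw [hx, hy] at h3
        nlinarith
      · intro i hi
        have := h2 i hi
        simp only; omega
      · funext i
        have := hf' i
        simp only; omega
    · rintro ⟨g, ⟨h1, h2⟩, rfl⟩
      refine ⟨?_, ?_⟩
      · intro i j hij
        have := h1 i j hij
        simp only
        nlinarith
      · intro i hi
        have := h2 i hi
        simp only; omega
  · intro f g h
    funext i
    have := congrFun h i
    simpa using this
  · intro f; simp [Finset.sum_add_distrib, EL]

lemma gf_SA_shift (n k : ℕ) (hk : k ≤ n) : gf (SA n k n) = X ^ (EA n k) * gf (SA n k 0) := by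
  rw [← gf_image (SA n k 0) (fun g i => g i + (n - (i : ℕ))) (EA n k)]
  · congr 1
    ext f
    constructor
    · rintro ⟨h1, h2⟩
      have hf : ∀ a (ha : a < k), n - a ≤ f ⟨a, ha⟩ := by
        intro a
        induction a with
        | zero => intro ha; have := h2 ⟨0, ha⟩ rfl; omega
        | succ a ih =>
          intro ha
          have h3 := ih (by omega)
          have h4 := h1 ⟨a, by omega⟩ ⟨a+1, ha⟩ rfl
          simp only at h4
          obtain ⟨r, hr⟩ : ∃ r, n = a + 1 + r := ⟨n - (a+1), by omega⟩
          have e1 : n - a = r + 1 := by omega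
          have e2 : n - (a+1) = r := by omega
          rw [e1] at h3 h4
          rw [e2] at h4 ⊢
          by_contra hlt
          have h5 : f ⟨a+1, ha⟩ + 1 ≤ r := by omega
          nlinarith
      have hf' : ∀ i : Fin k, n - (i : ℕ) ≤ f i := fun i => hf i i.2
      refine ⟨fun i => f i - (n - (i : ℕ)), ⟨?_, ?_⟩, ?_⟩
      · intro i j hij
        have h3 := h1 i j hij
        obtain ⟨x, hx⟩ := Nat.exists_eq_add_of_le (hf' i)
        obtain ⟨y, hy⟩ := Nat.exists_eq_add_of_le (hf' j)
        simp only [hx, hy, Nat.add_sub_cancel_left]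
        rw [hx, hy] at h3
        nlinarith
      · intro i hi
        exact Nat.zero_le _
      · funext i
        have := hf' i
        simp only; omega
    · rintro ⟨g, ⟨h1, h2⟩, rfl⟩
      refine ⟨?_, ?_⟩
      · intro i j hij
        have := h1 i j hij
        simp only
        nlinarith
      · intro i hi
        simp only [hi]; omega
  · intro f g h
    funext i
    have := congrFun h i
    simpa using this
  · intro f; simp [Finset.sum_add_distrib, EA]

open Finset in
lemma QL (k : ℕ) : ∀ d m c, 1 ≤ c → m + 2 = c + d → gf (SL m k c) =
    ∑ x ∈ antidiagonal k, X ^ (c * x.1 + x.1.choose 2) * qb (d + x.1 - 1) x.1 *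
      (X ^ (EL (m + x.1) x.2) * gf (SL (m + x.1) x.2 1)) := by
  induction k with
  | zero =>
    intro d m c hc h
    simp only [Finset.Nat.antidiagonal_zero, sum_singleton]
    rw [gf_zero, gf_zero] <;> simp [SL, EL, qb_zero]
  | succ k ihk =>
    intro d
    induction d with
    | zero =>
      intro m c hc h
      obtain rfl : c = m + 2 := by omega
      rw [Finset.Nat.sum_antidiagonal_succ, gf_SL_shift, sum_eq_zero]
      · simp [qb_zero]
      · intro x hx; simp [qb_lt]
    | succ d ihd =>
      intro m c hc h
      rw [gf_SL_step m k c (by omega) hc, ihd m (c+1) (by omega) (by omega),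
        ihk (d+1) (m+1) (c+1) (by omega) (by omega), Finset.Nat.sum_antidiagonal_succ,
        Finset.Nat.sum_antidiagonal_succ, add_assoc, mul_sum, ← sum_add_distrib]
      congr 1
      · simp [qb_zero]
      · apply sum_congr rfl
        rintro ⟨j, t⟩ -
        simp only
        rw [show d + 1 + (j + 1) - 1 = (d + j) + 1 by omega, show d + (j+1) - 1 = d + j by omega,
          show d + 1 + j - 1 = d + j by omega, qb_succ, choose_two_succ,
          show m + 1 + j = m + (j + 1) by omega]
        ring

open Finset in
lemma QA (k : ℕ) : ∀ d n c, k ≤ n → n = c + d → gf (SA n k c) =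
    ∑ x ∈ antidiagonal k, X ^ (c * x.1) * qb d x.1 *
      (X ^ (EA (n - x.1) x.2) * gf (SA (n - x.1) x.2 0)) := by
  induction k with
  | zero =>
    intro d n c hc h
    simp only [Finset.Nat.antidiagonal_zero, sum_singleton]
    rw [gf_zero, gf_zero] <;> simp [SA, EA, qb_zero]
  | succ k ihk =>
    intro d
    induction d with
    | zero =>
      intro n c hk h
      obtain rfl : c = n := by omega
      rw [Finset.Nat.sum_antidiagonal_succ, gf_SA_shift _ _ hk, sum_eq_zero]
      · simp [qb_zero]
      · intro x hx; simp [qb_lt]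
    | succ d ihd =>
      intro n c hk h
      rw [gf_SA_step n k c (by omega) hk, ihd n (c+1) (by omega) (by omega),
        ihk d (n-1) c (by omega) (by omega), Finset.Nat.sum_antidiagonal_succ,
        Finset.Nat.sum_antidiagonal_succ, add_assoc, mul_sum, ← sum_add_distrib]
      congr 1
      · simp [qb_zero]
      · apply sum_congr rfl
        rintro ⟨j, t⟩ -
        simp only
        rw [qb_succ, show n - 1 - j = n - (j + 1) by omega]
        ring

lemma EL_eq (m t : ℕ) : EL m t = t.choose 2 + (m+1) * t := by
  induction t with
  | zero => simp [EL]
  | succ t ih =>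
    have : EL m (t+1) = EL m t + (m + t + 1) := by
      simp [EL, Fin.sum_univ_castSucc]
    rw [this, ih, choose_two_succ]; ring

lemma EA_eq (m t : ℕ) : EA (m + t) t = t.choose 2 + (m+1) * t := by
  induction t with
  | zero => simp [EA]
  | succ t ih =>
    have : EA (m + (t+1)) (t+1) = (m + t + 1) + EA (m + t) t := by
      simp only [EA, Fin.sum_univ_succ, Fin.val_zero, Fin.val_succ, ← add_assoc,
        Nat.add_sub_add_right, Nat.sub_zero]
    rw [this, ih, choose_two_succ]; ring

lemma choose_two_add (j t : ℕ) :
    (j + t + 1).choose 2 = (j+1).choose 2 + j * t + (t+1).choose 2 := by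
  induction t with
  | zero => simp
  | succ t ih =>
    rw [show j + (t + 1) + 1 = (j + t + 1) + 1 by omega, choose_two_succ, ih, choose_two_succ (t+1)]
    ring

open Finset in
lemma close_rec (k e : ℕ) (he : e ≠ 0) (G C D : PowerSeries ℤ) (F T : ℕ → ℕ → PowerSeries ℤ)
    (hG : G = ∑ x ∈ antidiagonal (k+1), F x.1 x.2)
    (hC : ∑ x ∈ antidiagonal (k+1), T x.1 x.2 = C)
    (h : ∀ j t, j + t = k → F (j+1) t * D = T (j+1) t)
    (hF : F 0 (k+1) = X ^ e * G) (hT : T 0 (k+1) = X ^ e * C) : G * D = C := by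
  rw [Finset.Nat.sum_antidiagonal_succ] at hG hC
  rw [hF] at hG
  rw [hT] at hC
  have : (∑ x ∈ antidiagonal k, F (x.1 + 1) x.2) * D = ∑ x ∈ antidiagonal k, T (x.1 + 1) x.2 := by
    rw [sum_mul]
    exact sum_congr rfl fun x hx => h x.1 x.2 (mem_antidiagonal.mp hx)
  rw [← this] at hC
  apply mul_left_cancel₀ (one_sub_X_pow_ne e he)
  linear_combination D * hG + hC

open Finset in
lemma mainA (m : ℕ) (k : ℕ) : gf (SA (m+k) k 0) * ∏ i ∈ range k, (1 - X ^ (2 * (m + 1) + i)) =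
    qb (m+k) k * ∏ i ∈ range k, (1 + X ^ (m + 1 + i)) := by
  induction k using Nat.strong_induction_on with
  | _ K ih =>
  rcases K with _ | k
  · rw [gf_zero] <;> simp [SA, qb_zero]
  refine close_rec k (EA (m + (k+1)) (k+1)) (by rw [EA_eq]; positivity) _ _ _
    (fun j t => X ^ (0 * j) * qb (m + (k + 1)) j * (X ^ EA (m + (k + 1) - j) t * gf (SA (m + (k + 1) - j) t 0)))
    (fun j t => qb (m + (k+1)) (k+1) * (qb (k+1) t * X ^ (t.choose 2) * (X ^ (m+1)) ^ t *
      (∏ i ∈ range t, (1 + X ^ (m+1) * X ^ i)) * (∏ i ∈ range j, (1 - X ^ (m+1) * X ^ (m+1) * X ^ (t + i)))))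
    (QA (k+1) (m+(k+1)) (m+(k+1)) 0 (by omega) (by omega)) ?_ ?_ ?_ ?_
  · rw [← mul_sum, CV2 (k+1) (X ^ (m+1)) (X ^ (m+1))]
    simp only [← pow_add]
  · intro j t hjt
    obtain rfl : k = j + t := hjt.symm
    have h1 := ih t (by omega)
    have h2 := qb_mul m (j+1) t
    rw [show j + 1 + t = j + t + 1 by omega] at h2
    rw [show m + (j + t + 1) - (j+1) = m + t by omega, EA_eq,
      show range (j + t + 1) = range (t + (j+1)) by congr 1; omega, prod_range_add]
    simp only [← pow_add]
    rw [prod_congr rfl (fun i _ => (by congr 2; ring :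
      1 - (X : PowerSeries ℤ) ^ (2 * (m+1) + (t + i)) = 1 - X ^ (m + 1 + (m+1) + (t + i))))]
    generalize ∏ i ∈ range (j+1), (1 - (X : PowerSeries ℤ) ^ (m + 1 + (m+1) + (t + i))) = P at *
    rw [zero_mul, pow_zero, pow_add, pow_mul]
    linear_combination (qb (m + (j + t + 1)) (j+1) * X ^ (t.choose 2) * (X ^ (m+1)) ^ t * P) * h1 +
      (X ^ (t.choose 2) * (X ^ (m+1)) ^ t * P * ∏ i ∈ range t, (1 + X ^ (m + 1 + i))) * h2
  · simp [qb_zero]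
  · simp only [EA_eq, qb_self, prod_range_zero, ← pow_add, ← pow_mul]
    ring

open Finset in
lemma mainL (k : ℕ) : ∀ m : ℕ,
    gf (SL m k 1) * ∏ i ∈ range k, (1 - X ^ (2 * m + k + 1 + i)) =
    X ^ ((k+1).choose 2) * qb (m+k) k * ∏ i ∈ range k, (1 + X ^ (m + 1 + i)) := by
  induction k using Nat.strong_induction_on with
  | _ K ih =>
  intro m
  rcases K with _ | k
  · rw [gf_zero] <;> simp [SL, qb_zero]
  refine close_rec k (EL m (k+1)) (by rw [EL_eq]; positivity) _ _ _
    (fun j t => X ^ (1 * j + j.choose 2) * qb (m + 1 + j - 1) j * (X ^ EL (m + j) t * gf (SL (m + j) t 1)))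
    (fun j t => X ^ ((k+2).choose 2) * qb (m + (k+1)) (k+1) *
      (qb (k+1) t * X ^ (t.choose 2) * (X ^ (m+1)) ^ t *
      (∏ i ∈ range t, (1 + X ^ (m+1) * X ^ (j + i))) *
      (∏ i ∈ range j, (1 - X ^ (m+1) * X ^ (m+1) * X ^ (k + 1 - 1 + i)))))
    (QL (k+1) (m+1) m 1 le_rfl (by omega)) ?_ ?_ ?_ ?_
  · rw [← mul_sum, CV1 (k+1) (X ^ (m+1)) (X ^ (m+1))]
    simp only [← pow_add]
  · intro j t hjt
    obtain rfl : k = j + t := hjt.symm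
    have h1 := ih t (by omega) (m + (j+1))
    have h2 := qb_mul' m (j+1) t
    rw [show m + (j + 1) + t = m + (j + t + 1) by omega] at h1
    rw [show j + 1 + t = j + t + 1 by omega] at h2
    have e0 : (j + t + 2).choose 2 = (j+2).choose 2 + (j+1) * t + (t+1).choose 2 := by
      rw [← choose_two_add]; congr 1; omega
    rw [show m + 1 + (j+1) - 1 = m + (j+1) by omega, EL_eq,
      show range (j + t + 1) = range ((j+1) + t) by congr 1; omega, prod_range_add, e0,
      choose_two_succ (j+1)]
    simp only [← pow_add, Nat.add_sub_cancel]
    rw [prod_congr rfl (fun i _ => (by congr 2; ring :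
      1 - (X : PowerSeries ℤ) ^ (2 * m + (j + t + 1) + 1 + i) = 1 - X ^ (m + 1 + (m+1) + (j + t + i))))]
    rw [prod_congr rfl (fun i _ => (by congr 2; ring :
      1 - (X : PowerSeries ℤ) ^ (2 * m + (j + t + 1) + 1 + (j + 1 + i)) = 1 - X ^ (2 * (m + (j+1)) + t + 1 + i)))]
    rw [prod_congr rfl (fun i _ => (by congr 2; ring :
      1 + (X : PowerSeries ℤ) ^ (m + 1 + (j + 1 + i)) = 1 + X ^ (m + (j+1) + 1 + i)))]
    generalize ∏ i ∈ range (j+1), (1 - (X : PowerSeries ℤ) ^ (m + 1 + (m+1) + (j + t + i))) = P at *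
    generalize ∏ i ∈ range t, (1 - (X : PowerSeries ℤ) ^ (2 * (m + (j+1)) + t + 1 + i)) = P' at *
    generalize ∏ i ∈ range t, (1 + (X : PowerSeries ℤ) ^ (m + (j+1) + 1 + i)) = P'' at *
    have e1 : (X : PowerSeries ℤ) ^ ((m + (j+1) + 1) * t) = (X ^ (m+1)) ^ t * X ^ ((j+1) * t) := by ring
    have e2 : (X : PowerSeries ℤ) ^ (1 * (j+1) + (j+1).choose 2) = X ^ ((j+1).choose 2 + (j+1)) := by
      congr 1; ring
    rw [e2]
    simp only [pow_add _ (t.choose 2), e1, pow_add _ _ ((t+1).choose 2), pow_add _ _ ((j+1)*t)]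
    generalize (X : PowerSeries ℤ) ^ ((j+1).choose 2 + (j+1)) = Y1 at *
    generalize (X : PowerSeries ℤ) ^ ((t+1).choose 2) = Y2 at *
    generalize (X : PowerSeries ℤ) ^ ((j+1) * t) = Y3 at *
    linear_combination (Y1 * qb (m + (j + 1)) (j+1) * X ^ (t.choose 2) * ((X ^ (m+1)) ^ t * Y3) * P) * h1 +
      (Y1 * Y2 * Y3 * X ^ (t.choose 2) * (X ^ (m+1)) ^ t * P * P'') * h2
  · simp [qb_zero]
  · simp only [EL_eq, qb_self, prod_range_zero, ← pow_add, ← pow_mul, zero_add]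
    ring

lemma lh_mono {n : ℕ} {lam : Fin n → ℕ} (h : IsLectureHall n lam) (i : Fin n) (hi : 0 < lam i) :
    ∀ b (hb : b < n), (i : ℕ) ≤ b → 0 < lam ⟨b, hb⟩ := by
  intro b
  induction b with
  | zero => intro hb h0; convert hi; omega
  | succ b ih =>
    intro hb hib
    rcases Nat.lt_or_ge b i with h1 | h1
    · convert hi; omega
    · have h2 := ih (by omega) h1
      have h3 := h ⟨b, by omega⟩ ⟨b+1, hb⟩ rfl
      by_contra h4
      have h5 : lam ⟨b+1, hb⟩ = 0 := by omega
      rw [h5] at h3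
      simp at h3
      omega

lemma link (m k : ℕ) : {lam : Fin (m + k) → ℕ | IsLectureHall (m + k) lam ∧
      (Finset.univ.filter fun i => 0 < lam i).card = k} =
    (fun g => (Fin.append (fun _ => 0) g : Fin (m + k) → ℕ)) '' SL m k 1 := by
  have hcard : ∀ (m k : ℕ), (Finset.univ.filter fun i : Fin (m + k) => m ≤ (i : ℕ)).card = k := by
    intro m k
    have : (Finset.univ.filter fun i : Fin (m + k) => m ≤ (i : ℕ)) =
        Finset.univ.map (Fin.natAddEmb m : Fin k ↪ Fin (m + k)) := by
      ext i
      simp only [Finset.mem_filter, Finset.mem_univ, true_and, Finset.mem_map, Fin.natAddEmb_apply]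
      constructor
      · intro h
        exact ⟨⟨i - m, by omega⟩, by ext; simp; omega⟩
      · rintro ⟨j, rfl⟩; simp
    rw [this]; simp
  ext lam
  constructor
  · rintro ⟨h1, h2⟩
    have key : ∀ i : Fin (m + k), 0 < lam i ↔ m ≤ (i : ℕ) := by
      have hsub : (Finset.univ.filter fun i => 0 < lam i) ⊆
          (Finset.univ.filter fun i : Fin (m + k) => m ≤ (i : ℕ)) := by
        intro i hi
        simp only [Finset.mem_filter, Finset.mem_univ, true_and] at hi ⊢
        by_contra hlt
        have hs : insert i (Finset.univ.filter fun i : Fin (m + k) => m ≤ (i : ℕ)) ⊆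
            (Finset.univ.filter fun i => 0 < lam i) := by
          intro j hj
          simp only [Finset.mem_insert, Finset.mem_filter, Finset.mem_univ, true_and] at hj ⊢
          rcases hj with rfl | hj
          · exact hi
          · exact lh_mono h1 i hi j j.2 (by omega)
        have := Finset.card_le_card hs
        rw [Finset.card_insert_of_notMem (by simpa using hlt), hcard, h2] at this
        omega
      have heq := Finset.eq_of_subset_of_card_le hsub (by rw [hcard, h2])
      intro i
      have := Finset.ext_iff.mp heq i
      simpa using this
    refine ⟨fun i => lam (Fin.natAdd m i), ⟨?_, ?_⟩, ?_⟩
    · intro i j hij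
      have := h1 (Fin.natAdd m i) (Fin.natAdd m j) (by simp; omega)
      simpa using this
    · intro i hi
      exact (key _).2 (by simp)
    · funext i
      refine Fin.addCases (fun i => ?_) (fun i => ?_) i
      · have := key (Fin.castAdd k i)
        simp only [Fin.append_left]
        simp only [Fin.val_castAdd] at this
        have := i.2
        omega
      · simp
  · rintro ⟨g, ⟨h1, h2⟩, rfl⟩
    have hpos : ∀ a (ha : a < k), 0 < g ⟨a, ha⟩ := by
      intro a
      induction a with
      | zero => intro ha; exact h2 ⟨0, ha⟩ rfl
      | succ a ih =>
        intro ha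
        have h3 := ih (by omega)
        have h4 := h1 ⟨a, by omega⟩ ⟨a+1, ha⟩ rfl
        by_contra h5
        have h6 : g ⟨a+1, ha⟩ = 0 := by omega
        rw [h6] at h4
        simp at h4
        omega
    refine ⟨?_, ?_⟩
    · intro i j hij
      refine Fin.addCases (fun i hij => ?_) (fun i hij => ?_) i hij
      · simp
      · have hj : m ≤ (j : ℕ) := by simp at hij; omega
        obtain ⟨j', rfl⟩ : ∃ j' : Fin k, j = Fin.natAdd m j' := ⟨⟨j - m, by omega⟩, by ext; simp; omega⟩
        have := h1 i j' (by simp at hij; omega)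
        simpa using this
    · refine Eq.trans ?_ (hcard m k)
      congr 1
      ext i
      simp only [Finset.mem_filter, Finset.mem_univ, true_and]
      refine Fin.addCases (fun i => ?_) (fun i => ?_) i
      · simp
      · simpa using hpos i i.2

/-- **Corteel–Savage** generating functions for truncated (anti-)lecture hall
partitions.  Both identities are stated in `ℤ[[q]]`, with denominators cleared:
since `binom(n,k)_q = [n]_q! / ([k]_q! [n-k]_q!)`, identity (i)
`∑_{λ ∈ L̄_{n,k}} q^{|λ|} (q^{2n-k+1};q)_k = q^{binom(k+1,2)} binom(n,k)_q (-q^{n-k+1};q)_k`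
is stated multiplied through by `[k]_q! [n-k]_q!`, and similarly for (ii). -/
theorem truncated_generating_functions (n k : ℕ) (hn : 1 ≤ n) (hk : k ≤ n) :
    ((PowerSeries.mk fun N =>
        (Nat.card {lam : Fin n → ℕ // IsLectureHall n lam ∧
            (Finset.univ.filter fun i => 0 < lam i).card = k ∧ ∑ i, lam i = N} : ℤ)) *
      (∏ i ∈ Finset.range k, (1 - (X : PowerSeries ℤ) ^ (2 * n - k + 1 + i))) *
      (qFact k * qFact (n - k)) =
      (X : PowerSeries ℤ) ^ (k * (k + 1) / 2) * qFact n *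
        ∏ i ∈ Finset.range k, (1 + (X : PowerSeries ℤ) ^ (n - k + 1 + i)))
    ∧
    ((PowerSeries.mk fun N =>
        (Nat.card {lam : Fin k → ℕ // IsTruncAnti n k lam ∧ ∑ i, lam i = N} : ℤ)) *
      (∏ i ∈ Finset.range k, (1 - (X : PowerSeries ℤ) ^ (2 * (n - k + 1) + i))) *
      (qFact k * qFact (n - k)) =
      qFact n * ∏ i ∈ Finset.range k, (1 + (X : PowerSeries ℤ) ^ (n - k + 1 + i))) := by
  obtain ⟨m, rfl⟩ : ∃ m, n = m + k := ⟨n - k, by omega⟩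
  have hq := qb_fact m k
  rw [Nat.add_sub_cancel]
  constructor
  · have h1 : (PowerSeries.mk fun N =>
        (Nat.card {lam : Fin (m + k) → ℕ // IsLectureHall (m + k) lam ∧
            (Finset.univ.filter fun i => 0 < lam i).card = k ∧ ∑ i, lam i = N} : ℤ)) =
        gf (SL m k 1) := by
      have h2 := gf_image (SL m k 1) (fun g => (Fin.append (fun _ => 0) g : Fin (m + k) → ℕ)) 0
        (by
          intro f g h
          funext i
          have := congrFun h (Fin.natAdd m i)
          simpa using this)
        (by intro f; simp [Fin.sum_univ_add])
      rw [pow_zero, one_mul, ← link] at h2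
      rw [← h2]
      ext N
      simp only [gf, coeff_mk, ← Nat.card_coe_set_eq]
      congr 1
      apply Nat.card_congr
      exact Equiv.subtypeEquivRight fun f => by
        simp only [Set.mem_ofPred_eq, and_assoc]
    rw [h1, show 2 * (m + k) - k + 1 = 2 * m + k + 1 by omega, mainL, ← hq, Nat.choose_two_right,
      Nat.add_sub_cancel, mul_comm (k+1) k]
    ring
  · have h1 : (PowerSeries.mk fun N =>
        (Nat.card {lam : Fin k → ℕ // IsTruncAnti (m + k) k lam ∧ ∑ i, lam i = N} : ℤ)) =
        gf (SA (m + k) k 0) := by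
      ext N
      simp only [gf, coeff_mk, ← Nat.card_coe_set_eq]
      congr 1
      apply Nat.card_congr
      exact Equiv.subtypeEquivRight fun f => by
        simp [SA, IsTruncAnti]
    rw [h1, mainA, ← hq]
    ring
end

section
/- Let k, ℓ be positive integers with kℓ ≥ 4. Define sequences a^{(k,ℓ)} by a^{(k,ℓ)}_0 = 0, a^{(k,ℓ)}_1 = 1, a^{(k,ℓ)}_{2i} = ℓ a^{(k,ℓ)}_{2i−1} − a^{(k,ℓ)}_{2i−2}, and a^{(k,ℓ)}_{2i+1} = k a^{(k,ℓ)}_{2i} − a^{(k,ℓ)}_{2i−1}, and similarly a^{(ℓ,k)} with the roles of k and ℓ exchanged. For m ≥ 1, let G_m^{(k,ℓ)} = {λ ∈ ℤ^m : λ_1/a^{(k,ℓ)}_m ≥ λ_2/a^{(k,ℓ)}_{m−1} ≥ ⋯ ≥ λ_m/a^{(k,ℓ)}_1 ≥ 0}, and for λ ∈ G_m^{(k,ℓ)} set |λ|_o = λ_1 + λ_3 + ⋯ and |λ|_e = λ_2 + λ_4 + ⋯. Then, as identities of formal power series in ℤ[[x,y]]: for every n ≥ 1, ∑_{λ ∈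 G_{2n}^{(k,ℓ)}} x^{|λ|_o} y^{|λ|_e} · ∏_{i=1}^{2n} (1 − x^{a^{(k,ℓ)}_i} y^{a^{(ℓ,k)}_{i−1}}) = 1, and ∑_{λ ∈ G_{2n−1}^{(k,ℓ)}} x^{|λ|_o} y^{|λ|_e} · ∏_{i=1}^{2n−1} (1 − x^{a^{(ℓ,k)}_i} y^{a^{(k,ℓ)}_{i−1}}) = 1. -/
open MvPowerSeries

/-- `lam` (0-based, length `m`) lies in `G_m^{(a)}` for the weight sequence `a`:
`lam₁/a_m ≥ lam₂/a_{m-1} ≥ ⋯ ≥ lam_m/a_1 ≥ 0`. -/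
def GCond (a : ℕ → ℕ) (m : ℕ) (lam : Fin m → ℕ) : Prop :=
  ∀ i j : Fin m, (j : ℕ) = (i : ℕ) + 1 →
    lam j * a (m - (i : ℕ)) ≤ lam i * a (m - (j : ℕ))

/-- The two-variable generating function `∑_{λ ∈ G_m^{(a)}} x^{|λ|_o} y^{|λ|_e}`
in `ℤ[[x, y]]` (variable `0` is `x`, variable `1` is `y`): the coefficient of
`x^{d 0} y^{d 1}` is the number of `λ ∈ G_m^{(a)}` with odd-indexed sum `d 0` and
even-indexed sum `d 1`. -/
noncomputable def Ggf (a : ℕ → ℕ) (m : ℕ) : MvPowerSeries (Fin 2) ℤ := fun d =>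
  (Nat.card {lam : Fin m → ℕ // GCond a m lam ∧
      (∑ i ∈ Finset.univ.filter fun i : Fin m => (i : ℕ) % 2 = 0, lam i) = d 0 ∧
      (∑ i ∈ Finset.univ.filter fun i : Fin m => (i : ℕ) % 2 = 1, lam i) = d 1} : ℤ)

namespace LH

def dn (a : ℕ → ℕ) (i t : ℕ) : ℕ := a i * t / a (i + 1)

def up (a c : ℕ → ℕ) : ℕ → ℕ → ℕ
  | 0, _ => 0
  | (i + 1), t => c i * t - dn a i t

def S : ℕ → (ℕ → ℕ) → ℕ
  | 0, _ => 0
  | 1, u => u 1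
  | (m + 2), u => u (m + 2) + S m u

structure Hyp (a c : ℕ → ℕ) : Prop where
  a0 : a 0 = 0
  pos : ∀ j, 0 < a (j + 1)
  c2 : ∀ j, c (j + 2) = c j
  rec' : ∀ j, a (j + 2) + a j = c j * a (j + 1)

variable {a c : ℕ → ℕ}

lemma le_dn (h : Hyp a c) (i x t : ℕ) : x ≤ dn a i t ↔ x * a (i + 1) ≤ t * a i := by
  unfold dn
  rw [Nat.le_div_iff_mul_le (h.pos i), mul_comm t]

lemma dn_le (h : Hyp a c) (i t : ℕ) : dn a i t ≤ c i * t := by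
  unfold dn
  apply Nat.div_le_of_le_mul
  have := h.rec' i
  nlinarith [Nat.zero_le (a (i+2)), Nat.zero_le (a (i+2) * t)]

lemma up_add_dn (h : Hyp a c) (i t : ℕ) : up a c (i + 1) t + dn a i t = c i * t := by
  have := dn_le h i t
  simp only [up]; omega

lemma up_le (h : Hyp a c) (i x t : ℕ) (h0 : i = 0 → t = 0) :
    up a c i t ≤ x ↔ t * a (i + 1) ≤ x * a i := by
  cases i with
  | zero => simp [up, h0 rfl]
  | succ i =>
    simp only [up]
    rw [Nat.sub_le_iff_le_add, ← Nat.sub_le_iff_le_add', le_dn h, Nat.sub_mul,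
      Nat.sub_le_iff_le_add]
    have h1 := h.rec' i
    have h2 : c i * t * a (i + 1) = t * a (i + 2) + t * a i := by
      rw [← mul_add, h1]; ring
    rw [h2]
    constructor <;> intro h3 <;> linarith

def GP (a : ℕ → ℕ) (m : ℕ) (u : ℕ → ℕ) : Prop :=
  u 0 = 0 ∧ (∀ j, m < j → u j = 0) ∧ ∀ j, j < m → u j * a (j + 1) ≤ u (j + 1) * a j

lemma S_congr (m : ℕ) (u v : ℕ → ℕ) (h : ∀ j ≤ m, (m - j) % 2 = 0 → u j = v j) :
    S m u = S m v := by
  induction m using Nat.twoStepInduction with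
  | zero => rfl
  | one => exact h 1 le_rfl rfl
  | more m ih _ =>
    simp only [S]
    rw [h (m+2) le_rfl (by simp), ih (fun j hj hj' => h j (by omega) (by omega))]

lemma S_pred (m : ℕ) (u : ℕ → ℕ) : S (m + 1) u = u (m + 1) + S (m - 1) u := by
  cases m <;> simp [S]

lemma S_key (h : Hyp a c) (m : ℕ) (u v : ℕ → ℕ)
    (hv : ∀ j, 0 < j → j < m → (m - j) % 2 = 1 →
      v j + u j = up a c (j - 1) (u (j - 1)) + dn a j (u (j + 1))) :
    S (m - 1) u + S (m - 1) v + up a c m (u m) = c (m + 1) * S m u := by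
  induction m using Nat.twoStepInduction with
  | zero => simp [S, up]
  | one => simp [S, up, dn, h.a0, h.c2]
  | more m ih _ =>
    have h1 := ih (fun j h0 hj hj' => hv j h0 (by omega) (by omega))
    have h2 := hv (m + 1) (by omega) (by omega) (by omega)
    have h3 := up_add_dn h (m + 1) (u (m + 2))
    have h4 := h.c2 (m + 1)
    simp only [Nat.add_sub_cancel, show m + 2 - 1 = m + 1 from rfl, S_pred m, S] at *
    rw [show m + 2 + 1 = m + 1 + 2 from rfl, h4, mul_add]
    linarith

def R (a c : ℕ → ℕ) (m : ℕ) (u : ℕ → ℕ) (j : ℕ) : ℕ :=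
  if 0 < j ∧ j < m ∧ (m - j) % 2 = 1 then
    up a c (j - 1) (u (j - 1)) + dn a j (u (j + 1)) - u j else u j

lemma R_pos (m : ℕ) (u : ℕ → ℕ) (j : ℕ) (h : 0 < j ∧ j < m ∧ (m - j) % 2 = 1) :
    R a c m u j = up a c (j - 1) (u (j - 1)) + dn a j (u (j + 1)) - u j := if_pos h

lemma R_neg (m : ℕ) (u : ℕ → ℕ) (j : ℕ) (h : ¬ (0 < j ∧ j < m ∧ (m - j) % 2 = 1)) :
    R a c m u j = u j := if_neg h

lemma bounds (h : Hyp a c) {m : ℕ} {u : ℕ → ℕ} (hu : GP a m u) (j : ℕ) (h0 : 0 < j) (hj : j < m) :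
    up a c (j - 1) (u (j - 1)) ≤ u j ∧ u j ≤ dn a j (u (j + 1)) := by
  obtain ⟨j, rfl⟩ : ∃ i, j = i + 1 := ⟨j - 1, by omega⟩
  refine ⟨?_, (le_dn h _ _ _).2 (hu.2.2 _ hj)⟩
  exact (up_le h _ _ _ (by rintro h1; simp at h1; subst h1; exact hu.1)).2 (hu.2.2 j (by omega))

lemma R_GP (h : Hyp a c) {m : ℕ} {u : ℕ → ℕ} (hu : GP a m u) : GP a m (R a c m u) := by
  refine ⟨?_, ?_, ?_⟩
  · rw [R_neg _ _ _ (by omega)]; exact hu.1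
  · intro j hj
    rw [R_neg _ _ _ (by omega)]; exact hu.2.1 j hj
  · intro j hj
    by_cases h1 : 0 < j ∧ j < m ∧ (m - j) % 2 = 1
    · have := bounds h hu j h1.1 h1.2.1
      rw [← le_dn h, R_pos _ _ _ h1, R_neg _ _ (j + 1) (by omega)]
      omega
    · rw [R_neg _ _ _ h1]
      by_cases h2 : 0 < j + 1 ∧ j + 1 < m ∧ (m - (j + 1)) % 2 = 1
      · have := bounds h hu (j + 1) h2.1 h2.2.1
        rw [← up_le h _ _ _ (by rintro rfl; exact hu.1), R_pos _ _ _ h2]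
        simp only [Nat.add_sub_cancel] at *
        omega
      · rw [R_neg _ _ _ h2]
        exact hu.2.2 j hj

lemma R_invol (h : Hyp a c) {m : ℕ} {u : ℕ → ℕ} (hu : GP a m u) :
    R a c m (R a c m u) = u := by
  funext j
  by_cases h1 : 0 < j ∧ j < m ∧ (m - j) % 2 = 1
  · have := bounds h hu j h1.1 h1.2.1
    rw [R_pos _ _ _ h1, R_pos _ _ j h1, R_neg _ _ (j - 1) (by omega), R_neg _ _ (j + 1) (by omega)]
    omega
  · rw [R_neg _ _ _ h1, R_neg _ _ _ h1]

def Requiv (h : Hyp a c) (m : ℕ) : {u // GP a m u} ≃ {u // GP a m u} where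
  toFun u := ⟨R a c m u.1, R_GP h u.2⟩
  invFun u := ⟨R a c m u.1, R_GP h u.2⟩
  left_inv u := Subtype.ext (R_invol h u.2)
  right_inv u := Subtype.ext (R_invol h u.2)

def Tequiv (h : Hyp a c) (m : ℕ) : {u // GP a (m + 1) u} ≃ ℕ × {u // GP a m u} where
  toFun u := (u.1 (m + 1) - up a c m (u.1 m), ⟨fun j => if j ≤ m then u.1 j else 0, by
    obtain ⟨u, h1, h2, h3⟩ := u
    refine ⟨by simp [h1], fun j hj => if_neg (by omega), fun j hj => ?_⟩
    simp only [if_pos hj.le, if_pos (show j + 1 ≤ m from hj)]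
    exact h3 j (by omega)⟩)
  invFun p := ⟨fun j => if j ≤ m then p.2.1 j else if j = m + 1 then p.1 + up a c m (p.2.1 m) else 0, by
    obtain ⟨s, u, h1, h2, h3⟩ := p
    refine ⟨by simp [h1], fun j hj => ?_, fun j hj => ?_⟩
    · simp only [if_neg (show ¬ j ≤ m by omega), if_neg (show ¬ j = m + 1 by omega)]
    · simp only [if_pos (show j ≤ m by omega)]
      by_cases hj' : j + 1 ≤ m
      · simp only [if_pos hj']; exact h3 j hj'
      · have : j = m := by omega
        subst this
        simp only [if_neg hj', if_true]
        rw [← up_le h _ _ _ (by rintro rfl; exact h1)]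
        omega⟩
  left_inv u := by
    obtain ⟨u, h1, h2, h3⟩ := u
    apply Subtype.ext
    funext j
    have := (up_le h m (u (m+1)) (u m) (by rintro rfl; exact h1)).2 (h3 m (by omega))
    simp only [le_refl, if_true]
    split_ifs with h4 h5
    · rfl
    · subst h5; omega
    · rw [h2 j (by omega)]
  right_inv p := by
    obtain ⟨s, u, h1, h2, h3⟩ := p
    simp only [le_refl, if_true, Prod.mk.injEq]
    refine ⟨by simp, ?_⟩
    apply Subtype.ext
    funext j
    dsimp only
    split_ifs with h4
    · rfl
    · rw [h2 j (by omega)]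

def E (h : Hyp a c) (m : ℕ) : {u // GP a (m + 1) u} ≃ ℕ × {u // GP a m u} :=
  (Tequiv h m).trans ((Equiv.refl ℕ).prodCongr (Requiv h m))

lemma E_odd (h : Hyp a c) (m : ℕ) (u : {u // GP a (m + 1) u}) :
    S m u.1 = S m (E h m u).2.1 := by
  apply S_congr
  intro j hj hj'
  change _ = R a c m _ j
  rw [R_neg _ _ _ (by omega)]
  exact (if_pos hj).symm

lemma E_even (h : Hyp a c) (m : ℕ) (u : {u // GP a (m + 1) u}) :
    S (m + 1) u.1 + S (m - 1) (E h m u).2.1 = (E h m u).1 + c (m + 1) * S m (E h m u).2.1 := by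
  have e1 : (E h m u).1 = u.1 (m + 1) - up a c m (u.1 m) := rfl
  have e2 : (E h m u).2.1 = R a c m (Tequiv h m u).2.1 := rfl
  have e3 : ∀ j ≤ m, (Tequiv h m u).2.1 j = u.1 j := fun j hj => if_pos hj
  rw [← E_odd, S_pred, e1, ← S_key h m u.1 (E h m u).2.1]
  · have := (up_le h m (u.1 (m+1)) (u.1 m) (by rintro rfl; exact u.2.1)).2 (u.2.2.2 m (by omega))
    omega
  · intro j h0 hj hj'
    rw [e2, R_pos _ _ _ ⟨h0, hj, hj'⟩, e3 _ (by omega), e3 _ (by omega), e3 _ (by omega)]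
    have := bounds h u.2 j h0 (by omega)
    omega

lemma main_bij (h : Hyp a c) (P : ℕ → ℕ → ℕ) (P0 : ∀ m, P m 0 = 0) (P1 : ∀ m, P m 1 = 1)
    (P2 : ∀ m, P (m + 2) = P m)
    (hP : ∀ m i, P (m + 1) (i + 2) + P (m + 1) i = c (m + 1) * P m (i + 1)) (m : ℕ) :
    ∃ e : {u // GP a m u} ≃ (Fin m → ℕ), ∀ u, S m u.1 = ∑ i : Fin m, P m (i + 1) * e u i ∧
      S (m - 1) u.1 = ∑ i : Fin m, P (m + 1) i * e u i := by
  induction m with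
  | zero =>
    refine ⟨⟨fun _ => Fin.elim0, fun _ => ⟨fun _ => 0, by simp [GP]⟩, ?_, ?_⟩, ?_⟩
    · rintro ⟨u, h1, h2, h3⟩
      apply Subtype.ext
      funext j
      rcases Nat.eq_zero_or_pos j with rfl | hj
      · exact h1.symm
      · exact (h2 j hj).symm
    · intro f; exact Subsingleton.elim _ _
    · intro u; simp [S]
  | succ m ih =>
    obtain ⟨e, he⟩ := ih
    refine ⟨((E h m).trans ((Equiv.refl ℕ).prodCongr e)).trans (Fin.consEquiv (fun _ => ℕ)), ?_⟩
    intro u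
    have h1 := E_odd h m u
    have h2 := E_even h m u
    obtain ⟨h3, h4⟩ := he (E h m u).2
    simp only [Fin.sum_univ_succ, Equiv.trans_apply, Equiv.prodCongr_apply, Fin.consEquiv_apply,
      Fin.cons_zero, Fin.cons_succ, Fin.val_zero, Fin.val_succ, P0, P1, P2, Nat.add_sub_cancel,
      Prod.map, zero_add, one_mul, zero_mul, Equiv.refl_apply]
    refine ⟨?_, h1.trans h3⟩
    have h5 : ∑ i : Fin m, P (m + 1) (i + 1 + 1) * e (E h m u).2 i +
        ∑ i : Fin m, P (m + 1) i * e (E h m u).2 i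
        = c (m + 1) * ∑ i : Fin m, P m (i + 1) * e (E h m u).2 i := by
      rw [← Finset.sum_add_distrib, Finset.mul_sum]
      refine Finset.sum_congr rfl fun i _ => ?_
      rw [← add_mul, hP, mul_assoc]
    rw [h3, h4] at h2
    linarith

lemma sum_even (m : ℕ) (u : ℕ → ℕ) :
    ∑ i ∈ Finset.range m, (if i % 2 = 0 then u (m - i) else 0) = S m u := by
  induction m using Nat.twoStepInduction with
  | zero => simp [S]
  | one => simp [S]
  | more m ih _ =>
    rw [Finset.sum_range_succ', Finset.sum_range_succ']
    simp only [S, ← ih]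
    have : ∀ i, (i + 1 + 1) % 2 = i % 2 := by omega
    have h2 : ∀ i, m + 2 - (i + 1 + 1) = m - i := by omega
    simp only [this, h2]
    simp [add_comm]

lemma sum_odd (m : ℕ) (u : ℕ → ℕ) :
    ∑ i ∈ Finset.range m, (if i % 2 = 1 then u (m - i) else 0) = S (m - 1) u := by
  cases m with
  | zero => simp [S]
  | succ m =>
    rw [Finset.sum_range_succ']
    have : ∀ i, (i + 1) % 2 = 1 ↔ i % 2 = 0 := by omega
    simp [this, Nat.add_sub_add_right, sum_even]

def Fequiv (a : ℕ → ℕ) (m : ℕ) : {u // GP a m u} ≃ {lam : Fin m → ℕ // GCond a m lam} where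
  toFun u := ⟨fun i => u.1 (m - i), by
    intro i j hij
    have := u.2.2.2 (m - j) (by omega)
    rwa [show m - (j : ℕ) + 1 = m - i by omega] at this⟩
  invFun v := ⟨fun j => if hj : 0 < j ∧ j ≤ m then v.1 ⟨m - j, by omega⟩ else 0, by
    refine ⟨by simp, fun j hj => dif_neg (by omega), fun j hj => ?_⟩
    by_cases h0 : 0 < j
    · simp only [dif_pos (show 0 < j ∧ j ≤ m by omega), dif_pos (show 0 < j + 1 ∧ j + 1 ≤ m by omega)]
      have := v.2 ⟨m - (j + 1), by omega⟩ ⟨m - j, by omega⟩ (by simp; omega)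
      simpa only [show m - (m - (j + 1)) = j + 1 by omega, show m - (m - j) = j by omega] using this
    · simp [h0]⟩
  left_inv u := by
    apply Subtype.ext
    funext j
    dsimp only
    split_ifs with h
    · rw [show m - (m - j) = j by omega]
    · by_cases h0 : j = 0
      · subst h0; exact u.2.1.symm
      · exact (u.2.2.1 j (by omega)).symm
  right_inv v := by
    apply Subtype.ext
    funext i
    dsimp only
    rw [dif_pos (by omega)]
    exact congrArg v.1 (Fin.ext (by simp only; omega))

noncomputable def H (p q : ℕ → ℕ) (m : ℕ) : MvPowerSeries (Fin 2) ℤ := fun d =>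
  (Nat.card {n : Fin m → ℕ // ∑ i : Fin m, p i * n i = d 0 ∧ ∑ i : Fin m, q i * n i = d 1} : ℤ)

lemma Ggf_eq (h : Hyp a c) (P : ℕ → ℕ → ℕ) (P0 : ∀ m, P m 0 = 0) (P1 : ∀ m, P m 1 = 1)
    (P2 : ∀ m, P (m + 2) = P m)
    (hP : ∀ m i, P (m + 1) (i + 2) + P (m + 1) i = c (m + 1) * P m (i + 1)) (m : ℕ) :
    Ggf a m = H (fun i => P m (i + 1)) (P (m + 1)) m := by
  obtain ⟨e, he⟩ := main_bij h P P0 P1 P2 hP m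
  funext d
  unfold Ggf H
  congr 1
  have key : ∀ u : {u // GP a m u},
      (∑ i ∈ Finset.univ.filter fun i : Fin m => (i : ℕ) % 2 = 0, (Fequiv a m u).1 i) = S m u.1 ∧
      (∑ i ∈ Finset.univ.filter fun i : Fin m => (i : ℕ) % 2 = 1, (Fequiv a m u).1 i)
        = S (m - 1) u.1 := by
    intro u
    rw [Finset.sum_filter, Finset.sum_filter, ← sum_even, ← sum_odd,
      ← Fin.sum_univ_eq_sum_range (fun i => if i % 2 = 0 then u.1 (m - i) else 0),
      ← Fin.sum_univ_eq_sum_range (fun i => if i % 2 = 1 then u.1 (m - i) else 0)]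
    exact ⟨rfl, rfl⟩
  refine Nat.card_congr ((Equiv.subtypeSubtypeEquivSubtypeInter _ _).symm.trans ?_)
  refine Equiv.subtypeEquiv ((Fequiv a m).symm.trans e) ?_
  intro v
  obtain ⟨u, rfl⟩ := (Fequiv a m).surjective v
  rw [(key u).1, (key u).2, (he u).1, (he u).2]
  simp

lemma H_finite (p q : ℕ → ℕ) (hp : ∀ i, 0 < p i) (m x y : ℕ) :
    Finite {n : Fin m → ℕ // ∑ i : Fin m, p i * n i = x ∧ ∑ i : Fin m, q i * n i = y} := by
  apply Set.Finite.to_subtype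
  apply (Set.finite_Iic (fun _ : Fin m => x)).subset
  rintro n ⟨h1, -⟩ i
  calc n i ≤ p i * n i := Nat.le_mul_of_pos_left _ (hp i)
    _ ≤ _ := Finset.single_le_sum (f := fun i : Fin m => p i * n i) (fun _ _ => Nat.zero_le _) (Finset.mem_univ i)
    _ = x := h1

def Sp (p q : ℕ → ℕ) (m x y : ℕ) : Type :=
  {n : Fin m → ℕ // ∑ i : Fin m, p i * n i = x ∧ ∑ i : Fin m, q i * n i = y}

def sp0 (p q : ℕ → ℕ) (m x y : ℕ) :
    {n : Sp p q (m + 1) x y // n.1 (Fin.last m) = 0} ≃ Sp p q m x y where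
  toFun n := ⟨fun i => n.1.1 i.castSucc, by
    obtain ⟨⟨n, h1, h2⟩, h3⟩ := n
    simp only [Fin.sum_univ_castSucc] at h1 h2
    simp only at h3
    rw [h3] at h1 h2
    simpa using ⟨h1, h2⟩⟩
  invFun n := ⟨⟨Fin.snoc (α := fun _ => ℕ) n.1 0, by
    obtain ⟨n, h1, h2⟩ := n
    simpa [Fin.sum_univ_castSucc] using ⟨h1, h2⟩⟩, by simp⟩
  left_inv n := by
    apply Subtype.ext; apply Subtype.ext
    funext i
    refine Fin.lastCases ?_ (fun i => ?_) i
    · simpa using n.2.symm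
    · simp
  right_inv n := by
    apply Subtype.ext
    funext i
    simp

def sp1 (p q : ℕ → ℕ) (m x y : ℕ) (hx : p m ≤ x) (hy : q m ≤ y) :
    {n : Sp p q (m + 1) x y // ¬ n.1 (Fin.last m) = 0} ≃ Sp p q (m + 1) (x - p m) (y - q m) where
  toFun n := ⟨fun i => if i = Fin.last m then n.1.1 i - 1 else n.1.1 i, by
    obtain ⟨⟨n, h1, h2⟩, h3⟩ := n
    simp only [Fin.sum_univ_castSucc] at h1 h2
    simp only at h3
    obtain ⟨t, ht⟩ := Nat.exists_eq_succ_of_ne_zero h3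
    simp only [Fin.sum_univ_castSucc, Fin.castSucc_ne_last, if_true, if_false, ht] at *
    simp only [Nat.succ_eq_add_one, mul_add, Nat.add_sub_cancel, Fin.val_last, mul_one] at *
    omega⟩
  invFun n := ⟨⟨fun i => if i = Fin.last m then n.1 i + 1 else n.1 i, by
    obtain ⟨n, h1, h2⟩ := n
    rw [Fin.sum_univ_castSucc] at h1 h2
    simp only [Fin.val_last] at h1 h2
    simp only [Fin.sum_univ_castSucc, Fin.castSucc_ne_last, if_true, if_false]
    simp only [mul_add, Fin.val_last, mul_one]
    omega⟩, by simp⟩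
  left_inv n := by
    apply Subtype.ext; apply Subtype.ext
    funext i
    by_cases hi : i = Fin.last m
    · subst hi
      have := n.2
      simp only [if_true]
      omega
    · simp [hi]
  right_inv n := by
    apply Subtype.ext
    funext i
    by_cases hi : i = Fin.last m <;> simp [hi]

lemma H_step (p q : ℕ → ℕ) (hp : ∀ i, 0 < p i) (m : ℕ) :
    H p q (m + 1) * (1 - (X 0 : MvPowerSeries (Fin 2) ℤ) ^ (p m) * X 1 ^ (q m)) = H p q m := by
  set w : Fin 2 →₀ ℕ := Finsupp.single 0 (p m) + Finsupp.single 1 (q m) with hw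
  have hX : (X 0 : MvPowerSeries (Fin 2) ℤ) ^ (p m) * X 1 ^ (q m) = monomial w 1 := by
    rw [X_pow_eq, X_pow_eq, monomial_mul_monomial, one_mul]
  have w0 : w 0 = p m := by simp [hw]
  have w1 : w 1 = q m := by simp [hw]
  have hwd : ∀ d : Fin 2 →₀ ℕ, w ≤ d ↔ p m ≤ d 0 ∧ q m ≤ d 1 := by
    intro d
    rw [Finsupp.le_def, Fin.forall_fin_two, w0, w1]
  ext d
  rw [hX, mul_sub, mul_one, map_sub, coeff_mul_monomial, mul_one]
  change (Nat.card (Sp p q (m + 1) (d 0) (d 1)) : ℤ) -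
    (if w ≤ d then (Nat.card (Sp p q (m + 1) ((d - w) 0) ((d - w) 1)) : ℤ) else 0)
    = Nat.card (Sp p q m (d 0) (d 1))
  have f1 : Finite (Sp p q (m + 1) (d 0) (d 1)) := H_finite p q hp _ _ _
  classical
  have hs : Nat.card (Sp p q (m + 1) (d 0) (d 1)) =
      Nat.card {n : Sp p q (m + 1) (d 0) (d 1) // n.1 (Fin.last m) = 0} +
      Nat.card {n : Sp p q (m + 1) (d 0) (d 1) // ¬ n.1 (Fin.last m) = 0} := by
    rw [← Nat.card_sum]
    exact Nat.card_congr (Equiv.sumCompl _).symm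
  rw [hs, Nat.card_congr (sp0 p q m (d 0) (d 1))]
  split_ifs with hd
  · rw [Finsupp.tsub_apply, Finsupp.tsub_apply, w0, w1,
      Nat.card_congr (sp1 p q m (d 0) (d 1) ((hwd d).1 hd).1 ((hwd d).1 hd).2)]
    push_cast; ring
  · have : IsEmpty {n : Sp p q (m + 1) (d 0) (d 1) // ¬ n.1 (Fin.last m) = 0} := by
      refine ⟨?_⟩
      rintro ⟨⟨n, h1, h2⟩, h3⟩
      apply hd
      rw [hwd]
      simp only at h3
      simp only [Fin.sum_univ_castSucc, Fin.val_last] at h1 h2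
      have h4 := Nat.le_mul_of_pos_right (p m) (Nat.pos_of_ne_zero h3)
      have h5 := Nat.le_mul_of_pos_right (q m) (Nat.pos_of_ne_zero h3)
      omega
    simp

lemma H_prod (p q : ℕ → ℕ) (hp : ∀ i, 0 < p i) (m : ℕ) :
    H p q m * ∏ i ∈ Finset.range m,
      (1 - (X 0 : MvPowerSeries (Fin 2) ℤ) ^ (p i) * X 1 ^ (q i)) = 1 := by
  induction m with
  | zero =>
    simp only [Finset.range_zero, Finset.prod_empty, mul_one]
    ext d
    rw [coeff_one]
    change (Nat.card (Sp p q 0 (d 0) (d 1)) : ℤ) = _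
    have hd : d = 0 ↔ d 0 = 0 ∧ d 1 = 0 := by
      rw [Finsupp.ext_iff, Fin.forall_fin_two]; rfl
    split_ifs with h
    · have : Unique (Sp p q 0 (d 0) (d 1)) :=
        { default := ⟨Fin.elim0, by simpa [eq_comm] using hd.1 h⟩
          uniq := fun x => Subtype.ext (Subsingleton.elim _ _) }
      simp
    · have : IsEmpty (Sp p q 0 (d 0) (d 1)) := by
        refine ⟨?_⟩
        rintro ⟨n, h1, h2⟩
        apply h
        rw [hd]
        simpa [eq_comm] using And.intro h1 h2
      simp
  | succ m ih =>
    rw [Finset.prod_range_succ, mul_comm (∏ i ∈ _, _), ← mul_assoc, H_step p q hp, ih]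

lemma pos_aux (k l : ℕ) (hl : 0 < l) (hkl : 4 ≤ k * l) (a : ℕ → ℕ)
    (ha0 : a 0 = 0) (ha1 : a 1 = 1)
    (haE : ∀ i : ℕ, (a (2 * i + 2) : ℤ) = l * a (2 * i + 1) - a (2 * i))
    (haO : ∀ i : ℕ, (a (2 * i + 3) : ℤ) = k * a (2 * i + 2) - a (2 * i + 1)) (j : ℕ) :
    0 < a (j + 1) := by
  have hkl' : (4 : ℤ) ≤ k * l := by exact_mod_cast hkl
  have key : ∀ i, (a (2 * i) : ℤ) + 1 ≤ a (2 * i + 2) ∧ (a (2 * i + 1) : ℤ) + 1 ≤ a (2 * i + 3) := by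
    intro i
    induction i with
    | zero =>
      have h1 := haE 0
      have h2 := haO 0
      simp only [mul_zero, zero_add, ha0, ha1] at *
      push_cast at *
      rw [h2, h1]
      constructor <;> nlinarith
    | succ i ih =>
      have h1 := haE i
      have h2 := haO i
      have h3 := haE (i + 1)
      have h4 := haO (i + 1)
      rw [show 2 * (i + 1) = 2 * i + 2 by ring] at *
      rw [show 2 * i + 2 + 1 = 2 * i + 3 by ring, show 2 * i + 2 + 2 = 2 * i + 4 by ring,
        show 2 * i + 2 + 3 = 2 * i + 5 by ring] at *
      obtain ⟨h5, h6⟩ := ih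
      have e1 : (a (2 * i + 4) : ℤ) = (k * l - 2) * a (2 * i + 2) - a (2 * i) := by
        rw [h3, h2]; linear_combination h1
      have e2 : (a (2 * i + 5) : ℤ) = (k * l - 2) * a (2 * i + 3) - a (2 * i + 1) := by
        rw [h4, h3]; linear_combination h2
      have p1 := mul_nonneg (sub_nonneg.2 hkl') (Int.natCast_nonneg (a (2 * i + 2)))
      have p2 := mul_nonneg (sub_nonneg.2 hkl') (Int.natCast_nonneg (a (2 * i + 3)))
      constructor <;> nlinarith
  rcases Nat.even_or_odd' j with ⟨i, rfl | rfl⟩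
  · cases i with
    | zero => simp [ha1]
    | succ i =>
      have := (key i).2
      rw [show 2 * (i + 1) + 1 = 2 * i + 3 by ring]; omega
  · have := (key i).1
    rw [show 2 * i + 1 + 1 = 2 * i + 2 by ring]; omega

end LH

/-- **The (k,ℓ)-lecture hall theorem** (Bousquet-Mélou–Eriksson).  Here `a` is the
`(k,ℓ)`-sequence and `b` the `(ℓ,k)`-sequence, specified by their defining
recurrences as hypotheses. -/
theorem k_ell_lecture_hall_theorem (k l : ℕ) (hk : 0 < k) (hl : 0 < l)
    (hkl : 4 ≤ k * l) (a b : ℕ → ℕ)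
    (ha0 : a 0 = 0) (ha1 : a 1 = 1)
    (haE : ∀ i : ℕ, (a (2 * i + 2) : ℤ) = l * a (2 * i + 1) - a (2 * i))
    (haO : ∀ i : ℕ, (a (2 * i + 3) : ℤ) = k * a (2 * i + 2) - a (2 * i + 1))
    (hb0 : b 0 = 0) (hb1 : b 1 = 1)
    (hbE : ∀ i : ℕ, (b (2 * i + 2) : ℤ) = k * b (2 * i + 1) - b (2 * i))
    (hbO : ∀ i : ℕ, (b (2 * i + 3) : ℤ) = l * b (2 * i + 2) - b (2 * i + 1))
    (n : ℕ) (hn : 1 ≤ n) :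
    (Ggf a (2 * n) * ∏ i ∈ Finset.range (2 * n),
        (1 - (X 0 : MvPowerSeries (Fin 2) ℤ) ^ (a (i + 1)) * X 1 ^ (b i)) = 1)
    ∧
    (Ggf a (2 * n - 1) * ∏ i ∈ Finset.range (2 * n - 1),
        (1 - (X 0 : MvPowerSeries (Fin 2) ℤ) ^ (b (i + 1)) * X 1 ^ (a i)) = 1) := by
  have hkl2 : 4 ≤ l * k := by rwa [mul_comm]
  have apos := LH.pos_aux k l hl hkl a ha0 ha1 haE haO
  have bpos := LH.pos_aux l k hk hkl2 b hb0 hb1 hbE hbO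
  have hab : ∀ i : ℕ, (k * a (2 * i) : ℤ) = l * b (2 * i) ∧ a (2 * i + 1) = b (2 * i + 1) := by
    intro i
    induction i with
    | zero => simp [ha0, hb0, ha1, hb1]
    | succ i ih =>
      obtain ⟨h1, h2⟩ := ih
      have h2' : (a (2 * i + 1) : ℤ) = b (2 * i + 1) := by exact_mod_cast h2
      have h3 : (k * a (2 * (i + 1)) : ℤ) = l * b (2 * (i + 1)) := by
        rw [show 2 * (i + 1) = 2 * i + 2 by ring, haE, hbE, h2']
        linear_combination -h1
      refine ⟨h3, ?_⟩
      zify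
      rw [show 2 * (i + 1) + 1 = 2 * i + 3 by ring, haO, hbO, h2']
      rw [show 2 * (i + 1) = 2 * i + 2 by ring] at h3
      linear_combination h3
  let c : ℕ → ℕ := fun j => if j % 2 = 0 then l else k
  let P : ℕ → ℕ → ℕ := fun m => if m % 2 = 0 then a else b
  have h : LH.Hyp a c := by
    refine ⟨ha0, apos, fun j => by simp [c], fun j => ?_⟩
    rcases Nat.even_or_odd' j with ⟨i, rfl | rfl⟩
    · have := haE i
      simp only [c, Nat.mul_mod_right, if_true]
      zify; linarith
    · have := haO i
      have h1 : (2 * i + 1) % 2 = 1 := by omega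
      simp only [c, h1, one_ne_zero, if_false]
      zify; rw [show 2 * i + 1 + 2 = 2 * i + 3 by ring, show 2 * i + 1 + 1 = 2 * i + 2 by ring]
      linarith
  have P0 : ∀ m, P m 0 = 0 := by intro m; simp only [P]; split_ifs <;> assumption
  have P1 : ∀ m, P m 1 = 1 := by intro m; simp only [P]; split_ifs <;> assumption
  have P2 : ∀ m, P (m + 2) = P m := by intro m; simp [P]
  have Ppos : ∀ m i, 0 < P m (i + 1) := by
    intro m i; simp only [P]; split_ifs
    · exact apos i
    · exact bpos i
  have hP : ∀ m i, P (m + 1) (i + 2) + P (m + 1) i = c (m + 1) * P m (i + 1) := by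
    intro m i
    have hi : i = 2 * (i / 2) ∨ i = 2 * (i / 2) + 1 := by omega
    generalize i / 2 = r at hi
    have e1 := haE r
    have e2 := haO r
    have e3 := hbE r
    have e4 := hbO r
    have e5 := (hab r).2
    have e6 := (hab (r + 1)).1
    rw [show 2 * (r + 1) = 2 * r + 2 by ring] at e6
    rcases Nat.mod_two_eq_zero_or_one m with hm | hm
    · have hm' : (m + 1) % 2 = 1 := by omega
      simp only [P, c, hm, hm', one_ne_zero, if_true, if_false]
      zify
      rcases hi with rfl | rfl
      · rw [e5]; linarith
      · rw [show 2 * r + 1 + 2 = 2 * r + 3 by ring, show 2 * r + 1 + 1 = 2 * r + 2 by ring]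
        linarith
    · have hm' : (m + 1) % 2 = 0 := by omega
      simp only [P, c, hm, hm', one_ne_zero, if_true, if_false]
      zify
      rcases hi with rfl | rfl
      · rw [← e5]; linarith
      · rw [show 2 * r + 1 + 2 = 2 * r + 3 by ring, show 2 * r + 1 + 1 = 2 * r + 2 by ring]
        linarith
  have main : ∀ m, Ggf a m * ∏ i ∈ Finset.range m,
      (1 - (X 0 : MvPowerSeries (Fin 2) ℤ) ^ (P m (i + 1)) * X 1 ^ (P (m + 1) i)) = 1 := by
    intro m
    rw [LH.Ggf_eq h P P0 P1 P2 hP m]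
    exact LH.H_prod (fun i => P m (i + 1)) (P (m + 1)) (Ppos m) m
  have q1 : P (2 * n) = a := by simp [P]
  have q2 : P (2 * n + 1) = b := if_neg (by omega)
  have q3 : P (2 * n - 1) = b := if_neg (by omega)
  have q4 : P (2 * n - 1 + 1) = a := if_pos (by omega)
  refine ⟨?_, ?_⟩
  · have := main (2 * n); rwa [q1, q2] at this
  · have := main (2 * n - 1); rwa [q3, q4] at this
end

section
/- Let ℓ ≥ 2 be an integer, define a_0 = 0, a_1 = 1, and a_i = ℓ a_{i−1} − a_{i−2} for i ≥ 2, and let c_ℓ = (ℓ + √(ℓ² − 4))/2 be the largest real root of x² − ℓx + 1. Then for every nonnegative integer N, the number of partitions of N into parts from the set {a_i + a_{i−1} : i ≥ 1} (parts may repeat) equals the number of finite sequences λ_1 > λ_2 > ⋯ > λ_k > 0 of positive integers with λ_1 + ⋯ + λ_k = N and λ_i > c_ℓ · λ_{i+1} for all 1 ≤ i < k. -/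
structure EllSys (l : ℕ) where
  X : Type
  o : X → ℕ
  e : X → ℕ
  x0 : X
  φ : X ≃ ℕ × X
  he : ∀ x, e x = o (φ x).2
  ho : ∀ x, o x + e (φ x).2 = (φ x).1 + l * o (φ x).2
  o0 : o x0 = 0
  e0 : e x0 = 0
  h0 : ∀ x, o x ≤ e x → x = x0

namespace EllSys

noncomputable def f {l : ℕ} (A B : EllSys l) (x : A.X) : B.X :=
  if h : A.o x ≤ A.e x then B.x0 else B.φ.symm ((A.φ x).1, f A B (A.φ x).2)
termination_by A.o x
decreasing_by
  have := A.he x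
  omega

theorem f_pres {l : ℕ} (A B : EllSys l) : ∀ n (x : A.X), A.o x = n →
    B.o (f A B x) = A.o x ∧ B.e (f A B x) = A.e x := by
  intro n
  induction n using Nat.strong_induction_on with
  | _ n ih =>
    intro x hx
    rw [f]
    split_ifs with h
    · rw [A.h0 x h, A.o0, A.e0, B.o0, B.e0]; simp
    · have h1 := A.he x
      have h2 := A.ho x
      obtain ⟨i1, i2⟩ := ih _ (by omega) (A.φ x).2 rfl
      have h3 := B.he (B.φ.symm ((A.φ x).1, f A B (A.φ x).2))
      have h4 := B.ho (B.φ.symm ((A.φ x).1, f A B (A.φ x).2))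
      simp only [Equiv.apply_symm_apply] at h3 h4
      rw [i1] at h3 h4
      rw [i2] at h4
      omega

theorem f_inv {l : ℕ} (A B : EllSys l) : ∀ n (x : A.X), A.o x = n →
    f B A (f A B x) = x := by
  intro n
  induction n using Nat.strong_induction_on with
  | _ n ih =>
    intro x hx
    obtain ⟨p1, p2⟩ := f_pres A B _ x rfl
    rw [f]
    split_ifs with h
    · rw [p1, p2] at h
      exact (A.h0 x h).symm
    · rw [p1, p2] at h
      have h1 := A.he x
      have e1 : f A B x = B.φ.symm ((A.φ x).1, f A B (A.φ x).2) := by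
        conv_lhs => rw [f]
        rw [dif_neg h]
      rw [e1]
      simp only [Equiv.apply_symm_apply]
      rw [ih _ (by omega) (A.φ x).2 rfl]
      simp

theorem card_eq {l : ℕ} (A B : EllSys l) (N : ℕ) :
    Nat.card {x : A.X // A.o x + A.e x = N} = Nat.card {x : B.X // B.o x + B.e x = N} := by
  apply Nat.card_congr
  refine Equiv.subtypeEquiv ⟨f A B, f B A, fun x => f_inv A B _ x rfl, fun x => f_inv B A _ x rfl⟩ ?_
  intro x
  obtain ⟨p1, p2⟩ := f_pres A B _ x rfl
  simp [p1, p2]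

end EllSys

theorem ell_mono (l : ℕ) (hl : 2 ≤ l) (a : ℕ → ℕ)
    (ha0 : a 0 = 0) (ha1 : a 1 = 1)
    (harec : ∀ i : ℕ, (a (i + 2) : ℤ) = l * a (i + 1) - a i) (i : ℕ) : a i < a (i + 1) := by
  induction i with
  | zero => simp [ha0, ha1]
  | succ i ih =>
    have h := harec i
    have : (2 : ℤ) * a (i + 1) ≤ l * a (i + 1) := by
      apply mul_le_mul_of_nonneg_right <;> simp; exact_mod_cast hl
    show a (i+1) < a (i+2)
    omega

def ellSysM (l : ℕ) (hl : 2 ≤ l) (a : ℕ → ℕ)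
    (ha0 : a 0 = 0) (ha1 : a 1 = 1)
    (harec : ∀ i : ℕ, (a (i + 2) : ℤ) = l * a (i + 1) - a i) : EllSys l where
  X := Multiset ℕ
  o s := (s.map (fun i => a (i + 1))).sum
  e s := (s.map a).sum
  x0 := 0
  φ := 
    { toFun := fun s => (s.count 0, (s.filter (fun i => ¬ 0 = i)).map Nat.pred)
      invFun := fun p => Multiset.replicate p.1 0 + p.2.map Nat.succ
      left_inv := by
        intro s
        simp only [Multiset.map_map]
        conv_rhs => rw [← Multiset.filter_add_not (fun i => 0 = i) s, Multiset.filter_eq]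
        congr 1
        conv_rhs => rw [← Multiset.map_id (Multiset.filter (fun i => ¬ 0 = i) s)]
        apply Multiset.map_congr rfl
        intro x hx
        simp only [Multiset.mem_filter] at hx
        simp; omega
      right_inv := by
        rintro ⟨k, t⟩
        have h1 : Multiset.filter (fun i => ¬ 0 = i) (Multiset.replicate k 0) = 0 := by
          rw [Multiset.filter_eq_nil]
          intro x hx
          simp [Multiset.eq_of_mem_replicate hx]
        have h2 : Multiset.filter (fun i => ¬ 0 = i) (t.map Nat.succ) = t.map Nat.succ := by
          rw [Multiset.filter_eq_self]
          intro x hx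
          simp only [Multiset.mem_map] at hx
          obtain ⟨y, _, rfl⟩ := hx
          omega
        simp only [Multiset.filter_add, h1, h2, Multiset.count_add, Multiset.count_replicate_self,
          zero_add, Multiset.map_map]
        refine Prod.ext ?_ ?_
        · simp
        · simp }
  he s := by
    induction s using Multiset.induction_on with
    | empty => simp
    | cons i s ih =>
      simp only [Equiv.coe_fn_mk] at ih ⊢
      rcases i with _ | i <;> simp [ih, ha0]
  ho s := by
    induction s using Multiset.induction_on with
    | empty => simp
    | cons i s ih =>
      simp only [Equiv.coe_fn_mk] at ih ⊢
      rcases i with _ | i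
      · simp [ha1] at ih ⊢
        omega
      · have h := harec i
        have h' : a (i+2) + a i = l * a (i+1) := by zify; omega
        simp at ih ⊢
        rw [mul_add, ← h']
        rw [show i + 1 + 1 = i + 2 from rfl]
        omega
  o0 := by simp
  e0 := by simp
  h0 s hs := by
    have : (s.map a).sum + s.card ≤ (s.map (fun i => a (i + 1))).sum := by
      clear hs
      induction s using Multiset.induction_on with
      | empty => simp
      | cons i s ih =>
        have := ell_mono l hl a ha0 ha1 harec i
        simp
        omega
    have : s.card = 0 := by omega
    simpa using this

theorem ell_partition_card (l : ℕ) (hl : 2 ≤ l) (a : ℕ → ℕ)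
    (ha0 : a 0 = 0) (ha1 : a 1 = 1)
    (harec : ∀ i : ℕ, (a (i + 2) : ℤ) = l * a (i + 1) - a i) (N : ℕ) :
    Nat.card {p : N.Partition //
        ∀ x ∈ p.parts, ∃ i : ℕ, 1 ≤ i ∧ x = a i + a (i - 1)} =
    Nat.card {s : Multiset ℕ // (s.map (fun i => a (i + 1))).sum + (s.map a).sum = N} := by
  symm
  have hm := ell_mono l hl a ha0 ha1 harec
  have hs : StrictMono (fun i => a (i+1) + a i) := by
    apply strictMono_nat_of_lt_succ
    intro n
    have := hm n
    have := hm (n+1)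
    omega
  refine Nat.card_congr (Equiv.ofBijective (fun s => ⟨⟨s.1.map (fun i => a (i+1) + a i), ?_, ?_⟩, ?_⟩) ⟨?_, ?_⟩)
  · intro i hi
    simp only [Multiset.mem_map] at hi
    obtain ⟨j, _, rfl⟩ := hi
    have := hm j
    omega
  · rw [Multiset.sum_map_add]; exact s.2
  · intro x hx
    simp only [Multiset.mem_map] at hx
    obtain ⟨j, _, rfl⟩ := hx
    exact ⟨j+1, by omega, rfl⟩
  · intro s t h
    simp only [Subtype.mk.injEq, Nat.Partition.mk.injEq] at h
    exact Subtype.ext (Multiset.map_injective hs.injective h)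
  · rintro ⟨⟨s, h1, h2⟩, h3⟩
    have : ∃ t : Multiset ℕ, t.map (fun i => a (i+1) + a i) = s := by
      replace h3 : ∀ x ∈ s, ∃ i : ℕ, 1 ≤ i ∧ x = a i + a (i - 1) := h3
      clear h1 h2
      induction s using Multiset.induction_on with
      | empty => exact ⟨0, rfl⟩
      | cons x s ih =>
        obtain ⟨t, ht⟩ := ih (fun y hy => h3 y (Multiset.mem_cons_of_mem hy))
        obtain ⟨i, hi, hx⟩ := h3 x (Multiset.mem_cons_self _ _)
        refine ⟨(i-1) ::ₘ t, ?_⟩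
        rw [Multiset.map_cons, ht, hx]
        rw [Nat.sub_add_cancel hi]
    obtain ⟨t, rfl⟩ := this
    refine ⟨⟨t, ?_⟩, rfl⟩
    rw [← h2, Multiset.sum_map_add]

/-- abstract data of the shift -/
structure EllShift (l : ℕ) where
  S : ℕ → ℕ
  R : ℕ → ℕ
  gc : ∀ z x, S z ≤ x ↔ z ≤ R x
  add : ∀ x, S x + R x = l * x
  lt : ∀ x, 0 < x → x < S x

namespace EllShift
variable {l : ℕ} (T : EllShift l)

theorem S0 : T.S 0 = 0 := by have := T.add 0; simp at this; omega
theorem R0 : T.R 0 = 0 := by have := T.add 0; simp at this; omega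
theorem le (x : ℕ) : x ≤ T.S x := by
  rcases Nat.eq_zero_or_pos x with rfl | h
  · simp
  · exact (T.lt x h).le

structure Seq where
  u : ℕ → ℕ
  v : ℕ → ℕ
  uv : ∀ i, T.S (v i) ≤ u i
  vu : ∀ i, T.S (u (i + 1)) ≤ v i
  fin : ∃ M, ∀ i, M ≤ i → u i = 0

end EllShift

theorem ell_summable (u : ℕ → ℕ) (h : ∃ M, ∀ i, M ≤ i → u i = 0) : Summable u := by
  obtain ⟨M, hM⟩ := h
  apply summable_of_ne_finset_zero (s := Finset.range M)
  intro i hi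
  apply hM
  simpa using hi

theorem ell_tsum_succ (u : ℕ → ℕ) (h : ∃ M, ∀ i, M ≤ i → u i = 0) :
    ∑' i, u i = u 0 + ∑' i, u (i + 1) := by
  apply tsum_eq_zero_add'
  apply ell_summable
  obtain ⟨M, hM⟩ := h
  exact ⟨M, fun i hi => hM _ (by omega)⟩

namespace EllShift
variable {l : ℕ} (T : EllShift l)

theorem Seq.finv (x : T.Seq) : ∃ M, ∀ i, M ≤ i → x.v i = 0 := by
  obtain ⟨M, hM⟩ := x.fin
  refine ⟨M, fun i hi => ?_⟩
  have := x.uv i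
  have := T.le (x.v i)
  have := hM i hi
  omega

@[ext] theorem Seq.ext' (x y : T.Seq) (h1 : x.u = y.u) (h2 : x.v = y.v) : x = y := by
  cases x; cases y; simp_all

theorem Seq.key (x : T.Seq) (i : ℕ) : T.S (x.v (i+1)) ≤ x.u (i+1) ∧ x.u (i+1) ≤ T.R (x.v i) :=
  ⟨x.uv _, (T.gc _ _).1 (x.vu i)⟩

def down (x : T.Seq) : T.Seq where
  u := x.v
  v i := T.R (x.v i) + T.S (x.v (i + 1)) - x.u (i + 1)
  uv i := by
    rw [T.gc]
    have := x.key T i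
    omega
  vu i := by
    have := x.key T i
    omega
  fin := x.finv

def up (k : ℕ) (x : T.Seq) : T.Seq where
  u i := match i with
    | 0 => k + T.S (x.u 0)
    | i + 1 => T.R (x.u i) + T.S (x.u (i + 1)) - x.v i
  v := x.u
  uv i := by
    rcases i with _ | i
    · simp
    · have h1 := (T.gc _ _).1 (x.uv i)
      simp only
      omega
  vu i := by
    have h1 := x.vu i
    simp only [T.gc]
    omega
  fin := by
    obtain ⟨M, hM⟩ := x.fin
    refine ⟨M + 1, fun i hi => ?_⟩
    rcases i with _ | i
    · omega
    · simp [hM i (by omega), hM (i+1) (by omega), T.S0, T.R0]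

noncomputable def sys : EllSys l where
  X := T.Seq
  o x := ∑' i, x.u i
  e x := ∑' i, x.v i
  x0 := ⟨fun _ => 0, fun _ => 0, by simp [T.S0], by simp [T.S0], by simp⟩
  φ :=
    { toFun := fun x => (x.u 0 - T.S (x.v 0), T.down x)
      invFun := fun p => T.up p.1 p.2
      left_inv := by
        intro x
        apply Seq.ext'
        · funext i
          rcases i with _ | i
          · have := x.uv 0
            simp only [up, down]; omega
          · have := x.key T i
            simp only [up, down]; omega
        · rfl
      right_inv := by
        rintro ⟨k, x⟩
        refine Prod.ext ?_ ?_
        · simp [up]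
        · apply Seq.ext'
          · rfl
          · funext i
            have h1 := (T.gc _ _).1 (x.uv i)
            have h2 := x.vu i
            simp only [up, down]; omega }
  he x := rfl
  ho x := by
    have hu := x.fin
    have hv := x.finv
    have hS : ∃ M, ∀ i, M ≤ i → T.S (x.v i) = 0 := by
      obtain ⟨M, hM⟩ := hv
      exact ⟨M, fun i hi => by rw [hM i hi, T.S0]⟩
    have hR : ∃ M, ∀ i, M ≤ i → T.R (x.v i) = 0 := by
      obtain ⟨M, hM⟩ := hv
      exact ⟨M, fun i hi => by rw [hM i hi, T.R0]⟩
    have sh : ∀ w : ℕ → ℕ, (∃ M, ∀ i, M ≤ i → w i = 0) → ∃ M, ∀ i, M ≤ i → w (i+1) = 0 := by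
      rintro w ⟨M, hM⟩
      exact ⟨M, fun i hi => hM _ (by omega)⟩
    have e1 : ∑' i, x.u (i+1) + ∑' i, (T.down x).v i = ∑' i, T.R (x.v i) + ∑' i, T.S (x.v (i+1)) := by
      rw [← Summable.tsum_add (ell_summable _ (sh _ hu)) (ell_summable _ (T.down x).finv),
        ← Summable.tsum_add (ell_summable _ hR) (ell_summable _ (sh _ hS))]
      congr 1
      funext i
      have := x.key T i
      simp only [down]; omega
    have e2 : ∑' i, T.S (x.v i) + ∑' i, T.R (x.v i) = l * ∑' i, x.v i := by
      rw [← Summable.tsum_add (ell_summable _ hS) (ell_summable _ hR),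
        ← Summable.tsum_mul_left _ (ell_summable _ hv)]
      congr 1
      funext i
      exact T.add _
    have e3 := ell_tsum_succ _ hu
    have e4 := ell_tsum_succ _ hS
    have := x.uv 0
    show ∑' i, x.u i + ∑' i, (T.down x).v i = (x.u 0 - T.S (x.v 0)) + l * ∑' i, x.v i
    omega
  o0 := by simp
  e0 := by simp
  h0 x h := by
    have hs : ∀ i, x.u (i+1) ≤ x.v i := fun i => (T.le _).trans (x.vu i)
    have hs' : ∀ i, x.v i ≤ x.u i := fun i => (T.le _).trans (x.uv i)
    have hd : ∀ i, x.v i + (x.u i - x.v i) = x.u i := fun i => by have := hs' i; omega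
    have hf : ∃ M, ∀ i, M ≤ i → x.u i - x.v i = 0 := by
      obtain ⟨M, hM⟩ := x.fin
      exact ⟨M, fun i hi => by rw [hM i hi]; simp⟩
    have e1 : ∑' i, x.v i + ∑' i, (x.u i - x.v i) = ∑' i, x.u i := by
      rw [← Summable.tsum_add (ell_summable _ x.finv) (ell_summable _ hf)]
      simp only [hd]
    have e2 : ∑' i, (x.u i - x.v i) = 0 := by omega
    have e3 : ∀ i, x.u i - x.v i = 0 := by
      intro i
      have := (ell_summable _ hf).le_tsum i (fun _ _ => Nat.zero_le _)
      omega
    have e4 : ∀ i, x.v i = 0 := by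
      intro i
      by_contra hne
      have := T.lt (x.v i) (by omega)
      have := x.uv i
      have := e3 i
      omega
    apply Seq.ext'
    · funext i
      have := e3 i
      have := e4 i
      simp only
      omega
    · funext i
      exact e4 i

/-- interleave -/
def Seq.il (x : T.Seq) (n : ℕ) : ℕ := if n % 2 = 0 then x.u (n / 2) else x.v (n / 2)

theorem Seq.il_even (x : T.Seq) (n : ℕ) : x.il T (2 * n) = x.u n := by simp [Seq.il]
theorem Seq.il_odd (x : T.Seq) (n : ℕ) : x.il T (2 * n + 1) = x.v n := by
  simp [Seq.il, Nat.add_mod, show (2 * n + 1) / 2 = n by omega]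

theorem Seq.il_S (x : T.Seq) (n : ℕ) : T.S (x.il T (n + 1)) ≤ x.il T n := by
  obtain ⟨k, rfl | rfl⟩ : ∃ k, n = 2 * k ∨ n = 2 * k + 1 := ⟨n / 2, by omega⟩
  · rw [x.il_even, x.il_odd]; exact x.uv k
  · rw [x.il_odd, show 2 * k + 1 + 1 = 2 * (k+1) by ring, x.il_even]; exact x.vu k

theorem Seq.il_fin (x : T.Seq) : ∃ M, ∀ n, M ≤ n → x.il T n = 0 := by
  obtain ⟨M, hM⟩ := x.fin
  obtain ⟨M', hM'⟩ := x.finv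
  refine ⟨2 * M + 2 * M', fun n hn => ?_⟩
  rw [Seq.il, hM _ (by omega), hM' _ (by omega)]; simp

theorem Seq.il_sum (x : T.Seq) : ∑' n, x.il T n = ∑' i, x.u i + ∑' i, x.v i := by
  rw [← tsum_even_add_odd]
  · simp only [x.il_even, x.il_odd]
  · simp only [x.il_even]; exact ell_summable _ x.fin
  · simp only [x.il_odd]; exact ell_summable _ x.finv

theorem Seq.il_anti (x : T.Seq) : Antitone (x.il T) :=
  antitone_nat_of_succ_le (fun n => (T.le _).trans (x.il_S T n))

/-- zero extension -/
def ext0 (p : Σ m : ℕ, Fin m → ℕ) (n : ℕ) : ℕ := if h : n < p.1 then p.2 ⟨n, h⟩ else 0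

theorem ext0_inj (p q : Σ m : ℕ, Fin m → ℕ) (hp : ∀ i, 0 < p.2 i) (hq : ∀ i, 0 < q.2 i)
    (h : ext0 p = ext0 q) : p = q := by
  have key : ∀ (p : Σ m : ℕ, Fin m → ℕ), (∀ i, 0 < p.2 i) → ∀ n, n < p.1 ↔ 0 < ext0 p n := by
    intro p hp n
    unfold ext0
    split_ifs with h
    · simp [h, hp]
    · simp [h]
  have h1 : p.1 = q.1 := by
    apply le_antisymm
    · by_contra hc
      have := (key p hp q.1).1 (by omega)
      rw [h, ← key q hq] at this
      omega
    · by_contra hc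
      have := (key q hq p.1).1 (by omega)
      rw [← h, ← key p hp] at this
      omega
  obtain ⟨m, p⟩ := p
  obtain ⟨m', q⟩ := q
  simp only at h1
  subst h1
  congr 1
  funext i
  have := congrFun h i
  simpa [ext0] using this

theorem ext0_sum (p : Σ m : ℕ, Fin m → ℕ) : ∑' n, ext0 p n = ∑ i, p.2 i := by
  rw [tsum_eq_sum (s := Finset.range p.1)]
  · rw [Finset.sum_range]
    apply Finset.sum_congr rfl
    intro i _
    simp [ext0]
  · intro n hn
    simp at hn
    simp [ext0, hn]

theorem card_seq (N : ℕ) (P : ℕ → ℕ → Prop)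
    (hP : ∀ x y, 0 < y → (P y x ↔ T.S y ≤ x)) :
    Nat.card {x : T.Seq // ∑' i, x.u i + ∑' i, x.v i = N} =
    Nat.card {p : Σ m : ℕ, Fin m → ℕ //
        (∀ i : Fin p.1, 0 < p.2 i) ∧
        (∀ i j : Fin p.1, (j : ℕ) = (i : ℕ) + 1 → P (p.2 j) (p.2 i)) ∧
        ∑ i, p.2 i = N} := by
  symm
  have mono : ∀ p : {p : Σ m : ℕ, Fin m → ℕ //
        (∀ i : Fin p.1, 0 < p.2 i) ∧
        (∀ i j : Fin p.1, (j : ℕ) = (i : ℕ) + 1 → P (p.2 j) (p.2 i)) ∧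
        ∑ i, p.2 i = N}, ∀ n, T.S (ext0 p.1 (n+1)) ≤ ext0 p.1 n := by
    rintro ⟨p, h1, h2, h3⟩ n
    unfold ext0
    simp only
    by_cases h : n + 1 < p.1
    · rw [dif_pos h, dif_pos (by omega), ← hP _ _ (h1 _)]
      apply h2; rfl
    · rw [dif_neg h, T.S0]; simp
  let F : ∀ p : {p : Σ m : ℕ, Fin m → ℕ //
        (∀ i : Fin p.1, 0 < p.2 i) ∧
        (∀ i j : Fin p.1, (j : ℕ) = (i : ℕ) + 1 → P (p.2 j) (p.2 i)) ∧
        ∑ i, p.2 i = N}, T.Seq := fun p =>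
    ⟨fun i => ext0 p.1 (2 * i), fun i => ext0 p.1 (2 * i + 1), fun i => mono p _,
      fun i => mono p (2 * i + 1), ⟨p.1.1, fun i hi => by
        unfold ext0
        rw [dif_neg (by omega)]⟩⟩
  have hF : ∀ p, (F p).il T = ext0 p.1 := by
    intro p
    funext n
    obtain ⟨k, rfl | rfl⟩ : ∃ k, n = 2 * k ∨ n = 2 * k + 1 := ⟨n / 2, by omega⟩
    · rw [Seq.il_even]
    · rw [Seq.il_odd]
  refine Nat.card_congr (Equiv.ofBijective (fun p => ⟨F p, ?_⟩) ⟨?_, ?_⟩)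
  · rw [← Seq.il_sum, hF, ext0_sum]; exact p.2.2.2
  · intro p q h
    have h' : F p = F q := congrArg Subtype.val h
    apply Subtype.ext
    apply ext0_inj _ _ p.2.1 q.2.1
    rw [← hF, ← hF, h']
  · rintro ⟨x, hx⟩
    classical
    have hex : ∃ M, x.il T M = 0 := by
      obtain ⟨M, hM⟩ := x.il_fin
      exact ⟨M, hM M le_rfl⟩
    have hlt : ∀ n, n < Nat.find hex → 0 < x.il T n := fun n hn =>
      Nat.pos_of_ne_zero (Nat.find_min hex hn)
    have hge : ∀ n, Nat.find hex ≤ n → x.il T n = 0 := fun n hn => by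
      have := x.il_anti T hn
      have := Nat.find_spec hex
      omega
    let p : Σ m : ℕ, Fin m → ℕ := ⟨Nat.find hex, fun i => x.il T i⟩
    have hp : ext0 p = x.il T := by
      funext n
      unfold ext0
      split_ifs with h
      · rfl
      · exact (hge n (by simpa [p] using h)).symm
    refine ⟨⟨p, fun i => hlt _ i.2, ?_, ?_⟩, ?_⟩
    · intro i j hij
      rw [hP _ _ (hlt _ j.2)]
      show T.S (x.il T j) ≤ x.il T i
      rw [hij]; exact x.il_S T _
    · rw [← ext0_sum, hp, Seq.il_sum]; exact hx
    · apply Subtype.ext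
      apply Seq.ext'
      · funext i
        show ext0 p _ = _
        rw [hp, Seq.il_even]
      · funext i
        show ext0 p _ = _
        rw [hp, Seq.il_odd]

end EllShift

theorem ell_floor_lt (c : ℝ) (y x : ℕ) (hc : 0 ≤ c) (hy : 0 < y) :
    (if y = 0 then 0 else ⌊c * y⌋₊ + 1) ≤ x ↔ c * y < x := by
  rw [if_neg hy.ne', Nat.succ_le_iff, Nat.floor_lt (by positivity)]

noncomputable def ellShift (l : ℕ) (c : ℝ) (hc : 1 ≤ c) (hcl : c * c + 1 = l * c) : EllShift l where
  S y := if y = 0 then 0 else ⌊c * y⌋₊ + 1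
  R x := l * x - (if x = 0 then 0 else ⌊c * x⌋₊ + 1)
  add x := by
    apply Nat.add_sub_of_le
    rcases Nat.eq_zero_or_pos x with rfl | h
    · simp
    · rw [ell_floor_lt c x _ (by linarith) h]
      push_cast
      have : (0:ℝ) < x := by exact_mod_cast h
      have : c < l := by nlinarith
      nlinarith
  gc z x := by
    rcases Nat.eq_zero_or_pos z with rfl | hz
    · simp
    rcases Nat.eq_zero_or_pos x with rfl | h
    · simp
    rw [ell_floor_lt c z _ (by linarith) hz]
    have hz' : (0:ℝ) < z := by exact_mod_cast hz
    have hx' : (0:ℝ) < x := by exact_mod_cast h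
    have e1 : z ≤ l * x - (if x = 0 then 0 else ⌊c * x⌋₊ + 1) ↔
        (if x = 0 then 0 else ⌊c * x⌋₊ + 1) ≤ l * x - z ∧ z ≤ l * x := by
      rw [if_neg h.ne']; omega
    rw [e1, ell_floor_lt c x _ (by linarith) h]
    constructor
    · intro hh
      have h2 : c * x < l * x - z := by
        have : c * (c * x) < c * (l * x - z) := by nlinarith
        exact lt_of_mul_lt_mul_left this (by linarith)
      have h3 : z ≤ l * x := by
        have : (z:ℝ) ≤ l * x := by nlinarith
        exact_mod_cast this
      refine ⟨?_, h3⟩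
      rw [Nat.cast_sub h3]; push_cast; exact h2
    · rintro ⟨h2, h3⟩
      rw [Nat.cast_sub h3] at h2; push_cast at h2
      have : c * (c * x) < c * (l * x - z) := mul_lt_mul_of_pos_left h2 (by linarith)
      nlinarith
  lt x hx := by
    rw [if_neg hx.ne', Nat.lt_succ_iff, Nat.le_floor_iff (by positivity)]
    have : (0:ℝ) < x := by exact_mod_cast hx
    nlinarith


/-- **The ℓ-Euler theorem** (Bousquet-Mélou–Eriksson).  Here `a` is the ℓ-sequence,
specified by its defining recurrence `a_i = ℓ a_{i-1} - a_{i-2}`, `a_0 = 0`, `a_1 = 1`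
as hypotheses, and `c = (ℓ + √(ℓ² - 4))/2` is the largest root of `x² - ℓx + 1`.
The number of partitions of `N` into parts from `{a_i + a_{i-1} : i ≥ 1}` equals the
number of finite strictly decreasing sequences of positive integers summing to `N`
in which each part is more than `c` times the next. -/
theorem ell_euler_theorem (l : ℕ) (hl : 2 ≤ l) (a : ℕ → ℕ)
    (ha0 : a 0 = 0) (ha1 : a 1 = 1)
    (harec : ∀ i : ℕ, (a (i + 2) : ℤ) = l * a (i + 1) - a i)
    (N : ℕ) :
    Nat.card {p : N.Partition //
        ∀ x ∈ p.parts, ∃ i : ℕ, 1 ≤ i ∧ x = a i + a (i - 1)} =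
    Nat.card {p : Σ m : ℕ, Fin m → ℕ //
        (∀ i : Fin p.1, 0 < p.2 i) ∧
        (∀ i j : Fin p.1, (j : ℕ) = (i : ℕ) + 1 →
          p.2 j < p.2 i ∧
            ((l : ℝ) + Real.sqrt ((l : ℝ) ^ 2 - 4)) / 2 * (p.2 j : ℝ) < (p.2 i : ℝ)) ∧
        ∑ i, p.2 i = N} := by
  set c : ℝ := ((l : ℝ) + Real.sqrt ((l : ℝ) ^ 2 - 4)) / 2 with hcdef
  have hl' : (2:ℝ) ≤ l := by exact_mod_cast hl
  have hsq := Real.sq_sqrt (show (0:ℝ) ≤ (l : ℝ) ^ 2 - 4 by nlinarith)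
  have hnn := Real.sqrt_nonneg ((l : ℝ) ^ 2 - 4)
  have hc : 1 ≤ c := by rw [hcdef]; linarith
  have hcl : c * c + 1 = l * c := by rw [hcdef]; nlinarith
  rw [ell_partition_card l hl a ha0 ha1 harec N]
  refine ((ellSysM l hl a ha0 ha1 harec).card_eq (ellShift l c hc hcl).sys N).trans ?_
  refine (ellShift l c hc hcl).card_seq N (fun y x => y < x ∧ c * (y : ℝ) < (x : ℝ)) ?_
  intro x y hy
  refine Iff.trans ?_ (ell_floor_lt c y x (by linarith) hy).symm
  constructor
  · exact fun h => h.2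
  · intro h
    refine ⟨?_, h⟩
    have : (y:ℝ) < x := by nlinarith [(Nat.cast_nonneg y : (0:ℝ) ≤ y)]
    exact_mod_cast this
end

section
/- For every nonnegative integer N, the number of finite sequences λ_1 > λ_2 > ⋯ > λ_k > 0 of positive integers with sum N such that λ_{2i} is even for every i with 2i ≤ k equals the number of partitions of N into parts congruent to 1, 5, or 6 modulo 8. -/
open PowerSeries in
theorem det_inv_mul {k : ℕ} (hk : 0 < k) :
    (1 - (X : ℤ⟦X⟧) ^ k) * invOfUnit (1 - (X : ℤ⟦X⟧) ^ k) 1 = 1 := by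
  apply mul_invOfUnit
  simp [hk.ne']

open PowerSeries in
noncomputable def detInv (k : ℕ) : ℤ⟦X⟧ := invOfUnit (1 - (X : ℤ⟦X⟧) ^ k) 1

open PowerSeries in
theorem detInv_mul (k : ℕ) (hk : 0 < k) : (1 - (X : ℤ⟦X⟧) ^ k) * detInv k = 1 := det_inv_mul hk

open PowerSeries in
noncomputable def detU (m : ℕ) : ℕ → ℤ⟦X⟧
  | 0 => 1
  | n + 1 => detU m n * (X ^ (4*n+4*m+1) * (1 + X^(4*n+1)) * detInv (4*n+4) * detInv (4*m+2+4*n))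

open PowerSeries in
theorem detU_shift (m n : ℕ) :
    detU (m+1) n * (1 - X^(4*m+2+4*n)) = X^(4*n) * (1 - X^(4*m+2)) * detU m n := by
  induction n with
  | zero => simp [detU]
  | succ n ih =>
    have h1 := detInv_mul (4*m+2+4*n) (by omega)
    have h2 := detInv_mul (4*(m+1)+2+4*n) (by omega)
    have e : 4*m+2+4*(n+1) = 4*(m+1)+2+4*n := by ring
    simp only [detU, e]
    have e1 : (X:ℤ⟦X⟧)^(4*n+4*(m+1)+1) = X^4 * X^(4*n+4*m+1) := by ring
    have e2 : (X:ℤ⟦X⟧)^(4*(n+1)) = X^4 * X^(4*n) := by ring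
    rw [e1, e2]
    generalize (X:ℤ⟦X⟧)^(4*n+4*m+1) = a at *
    generalize (X:ℤ⟦X⟧)^(4*(m+1)+2+4*n) = b at *
    generalize detInv (4*(m+1)+2+4*n) = b' at *
    generalize (X:ℤ⟦X⟧)^(4*m+2+4*n) = c at *
    generalize detInv (4*m+2+4*n) = c' at *
    generalize detInv (4*n+4) = d at *
    generalize (X:ℤ⟦X⟧)^(4*n+1) = f at *
    generalize (X:ℤ⟦X⟧)^(4*n) = g at *
    linear_combination (X^4 * a * (1+f) * d) * (c' * ih + detU (m+1) n * h2 - detU (m+1) n * h1)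

open PowerSeries in
theorem detU_tel (m L : ℕ) :
    (1 - X^(4*m+2)) * ∑ n ∈ Finset.range L, detU m n
      - (1 + X^(4*m+1)) * ∑ n ∈ Finset.range L, detU (m+1) n
      = - ((1 - X^(4*m+2)) * detU m L * (1 - X^(4*L))) := by
  induction L with
  | zero => simp
  | succ n ih =>
    rw [Finset.sum_range_succ, Finset.sum_range_succ]
    have h := detU_shift m n
    have h1 := detInv_mul (4*m+2+4*n) (by omega)
    have h2 := detInv_mul (4*n+4) (by omega)
    have e : 4 * (n+1) = 4*n+4 := by ring
    simp only [detU, e]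
    have e1 : (X:ℤ⟦X⟧)^(4*n+4*m+1) = X^(4*n) * X^(4*m+1) := by ring
    have e2 : (X:ℤ⟦X⟧)^(4*m+2+4*n) = X^(4*n) * (X * X^(4*m+1)) := by ring
    have e3 : (X:ℤ⟦X⟧)^(4*n+1) = X * X^(4*n) := by ring
    have e4 : (X:ℤ⟦X⟧)^(4*m+2) = X * X^(4*m+1) := by ring
    -- U (m+1) n = X^(4n) (1-c) U inv
    have h' : detU (m+1) n = X^(4*n) * (1 - X^(4*m+2)) * detU m n * detInv (4*m+2+4*n) := by
      rw [← h]; linear_combination (-detU (m+1) n) * h1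
    rw [h']
    rw [e4] at ih ⊢
    rw [e1, e3]
    rw [e2] at h1
    generalize (X:ℤ⟦X⟧)^(4*n+4) = b at *
    generalize detInv (4*n+4) = b' at *
    generalize detInv (4*m+2+4*n) = c' at *
    generalize (X:ℤ⟦X⟧)^(4*m+1) = a at *
    generalize (X:ℤ⟦X⟧)^(4*n) = g at *
    generalize detU m n = u at *
    linear_combination ih + (1 - X*a)*u*(g*a*(1+X*g))*c' * h2 - (1-X*a)*u*g*h1

open PowerSeries in
theorem detU_dvd (m n : ℕ) : (X:ℤ⟦X⟧)^(n*(4*m+1)) ∣ detU m n := by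
  induction n with
  | zero => simp
  | succ n ih =>
    rw [detU, add_mul, pow_add]
    refine mul_dvd_mul ih ?_
    refine Dvd.dvd.mul_right (Dvd.dvd.mul_right (Dvd.dvd.mul_right ?_ _) _) _
    exact pow_dvd_pow _ (by omega)

open PowerSeries in
theorem detU_prod (L M : ℕ) : (X:ℤ⟦X⟧)^L ∣ ∑ n ∈ Finset.range L, detU 0 n
    - (∏ m ∈ Finset.range M, ((1 + X^(4*m+1)) * detInv (4*m+2))) * ∑ n ∈ Finset.range L, detU M n := by
  induction M with
  | zero => simp
  | succ M ih =>
    have h := detU_tel M L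
    have h1 := detInv_mul (4*M+2) (by omega)
    obtain ⟨v, hv⟩ : (X:ℤ⟦X⟧)^L ∣ detU M L :=
      (pow_dvd_pow _ (by nlinarith)).trans (detU_dvd M L)
    obtain ⟨w, hw⟩ := ih
    rw [Finset.prod_range_succ]
    rw [hv] at h
    generalize ∏ m ∈ Finset.range M, ((1 + (X:ℤ⟦X⟧)^(4*m+1)) * detInv (4*m+2)) = p at *
    generalize ∑ n ∈ Finset.range L, detU M n = s at *
    generalize ∑ n ∈ Finset.range L, detU (M+1) n = s' at *
    generalize ∑ n ∈ Finset.range L, detU 0 n = s0 at *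
    refine ⟨w - p * v * (1 - X^(4*L)) , ?_⟩
    linear_combination hw + p * detInv (4*M+2) * h - p * s * h1 - p*X^L*v*(1-X^(4*L)) * h1

open PowerSeries in
theorem detU_sum_one (L M : ℕ) : (X:ℤ⟦X⟧)^M ∣ ∑ n ∈ Finset.range (L+1), detU M n - 1 := by
  rw [Finset.sum_range_succ']
  simp only [detU.eq_1, add_sub_cancel_right]
  refine Finset.dvd_sum fun i _ => (pow_dvd_pow _ ?_).trans (detU_dvd M (i+1))
  nlinarith

open PowerSeries in
theorem det_lhs (N M : ℕ) (h : N < M) : coeff N (∑ n ∈ Finset.range (N+1), detU 0 n) =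
    coeff N (∏ m ∈ Finset.range M, ((1 + (X:ℤ⟦X⟧)^(4*m+1)) * detInv (4*m+2))) := by
  have h1 := detU_prod (N+1) M
  have h2 := (pow_dvd_pow (X:ℤ⟦X⟧) (show N+1 ≤ M from h)).trans (detU_sum_one N M)
  have h3 := dvd_add h1 (h2.mul_left (∏ m ∈ Finset.range M, ((1 + (X:ℤ⟦X⟧)^(4*m+1)) * detInv (4*m+2))))
  rw [X_pow_dvd_iff] at h3
  have := h3 N (by omega)
  rw [← sub_eq_zero, ← map_sub, ← this]
  congr 1
  ring

open PowerSeries in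
theorem det_tail (M K : ℕ) : (X:ℤ⟦X⟧)^M ∣ ∏ j ∈ Finset.range K, (1 - X^(8*(M+j)+2)) - 1 := by
  induction K with
  | zero => simp
  | succ K ih =>
    rw [Finset.prod_range_succ]
    have : (X:ℤ⟦X⟧)^M ∣ X^(8*(M+K)+2) := pow_dvd_pow _ (by omega)
    have := dvd_sub ih (this.mul_left (∏ j ∈ Finset.range K, (1 - X^(8*(M+j)+2))))
    convert! this using 1
    ring

open PowerSeries in
theorem det_A_K (M : ℕ) :
    (∏ j ∈ Finset.range M, (detInv (8*j+1) * detInv (8*j+5) * detInv (8*j+6)))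
      * ∏ j ∈ Finset.range (2*M), (1 - X^(8*j+2))
    = (∏ m ∈ Finset.range (2*M), ((1 + (X:ℤ⟦X⟧)^(4*m+1)) * detInv (4*m+2))) *
      ∏ j ∈ Finset.range M, (1 - X^(8*j+2)) := by
  induction M with
  | zero => simp
  | succ M ih =>
    rw [show 2*(M+1) = 2*M+1+1 by ring]
    simp only [Finset.prod_range_succ]
    have e1 : (X:ℤ⟦X⟧)^(8*(2*M)+2) = X^(8*M+1) * X^(8*M+1) := by ring
    have e2 : (X:ℤ⟦X⟧)^(8*(2*M+1)+2) = X^(8*M+5) * X^(8*M+5) := by ring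
    have e3 : 4*(2*M)+1 = 8*M+1 := by ring
    have e4 : 4*(2*M+1)+1 = 8*M+5 := by ring
    have e5 : 4*(2*M)+2 = 8*M+2 := by ring
    have e6 : 4*(2*M+1)+2 = 8*M+6 := by ring
    rw [e1, e2, e3, e4, e5, e6]
    have h1 := detInv_mul (8*M+1) (by omega)
    have h2 := detInv_mul (8*M+5) (by omega)
    have h3 := detInv_mul (8*M+2) (by omega)
    generalize detInv (8*M+1) = a' at *
    generalize detInv (8*M+5) = b' at *
    generalize detInv (8*M+2) = c' at *
    generalize detInv (8*M+6) = d' at *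
    generalize (X:ℤ⟦X⟧)^(8*M+1) = a at *
    generalize (X:ℤ⟦X⟧)^(8*M+5) = b at *
    generalize (X:ℤ⟦X⟧)^(8*M+2) = c at *
    generalize ∏ j ∈ Finset.range M, (detInv (8*j+1) * detInv (8*j+5) * detInv (8*j+6)) = p at *
    generalize (∏ m ∈ Finset.range (2*M), ((1 + (X:ℤ⟦X⟧)^(4*m+1)) * detInv (4*m+2))) = q at *
    generalize (∏ j ∈ Finset.range M, (1 - (X:ℤ⟦X⟧)^(8*j+2))) = r at *
    generalize (∏ j ∈ Finset.range (2*M), (1 - (X:ℤ⟦X⟧)^(8*j+2))) = s at *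
    have g1 : (1 - a*a)*a' = 1 + a := by linear_combination (1+a)*h1
    have g2 : (1 - b*b)*b' = 1 + b := by linear_combination (1+b)*h2
    calc _ = (p * s) * ((1 - a*a)*a') * ((1 - b*b)*b') * d' := by ring
      _ = (q * r) * (1+a)*(1+b)*d' * ((1-c)*c') := by rw [ih, g1, g2, h3]; ring
      _ = _ := by ring

open PowerSeries in
theorem det_A_K' (M : ℕ) :
    (∏ j ∈ Finset.range M, (detInv (8*j+1) * detInv (8*j+5) * detInv (8*j+6)))
      * ∏ j ∈ Finset.range M, (1 - X^(8*(M+j)+2))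
    = (∏ m ∈ Finset.range (2*M), ((1 + (X:ℤ⟦X⟧)^(4*m+1)) * detInv (4*m+2))) := by
  have h := det_A_K M
  rw [two_mul M, Finset.prod_range_add, ← two_mul] at h
  have h0 : (∏ j ∈ Finset.range M, (1 - (X:ℤ⟦X⟧)^(8*j+2))) * ∏ j ∈ Finset.range M, detInv (8*j+2) = 1 := by
    rw [← Finset.prod_mul_distrib]
    exact Finset.prod_eq_one fun j _ => detInv_mul _ (by omega)
  linear_combination (∏ j ∈ Finset.range M, detInv (8*j+2)) * h +
   ((∏ m ∈ Finset.range (2*M), ((1 + (X:ℤ⟦X⟧)^(4*m+1)) * detInv (4*m+2))) - (∏ j ∈ Finset.range M, (detInv (8*j+1) * detInv (8*j+5) * detInv (8*j+6)))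
      * ∏ j ∈ Finset.range M, (1 - X^(8*(M+j)+2))) * h0

open PowerSeries in
theorem det_mid (N M : ℕ) (h : N < M) : coeff N (∑ n ∈ Finset.range (N+1), detU 0 n) =
    coeff N (∏ j ∈ Finset.range M, (detInv (8*j+1) * detInv (8*j+5) * detInv (8*j+6))) := by
  rw [det_lhs N (2*M) (by omega), ← det_A_K', ← sub_eq_zero, ← map_sub]
  have h2 := (pow_dvd_pow (X:ℤ⟦X⟧) (show N+1 ≤ M from h)).trans (det_tail M M)
  have h3 := h2.mul_left (∏ j ∈ Finset.range M, (detInv (8*j+1) * detInv (8*j+5) * detInv (8*j+6)))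
  rw [mul_sub, mul_one, X_pow_dvd_iff] at h3
  exact h3 N (by omega)

open PowerSeries PowerSeries.WithPiTopology in
theorem det_tsum (k : ℕ) : ∑' j : ℕ, (X:ℤ⟦X⟧)^((k+1)*j) = detInv (k+1) := by
  have h1 := detInv_mul (k+1) (by omega)
  have h2 : (∑' j : ℕ, (X:ℤ⟦X⟧)^((k+1)*j)) * (1 - X^(k+1)) = 1 := by
    simp_rw [pow_mul]
    exact tsum_pow_mul_one_sub_of_constantCoeff_eq_zero (by simp)
  calc _ = (∑' j : ℕ, (X:ℤ⟦X⟧)^((k+1)*j)) * ((1 - X^(k+1)) * detInv (k+1)) := by rw [h1, mul_one]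
    _ = _ := by rw [← mul_assoc, h2, one_mul]

theorem det_prod8 (f : ℕ → PowerSeries ℤ) (M : ℕ) :
    ∏ i ∈ Finset.range (8*M), (if ((i+1) % 8 = 1 ∨ (i+1) % 8 = 5 ∨ (i+1)%8 = 6) then f (i+1) else 1)
    = ∏ j ∈ Finset.range M, (f (8*j+1) * f (8*j+5) * f (8*j+6)) := by
  induction M with
  | zero => simp
  | succ M ih =>
    rw [show 8*(M+1) = 8*M+1+1+1+1+1+1+1+1 by ring]
    simp only [Finset.prod_range_succ, ih]
    rw [if_pos (by omega), if_neg (by omega), if_neg (by omega), if_neg (by omega),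
      if_pos (by omega), if_pos (by omega), if_neg (by omega), if_neg (by omega)]
    simp only [mul_one, mul_assoc]

open PowerSeries PowerSeries.WithPiTopology in
theorem det_rhs (N : ℕ) : (Nat.card {p : N.Partition //
        ∀ x ∈ p.parts, x % 8 = 1 ∨ x % 8 = 5 ∨ x % 8 = 6} : ℤ) =
    coeff N (∑ n ∈ Finset.range (N+1), detU 0 n) := by
  have h := Nat.Partition.hasProd_powerSeriesMk_card_restricted ℤ
    (fun x => x % 8 = 1 ∨ x % 8 = 5 ∨ x % 8 = 6)
  simp_rw [det_tsum] at h
  have h' := h.tendsto_prod_nat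
  rw [tendsto_iff_coeff_tendsto] at h'
  have h2 := (h' N).comp (Filter.tendsto_id.const_mul_atTop' (show 0 < 8 by norm_num))
  rw [nhds_discrete, Filter.tendsto_pure] at h2
  obtain ⟨M, hM, hM'⟩ := (h2.and (Filter.eventually_gt_atTop N)).exists
  rw [det_mid N M hM', ← det_prod8]
  simp only [Function.comp, id, coeff_mk] at hM
  rw [hM, Nat.card_eq_fintype_card, Fintype.card_subtype]
  rfl

open PowerSeries in
noncomputable def detGf {α : Type} (w : α → ℕ) : ℤ⟦X⟧ :=
  PowerSeries.mk fun N => (Set.ncard {a | w a = N} : ℤ)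

def DetFib {α : Type} (w : α → ℕ) : Prop := ∀ N, {a | w a = N}.Finite

theorem DetFib.le {α : Type} {w : α → ℕ} (h : DetFib w) (N : ℕ) : {a | w a ≤ N}.Finite := by
  have : {a | w a ≤ N} = ⋃ i ∈ Set.Iic N, {a | w a = i} := by ext; simp
  rw [this]
  exact (Set.finite_Iic N).biUnion fun i _ => h i

theorem DetFib.nat {α : Type} {w : α → ℕ} (h : DetFib w) (k : ℕ) (hk : 0 < k) :
    DetFib (fun x : α × ℕ => w x.1 + k * x.2) := by
  intro N
  refine ((h.le N).prod (Set.finite_Iic N)).subset ?_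
  rintro ⟨a, t⟩ hx
  simp only [Set.mem_ofPred_eq] at hx
  simp only [Set.mem_prod, Set.mem_ofPred_eq, Set.mem_Iic]
  constructor
  · omega
  · nlinarith

theorem DetFib.bool {α : Type} {w : α → ℕ} (h : DetFib w) (x y : ℕ) :
    DetFib (fun z : α × Bool => w z.1 + if z.2 then x else y) := by
  intro N
  refine ((h.le N).prod (Set.finite_univ)).subset ?_
  rintro ⟨a, t⟩ hx
  simp only [Set.mem_ofPred_eq] at hx
  simp only [Set.mem_prod, Set.mem_ofPred_eq, Set.mem_univ, and_true]
  omega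

open PowerSeries in
theorem detGf_nat {α : Type} {w : α → ℕ} (h : DetFib w) (k : ℕ) (hk : 0 < k) :
    detGf (fun x : α × ℕ => w x.1 + k * x.2) * (1 - X^k) = detGf w := by
  have hf := h.nat k hk
  ext N
  rw [mul_sub, mul_one, map_sub, coeff_mul_X_pow']
  simp only [detGf, coeff_mk]
  rw [sub_eq_iff_eq_add]
  have h0 : Set.ncard ((fun a : α => (a, 0)) '' {a | w a = N}) = Set.ncard {a | w a = N} :=
    Set.ncard_image_of_injective _ (fun a b hab => by simpa using hab)
  split_ifs with hN
  · have h1 : Set.ncard ((fun x : α × ℕ => (x.1, x.2+1)) '' {x | w x.1 + k * x.2 = N - k}) =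
        Set.ncard {x : α × ℕ | w x.1 + k * x.2 = N - k} :=
      Set.ncard_image_of_injective _ (fun a b hab => by
        simp at hab; exact Prod.ext hab.1 hab.2)
    rw [← h0, ← h1, ← Nat.cast_add, ← Set.ncard_union_eq ?_ ((h N).image _) ((hf (N-k)).image _)]
    · congr 2
      ext ⟨a, t⟩
      simp only [Set.mem_ofPred_eq, Set.mem_union, Set.mem_image, Prod.mk.injEq, Prod.exists]
      constructor
      · intro hh
        rcases t with _ | t
        · left; exact ⟨a, by simpa using hh, rfl, rfl⟩
        · right; refine ⟨a, t, ?_, rfl, rfl⟩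
          rw [mul_add] at hh; omega
      · rintro (⟨b, hb, rfl, rfl⟩ | ⟨b, s, hb, rfl, rfl⟩)
        · simpa using hb
        · rw [mul_add]; omega
    · rw [Set.disjoint_left]
      rintro ⟨a, t⟩ ⟨b, _, hb⟩ ⟨c, _, hc⟩
      simp at hb hc
      omega
  · rw [add_zero, ← h0]
    congr 2
    ext ⟨a, t⟩
    simp only [Set.mem_ofPred_eq, Set.mem_image, Prod.mk.injEq]
    constructor
    · intro hh
      rcases t with _ | t
      · exact ⟨a, by simpa using hh, rfl, rfl⟩
      · rw [mul_add] at hh; omega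
    · rintro ⟨b, hb, rfl, rfl⟩
      simpa using hb

theorem det_ncard_shift {α : Type} (w : α → ℕ) (x N : ℕ) :
    (Set.ncard {a | w a + x = N} : ℤ) = if x ≤ N then (Set.ncard {a | w a = N - x} : ℤ) else 0 := by
  split_ifs with h
  · congr 3
    ext a
    omega
  · have : {a | w a + x = N} = ∅ := by
      ext a
      simp only [Set.mem_ofPred_eq, Set.mem_empty_iff_false, iff_false]
      omega
    simp [this]

open PowerSeries in
theorem detGf_bool {α : Type} {w : α → ℕ} (h : DetFib w) (x y : ℕ) :
    detGf (fun z : α × Bool => w z.1 + if z.2 then x else y) = detGf w * (X^x + X^y) := by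
  have hx : ∀ x N, {a | w a + x = N}.Finite := fun x N => (h.le N).subset (by
    intro a ha; simp only [Set.mem_ofPred_eq] at ha ⊢; omega)
  ext N
  rw [mul_add, map_add, coeff_mul_X_pow', coeff_mul_X_pow']
  simp only [detGf, coeff_mk]
  rw [← det_ncard_shift, ← det_ncard_shift]
  have h1 : Set.ncard ((fun a : α => (a, true)) '' {a | w a + x = N}) = Set.ncard {a | w a + x = N} :=
    Set.ncard_image_of_injective _ (fun a b hab => by simpa using hab)
  have h2 : Set.ncard ((fun a : α => (a, false)) '' {a | w a + y = N}) = Set.ncard {a | w a + y = N} :=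
    Set.ncard_image_of_injective _ (fun a b hab => by simpa using hab)
  rw [← h1, ← h2, ← Nat.cast_add, ← Set.ncard_union_eq ?_ ((hx _ _).image _) ((hx _ _).image _)]
  · congr 2
    ext ⟨a, t⟩
    cases t <;> simp
  · rw [Set.disjoint_left]
    rintro ⟨a, t⟩ ⟨b, _, hb⟩ ⟨c, _, hc⟩
    have h3 := (congrArg Prod.snd hb).trans (congrArg Prod.snd hc).symm
    simp at h3

/-- Codes: `n` layers `(ε, e, t)`. -/
def DetV : ℕ → Type
  | 0 => Unit
  | n + 1 => ((DetV n × Bool) × ℕ) × ℕ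

def detW : (n : ℕ) → DetV n → ℕ
  | 0, _ => 0
  | n + 1, x => ((detW n x.1.1.1 + if x.1.1.2 then 8*n+2 else 4*n+1) + (4*n+2) * x.1.2) + (4*n+4) * x.2

theorem detW_fib (n : ℕ) : DetFib (detW n) := by
  induction n with
  | zero => intro N; exact Set.Finite.subset (Set.finite_univ (α := Unit)) (Set.subset_univ _)
  | succ n ih => exact ((ih.bool (8*n+2) (4*n+1)).nat (4*n+2) (by omega)).nat (4*n+4) (by omega)

open PowerSeries in
theorem detW_gf (n : ℕ) : detGf (detW n) = detU 0 n := by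
  induction n with
  | zero =>
    ext N
    simp only [detGf, coeff_mk, detU, coeff_one]
    split_ifs with h
    · subst h
      have : {a : DetV 0 | detW 0 a = 0} = {(show DetV 0 from ())} := by
        ext a; simp [detW]; rfl
      rw [this]; exact_mod_cast Set.ncard_singleton (show DetV 0 from ())
    · have : {a : DetV 0 | detW 0 a = N} = ∅ := by
        ext a; simp [detW]; omega
      rw [this]; simp
  | succ n ih =>
    have f1 := (detW_fib n).bool (8*n+2) (4*n+1)
    have f2 := f1.nat (4*n+2) (by omega)
    have g1 := detGf_bool (detW_fib n) (8*n+2) (4*n+1)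
    have g2 := detGf_nat f1 (4*n+2) (by omega)
    have g3 := detGf_nat f2 (4*n+4) (by omega)
    have e : detGf (detW (n+1)) * (1 - X^(4*n+4)) * (1 - X^(4*n+2)) = detU 0 n * (X^(8*n+2) + X^(4*n+1)) := by
      rw [← ih, ← g1, ← g2, ← g3]; rfl
    have h1 := detInv_mul (4*n+4) (by omega)
    have h2 := detInv_mul (4*n+2) (by omega)
    rw [detU, show 4*0+2+4*n = 4*n+2 by ring, show 4*n+4*0+1 = 4*n+1 by ring]
    have e1 : (X:ℤ⟦X⟧)^(8*n+2) = X^(4*n+1) * X^(4*n+1) := by ring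
    rw [e1] at e
    generalize detInv (4*n+4) = a' at *
    generalize detInv (4*n+2) = b' at *
    linear_combination a' * b' * e - detGf (detW (n+1)) * (1 - X^(4*n+2)) * b' * h1 - detGf (detW (n+1)) * h2

theorem detW_ge (n : ℕ) (v : DetV n) : n ≤ detW n v := by
  induction n with
  | zero => simp
  | succ n ih =>
    have := ih v.1.1.1
    simp only [detW]
    split_ifs <;> omega

open PowerSeries in
theorem det_codes (N : ℕ) : (Nat.card {x : Σ n, DetV n // detW x.1 x.2 = N} : ℤ) =
    coeff N (∑ n ∈ Finset.range (N+1), detU 0 n) := by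
  have e : {x : Σ n, DetV n // detW x.1 x.2 = N} ≃ Σ n : Fin (N+1), {v : DetV n // detW n v = N} :=
    { toFun := fun x => ⟨⟨x.1.1, by have := detW_ge _ x.1.2; have := x.2; omega⟩, ⟨x.1.2, x.2⟩⟩
      invFun := fun y => ⟨⟨y.1, y.2.1⟩, y.2.2⟩
      left_inv := fun x => rfl
      right_inv := fun y => rfl }
  have : ∀ n : Fin (N+1), Finite {v : DetV n // detW n v = N} := fun n => detW_fib n N
  rw [Nat.card_congr e, Nat.card_sigma, map_sum, Finset.sum_range]
  push_cast
  refine Finset.sum_congr rfl fun n _ => ?_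
  rw [← detW_gf]
  simp only [detGf, coeff_mk]
  rfl

def DetValid (n : ℕ) (l : ℕ → ℕ) : Prop :=
  (∀ i, i + 1 < 2*n → l (i+1) < l i) ∧ (∀ i, i % 2 = 1 → l i % 2 = 0) ∧ ∀ i, 2*n ≤ i → l i = 0

theorem DetValid.unique {n n' : ℕ} {l : ℕ → ℕ} (h : DetValid n l) (h' : DetValid n' l) : n = n' := by
  by_contra hne
  rcases Nat.lt_or_gt_of_ne hne with hl | hl
  · have := h'.1 (2*n) (by omega)
    have := h.2.2 (2*n) le_rfl
    omega
  · have := h.1 (2*n') (by omega)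
    have := h'.2.2 (2*n') le_rfl
    omega

def detD (ε : Bool) (e : ℕ) : ℕ := if ε then 2*e+2 else 2*e+1
def detS (ε : Bool) (e t : ℕ) : ℕ := if ε then t+e+2 else t+e+1

def detDec : (n : ℕ) → DetV n → ℕ → ℕ
  | 0, _ => fun _ => 0
  | n + 1, x => fun i =>
      if i < 2*n then detDec n x.1.1.1 i + 2 * detS x.1.1.2 x.1.2 x.2
      else if i = 2*n then 2 * x.2 + detD x.1.1.2 x.1.2
      else if i = 2*n+1 then 2 * x.2 else 0

theorem detDec_valid (n : ℕ) (v : DetV n) : DetValid n (detDec n v) := by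
  induction n with
  | zero => exact ⟨fun i h => by omega, fun i _ => rfl, fun i _ => rfl⟩
  | succ n ih =>
    obtain ⟨⟨⟨v, ε⟩, e⟩, t⟩ := v
    obtain ⟨h1, h2, h3⟩ := ih v
    simp only [DetValid, detDec]
    refine ⟨fun i hi => ?_, fun i hi => ?_, fun i hi => ?_⟩
    · have := h1 i
      cases ε <;> simp only [detD, detS] <;> split_ifs <;> simp_all <;> omega
    · have := h2 i hi
      split_ifs <;> omega
    · split_ifs <;> omega

theorem detDec_sum (n : ℕ) (v : DetV n) : ∑ i ∈ Finset.range (2*n), detDec n v i = detW n v := by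
  induction n with
  | zero => rfl
  | succ n ih =>
    obtain ⟨⟨⟨v, ε⟩, e⟩, t⟩ := v
    rw [show 2*(n+1) = 2*n+1+1 by ring, Finset.sum_range_succ, Finset.sum_range_succ]
    have : ∑ i ∈ Finset.range (2*n), detDec (n+1) (((v, ε), e), t) i =
        ∑ i ∈ Finset.range (2*n), (detDec n v i + 2 * detS ε e t) := by
      refine Finset.sum_congr rfl fun i hi => ?_
      simp only [detDec]
      rw [if_pos (Finset.mem_range.mp hi)]
    rw [this, Finset.sum_add_distrib, ih]
    cases ε <;> simp [detDec, detW, detD, detS] <;> ring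

theorem detDec_inj (n : ℕ) (v v' : DetV n) (h : detDec n v = detDec n v') : v = v' := by
  induction n with
  | zero => rfl
  | succ n ih =>
    have hv := detDec_valid n v.1.1.1
    have hv' := detDec_valid n v'.1.1.1
    obtain ⟨⟨⟨v, ε⟩, e⟩, t⟩ := v
    obtain ⟨⟨⟨v', ε'⟩, e'⟩, t'⟩ := v'
    have ht := congrFun h (2*n+1)
    have ha := congrFun h (2*n)
    simp [detDec] at ht ha
    subst ht
    have : ε = ε' ∧ e = e' := by
      cases ε <;> cases ε' <;> simp [detD] at ha ⊢ <;> omega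
    obtain ⟨rfl, rfl⟩ := this
    have : v = v' := by
      apply ih
      funext i
      by_cases hi : i < 2*n
      · have := congrFun h i
        simpa [detDec, hi] using this
      · rw [hv.2.2 i (by omega), hv'.2.2 i (by omega)]
    subst this
    rfl

theorem DetValid.anti {n : ℕ} {l : ℕ → ℕ} (h : DetValid n l) (i j : ℕ) (hj : i + j < 2*n) :
    l (i+j) ≤ l i := by
  induction j with
  | zero => simp
  | succ j ih =>
    have := h.1 (i+j) (by omega)
    have := ih (by omega)
    rw [← add_assoc]
    omega

theorem detDec_surj (n : ℕ) (l : ℕ → ℕ) (h : DetValid n l) : ∃ v, detDec n v = l := by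
  induction n generalizing l with
  | zero =>
    refine ⟨(), ?_⟩
    funext i
    exact (h.2.2 i (by omega)).symm
  | succ n ih =>
    obtain ⟨t, ht⟩ : ∃ t, l (2*n+1) = 2*t := ⟨l (2*n+1) / 2, by
      have := h.2.1 (2*n+1) (by omega); omega⟩
    have hlt := h.1 (2*n) (by omega)
    obtain ⟨ε, e, hd⟩ : ∃ ε e, l (2*n) = 2*t + detD ε e := by
      rcases Nat.even_or_odd' (l (2*n)) with ⟨c, hc | hc⟩
      · exact ⟨true, c - t - 1, by simp only [detD]; simp; omega⟩
      · exact ⟨false, c - t, by simp only [detD]; simp; omega⟩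
    have hge : ∀ i, i < 2*n → 2 * detS ε e t ≤ l i := by
      intro i hi
      have h1 := h.anti i (2*n-1-i) (by omega)
      rw [show i + (2*n-1-i) = 2*n-1 by omega] at h1
      have h2 := h.1 (2*n-1) (by omega)
      rw [show 2*n-1+1 = 2*n by omega] at h2
      have h3 := h.2.1 (2*n-1) (by omega)
      cases ε <;> simp [detD, detS] at hd ⊢ <;> omega
    obtain ⟨v, hv⟩ := ih (fun i => if i < 2*n then l i - 2 * detS ε e t else 0) (by
      refine ⟨fun i hi => ?_, fun i hi => ?_, fun i hi => ?_⟩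
      · have := h.1 i (by omega)
        have := hge (i+1) hi
        have := hge i (by omega)
        simp only [hi, show i < 2*n by omega, if_true]
        omega
      · have := h.2.1 i hi
        dsimp only
        split_ifs <;> omega
      · simp only [show ¬ i < 2*n by omega, if_false])
    refine ⟨(((v, ε), e), t), ?_⟩
    funext i
    simp only [detDec, hv]
    split_ifs with h1 h2 h3
    · have := hge i h1; omega
    · subst h2; exact hd.symm
    · subst h3; exact ht.symm
    · exact (h.2.2 i (by omega)).symm

def DetZ (N : ℕ) : Type := {l : ℕ → ℕ // ∃ n, DetValid n l ∧ ∑ i ∈ Finset.range (2*n), l i = N}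

theorem det_card_codes (N : ℕ) :
    Nat.card {x : Σ n, DetV n // detW x.1 x.2 = N} = Nat.card (DetZ N) := by
  refine Nat.card_congr (Equiv.ofBijective (fun x => ⟨detDec x.1.1 x.1.2, x.1.1, detDec_valid _ _,
    (detDec_sum _ _).trans x.2⟩) ⟨?_, ?_⟩)
  · rintro ⟨⟨n, v⟩, hx⟩ ⟨⟨n', v'⟩, hx'⟩ h
    have h' : detDec n v = detDec n' v' := congrArg Subtype.val h
    have hn : n = n' := (detDec_valid n v).unique (h' ▸ detDec_valid n' v')
    subst hn
    have := detDec_inj n v v' h'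
    subst this
    rfl
  · rintro ⟨l, n, hl, hs⟩
    obtain ⟨v, rfl⟩ := detDec_surj n l hl
    exact ⟨⟨⟨n, v⟩, (detDec_sum n v).symm.trans hs⟩, rfl⟩

def detExt (k : ℕ) (f : Fin k → ℕ) (i : ℕ) : ℕ := if h : i < k then f ⟨i, h⟩ else 0

theorem detExt_sum (k K : ℕ) (hK : k ≤ K) (f : Fin k → ℕ) :
    ∑ i ∈ Finset.range K, detExt k f i = ∑ i, f i := by
  rw [← Finset.sum_subset (Finset.range_mono hK), Finset.sum_range]
  · exact Finset.sum_congr rfl fun i _ => by simp [detExt]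
  · intro i _ hi
    simp at hi
    simp [detExt, hi]

theorem det_card_seq (N : ℕ) :
    Nat.card {p : Σ k : ℕ, Fin k → ℕ //
        (∀ i : Fin p.1, 0 < p.2 i) ∧
        (∀ i j : Fin p.1, (j : ℕ) = (i : ℕ) + 1 → p.2 j < p.2 i) ∧
        (∀ m : Fin p.1, ((m : ℕ) + 1) % 2 = 0 → Even (p.2 m)) ∧
        ∑ i, p.2 i = N} = Nat.card (DetZ N) := by
  refine Nat.card_congr (Equiv.ofBijective (fun p => ⟨detExt p.1.1 p.1.2, (p.1.1+1)/2, ?_, ?_⟩) ⟨?_, ?_⟩)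
  · obtain ⟨⟨k, f⟩, h1, h2, h3, h4⟩ := p
    dsimp only at *
    refine ⟨fun i hi => ?_, fun i hi => ?_, fun i hi => ?_⟩
    · by_cases hk : i + 1 < k
      · have hi' : i < k := by omega
        simpa [detExt, hk, hi'] using h2 ⟨i, hi'⟩ ⟨i+1, hk⟩ rfl
      · have hi' : i < k := by omega
        simpa [detExt, hk, hi'] using h1 ⟨i, hi'⟩
    · by_cases hk : i < k
      · have := h3 ⟨i, hk⟩ (by simp only; omega)
        simpa [detExt, hk] using Nat.even_iff.mp this
      · simp [detExt, hk]
    · simp [detExt, show ¬ i < k by omega]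
  · exact (detExt_sum _ _ (by omega) _).trans p.2.2.2.2
  · rintro ⟨⟨k, f⟩, h1, h2, h3, h4⟩ ⟨⟨k', f'⟩, h1', h2', h3', h4'⟩ h
    have h' : detExt k f = detExt k' f' := congrArg Subtype.val h
    dsimp only at *
    have hk : k = k' := by
      by_contra hne
      rcases Nat.lt_or_gt_of_ne hne with hl | hl
      · have := congrFun h' k
        have := h1' ⟨k, hl⟩
        simp_all [detExt]
      · have := congrFun h' k'
        have := h1 ⟨k', hl⟩
        simp_all [detExt]
    subst hk
    have : f = f' := by
      funext i
      simpa [detExt] using congrFun h' i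
    subst this
    rfl
  · rintro ⟨l, n, hl, hs⟩
    have hex : ∃ k, l k = 0 := ⟨2*n, hl.2.2 _ le_rfl⟩
    obtain ⟨k, hk0, hkpos⟩ : ∃ k, l k = 0 ∧ ∀ i < k, 0 < l i :=
      ⟨Nat.find hex, Nat.find_spec hex, fun i hi => Nat.pos_of_ne_zero (Nat.find_min hex hi)⟩
    have hk1 : 2*n ≤ k + 1 := by
      by_contra hc
      have := hl.1 k (by omega)
      omega
    have hk2 : k ≤ 2*n := by
      by_contra hc
      have := hkpos (2*n) (by omega)
      have := hl.2.2 (2*n) le_rfl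
      omega
    have hext : detExt k (fun i => l i) = l := by
      funext i
      by_cases hi : i < k
      · simp [detExt, hi]
      · simp only [detExt, hi, dif_neg, not_false_eq_true]
        rcases Nat.eq_or_lt_of_le (not_lt.mp hi) with rfl | hlt
        · exact hk0.symm
        · exact (hl.2.2 i (by omega)).symm
    refine ⟨⟨⟨k, fun i => l i⟩, fun i => hkpos i i.2, fun i j hij => ?_, fun m hm => ?_, ?_⟩, Subtype.ext hext⟩
    · have := hl.1 i (by have := j.2; simp only at this; omega)
      simp only [hij]; exact this
    · exact Nat.even_iff.mpr (hl.2.1 m (by omega))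
    · rw [← hs, ← detExt_sum k (2*n) hk2, hext]


/-- The number of finite sequences `λ₁ > λ₂ > ⋯ > λ_k > 0` of positive integers with
sum `N` in which every even-indexed part `λ_{2i}` is even (here `p.2` is 0-based, so
the 1-based index of `p.2 m` is `m + 1`) equals the number of partitions of `N` into
parts congruent to `1`, `5`, or `6` modulo `8`. -/
theorem distinct_even_indexed_even (N : ℕ) :
    Nat.card {p : Σ k : ℕ, Fin k → ℕ //
        (∀ i : Fin p.1, 0 < p.2 i) ∧
        (∀ i j : Fin p.1, (j : ℕ) = (i : ℕ) + 1 → p.2 j < p.2 i) ∧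
        (∀ m : Fin p.1, ((m : ℕ) + 1) % 2 = 0 → Even (p.2 m)) ∧
        ∑ i, p.2 i = N} =
    Nat.card {p : N.Partition //
        ∀ x ∈ p.parts, x % 8 = 1 ∨ x % 8 = 5 ∨ x % 8 = 6} := by
  have h := (det_codes N).trans (det_rhs N).symm
  rw [det_card_seq, ← det_card_codes]
  exact_mod_cast h
end

section
/- For every nonnegative integer N, the number of finite sequences λ_1 > λ_2 > ⋯ > λ_k > 0 of positive integers with sum N such that λ_{2i−1} is even for every i with 2i−1 ≤ k equals the number of partitions of N into parts congruent to 2, 3, or 7 modulo 8. -/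
open Finset PowerSeries

/-- the pair of recursively defined series `(α, β)` -/
def ab {R : Type*} [CommRing R] (q c : R) : ℕ → R × R
  | 0 => (1, 1 + c)
  | m + 1 =>
    let a := (ab q c m).1
    let b := (ab q c m).2
    let a' := a + q ^ (m + 1) * b
    (a', b + q ^ (m + 1) * a + c * q ^ (m + 1) * a')

lemma ab_one {R : Type*} [CommRing R] (q c : R) (m : ℕ) :
    (ab q c (m+1)).1 = (ab q c m).1 + q ^ (m + 1) * (ab q c m).2 := rfl

lemma ab_two {R : Type*} [CommRing R] (q c : R) (m : ℕ) :
    (ab q c (m+1)).2 = (ab q c m).2 + q ^ (m + 1) * (ab q c m).1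
      + c * q ^ (m + 1) * (ab q c (m+1)).1 := rfl

lemma ab_key {R : Type*} [CommRing R] (q : R) (m : ℕ) : ∀ c : R,
    (ab q c m).2 = (1 + c) * (ab q (c * q) m).1 ∧
    (ab q (c * q) m).2 = (ab q c m).1 + c * q ^ (m + 1) * (ab q (c * q) m).1 := by
  induction m with
  | zero => intro c; simp [ab]
  | succ m ih =>
    intro c
    obtain ⟨h1, h2⟩ := ih c
    constructor
    · rw [ab_two, ab_one, ab_one, h2, h1]; ring
    · rw [ab_two q (c*q), h2, ab_one q c, h1]; ring

lemma ab_step {R : Type*} [CommRing R] (q : R) (m : ℕ) (c : R) :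
    (ab q c m).1 = (1 + c * q) * (ab q (c * q ^ 2) m).1
      - c * q ^ (m + 1) * (ab q (c * q) m).1 := by
  have h1 := (ab_key q m (c * q)).1
  have h2 := (ab_key q m c).2
  rw [show c * q ^ 2 = c * q * q by ring, ← h1, h2]; ring

lemma ab_iter {R : Type*} [CommRing R] (q c : R) (m : ℕ) (r : ℕ) :
    q ^ (m + 1) ∣ (ab q c m).1
      - (∏ i ∈ range r, (1 + c * q ^ (2 * i + 1))) * (ab q (c * q ^ (2 * r)) m).1 := by
  induction r with
  | zero => simp
  | succ r ih =>
    have h := ab_step q m (c * q ^ (2 * r))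
    rw [h] at ih
    rw [prod_range_succ]
    obtain ⟨y, hy⟩ := ih
    refine ⟨y - (∏ i ∈ range r, (1 + c * q ^ (2 * i + 1))) * (c * q ^ (2 * r)
      * (ab q (c * q ^ (2 * r) * q) m).1), ?_⟩
    rw [show c * q ^ (2 * (r + 1)) = c * q ^ (2 * r) * q ^ 2 by ring]
    linear_combination hy

lemma ab_zero {R : Type*} [CommRing R] (q : R) (m : ℕ) :
    (ab q 0 m).1 = ∏ i ∈ range m, (1 + q ^ (i + 1)) := by
  induction m with
  | zero => simp [ab]
  | succ m ih =>
    have := (ab_key q m 0).1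
    rw [ab_one, this, prod_range_succ, ← ih]; simp; ring

lemma ab_dvd {R : Type*} [CommRing R] (q c : R) (m : ℕ) :
    c ∣ (ab q c m).1 - (ab q 0 m).1 ∧ c ∣ (ab q c m).2 - (ab q 0 m).2 := by
  induction m with
  | zero => simp [ab]
  | succ m ih =>
    obtain ⟨⟨x, hx⟩, ⟨y, hy⟩⟩ := ih
    rw [ab_two, ab_two, ab_one, ab_one]
    constructor
    · exact ⟨x + q ^ (m+1) * y, by linear_combination hx + q ^ (m+1) * hy⟩
    · exact ⟨y + q ^ (m+1) * x + q ^ (m+1) * ((ab q c m).1 + q ^ (m+1) * (ab q c m).2),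
        by linear_combination hy + q ^ (m+1) * hx⟩

/-- the candidate product -/
noncomputable def QQ (R : ℕ) : ℤ⟦X⟧ :=
  (∏ r ∈ range (2 * R), (1 + X ^ (4 * r + 3))) * ∏ i ∈ range (4 * R), (1 + X ^ (2 * i + 2))

lemma ab_QQ (R : ℕ) :
    (X : ℤ⟦X⟧) ^ (8 * R) ∣ (ab ((X : ℤ⟦X⟧) ^ 2) X (4 * R)).1 - QQ R := by
  have h1 := ab_iter ((X : ℤ⟦X⟧) ^ 2) X (4 * R) (2 * R)
  have h2 := (ab_dvd ((X : ℤ⟦X⟧) ^ 2) (X * (X ^ 2) ^ (2 * (2 * R))) (4 * R)).1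
  rw [ab_zero] at h2
  have e1 : ∏ i ∈ range (2 * R), (1 + (X : ℤ⟦X⟧) * (X ^ 2) ^ (2 * i + 1))
      = ∏ r ∈ range (2 * R), (1 + X ^ (4 * r + 3)) :=
    prod_congr rfl fun i _ => by ring
  have e2 : ∏ i ∈ range (4 * R), (1 + ((X : ℤ⟦X⟧) ^ 2) ^ (i + 1))
      = ∏ i ∈ range (4 * R), (1 + X ^ (2 * i + 2)) :=
    prod_congr rfl fun i _ => by ring
  rw [e1] at h1
  rw [e2] at h2
  have d1 : (X : ℤ⟦X⟧) ^ (8 * R) ∣ (X ^ 2) ^ (4 * R + 1) := by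
    rw [← pow_mul]; exact pow_dvd_pow _ (by omega)
  have d2 : (X : ℤ⟦X⟧) ^ (8 * R) ∣ X * (X ^ 2) ^ (2 * (2 * R)) := by
    rw [← pow_mul, ← pow_succ']; exact pow_dvd_pow _ (by omega)
  have := dvd_add (d1.trans h1) ((d2.trans h2).mul_left
    (∏ r ∈ range (2 * R), (1 + X ^ (4 * r + 3))))
  rw [QQ]
  convert this using 1
  ring

/-- residue condition -/
abbrev PP (x : ℕ) : Prop := x % 8 = 2 ∨ x % 8 = 3 ∨ x % 8 = 7

/-- denominator -/
noncomputable def DD (M : ℕ) : ℤ⟦X⟧ := ∏ i ∈ range M, (if PP (i + 1) then 1 - X ^ (i + 1) else 1)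

lemma DD_succ (R : ℕ) : DD (8 * (R + 1)) = DD (8 * R) *
    ((1 - X ^ (8 * R + 2)) * (1 - X ^ (8 * R + 3)) * (1 - X ^ (8 * R + 7))) := by
  unfold DD
  rw [show 8 * (R + 1) = 8 * R + 8 by ring, prod_range_add]
  congr 1
  simp only [prod_range_succ, prod_range_zero]
  rw [if_neg (by unfold PP; omega), if_pos (by unfold PP; omega), if_pos (by unfold PP; omega),
    if_neg (by unfold PP; omega), if_neg (by unfold PP; omega), if_neg (by unfold PP; omega),
    if_pos (by unfold PP; omega), if_neg (by unfold PP; omega)]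
  ring

lemma QQ_succ (R : ℕ) : QQ (R + 1) = QQ R * ((1 + X ^ (8 * R + 3)) * (1 + X ^ (8 * R + 7)) *
    ((1 + X ^ (8 * R + 2)) * (1 + X ^ (8 * R + 4)) * (1 + X ^ (8 * R + 6))
      * (1 + X ^ (8 * R + 8)))) := by
  unfold QQ
  rw [show 2 * (R + 1) = 2 * R + 1 + 1 by ring, show 4 * (R + 1) = 4 * R + 1 + 1 + 1 + 1 by ring]
  simp only [prod_range_succ]
  ring

lemma six_succ (R : ℕ) : ∏ r ∈ range (2 * (R + 1)), (1 - (X : ℤ⟦X⟧) ^ (8 * r + 6)) =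
    (∏ r ∈ range (2 * R), (1 - (X : ℤ⟦X⟧) ^ (8 * r + 6))) *
      ((1 - X ^ (16 * R + 6)) * (1 - X ^ (16 * R + 14))) := by
  rw [show 2 * (R + 1) = 2 * R + 1 + 1 by ring]
  simp only [prod_range_succ]
  ring

lemma four_succ (R : ℕ) : ∏ r ∈ range (2 * (R + 1)), (1 - (X : ℤ⟦X⟧) ^ (4 * r + 4)) =
    (∏ r ∈ range (2 * R), (1 - (X : ℤ⟦X⟧) ^ (4 * r + 4))) *
      ((1 - X ^ (8 * R + 4)) * (1 - X ^ (8 * R + 8))) := by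
  rw [show 2 * (R + 1) = 2 * R + 1 + 1 by ring]
  simp only [prod_range_succ]
  ring

lemma four_succ' (R : ℕ) : ∏ r ∈ range (4 * (R + 1)), (1 - (X : ℤ⟦X⟧) ^ (4 * r + 4)) =
    (∏ r ∈ range (4 * R), (1 - (X : ℤ⟦X⟧) ^ (4 * r + 4))) *
      ((1 - X ^ (16 * R + 4)) * (1 - X ^ (16 * R + 8)) * (1 - X ^ (16 * R + 12))
        * (1 - X ^ (16 * R + 16))) := by
  rw [show 4 * (R + 1) = 4 * R + 1 + 1 + 1 + 1 by ring]
  simp only [prod_range_succ]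
  ring

lemma sq_fac (n k : ℕ) (h : k = n + n) :
    (1 - (X : ℤ⟦X⟧) ^ k) = (1 + X ^ n) * (1 - X ^ n) := by
  rw [h, pow_add]; ring

lemma QD (R : ℕ) : QQ R * DD (8 * R) *
    ((∏ r ∈ range R, (1 - (X : ℤ⟦X⟧) ^ (8 * r + 6)))
      * ∏ r ∈ range (2 * R), (1 - (X : ℤ⟦X⟧) ^ (4 * r + 4))) =
    (∏ r ∈ range (2 * R), (1 - (X : ℤ⟦X⟧) ^ (8 * r + 6)))
      * ∏ r ∈ range (4 * R), (1 - (X : ℤ⟦X⟧) ^ (4 * r + 4)) := by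
  induction R with
  | zero => simp [QQ, DD]
  | succ R ih =>
    rw [QQ_succ, DD_succ, six_succ, four_succ, four_succ', prod_range_succ _ R,
      sq_fac (8 * R + 3) (16 * R + 6) (by ring), sq_fac (8 * R + 7) (16 * R + 14) (by ring),
      sq_fac (8 * R + 2) (16 * R + 4) (by ring), sq_fac (8 * R + 4) (16 * R + 8) (by ring),
      sq_fac (8 * R + 6) (16 * R + 12) (by ring), sq_fac (8 * R + 8) (16 * R + 16) (by ring)]
    generalize (X : ℤ⟦X⟧) ^ (8 * R + 2) = a2 at *
    generalize (X : ℤ⟦X⟧) ^ (8 * R + 3) = a3 at *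
    generalize (X : ℤ⟦X⟧) ^ (8 * R + 4) = a4 at *
    generalize (X : ℤ⟦X⟧) ^ (8 * R + 6) = a6 at *
    generalize (X : ℤ⟦X⟧) ^ (8 * R + 7) = a7 at *
    generalize (X : ℤ⟦X⟧) ^ (8 * R + 8) = a8 at *
    have := congrArg (· * ((1 + a3) * (1 - a3) * ((1 + a7) * (1 - a7)) * ((1 + a2) * (1 - a2)
      * ((1 + a4) * (1 - a4)) * ((1 + a6) * (1 - a6)) * ((1 + a8) * (1 - a8))))) ih
    calc _ = _ := by ac_rfl
      _ = _ := this
      _ = _ := by ac_rfl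

lemma prod_one_mod (K n : ℕ) (f : ℕ → ℕ) (hf : ∀ i, K ≤ f i) :
    (X : ℤ⟦X⟧) ^ K ∣ (∏ i ∈ range n, (1 - X ^ f i)) - 1 := by
  induction n with
  | zero => simp
  | succ n ih =>
    rw [prod_range_succ]
    have h : (X : ℤ⟦X⟧) ^ K ∣ X ^ f n := pow_dvd_pow _ (hf n)
    have := dvd_sub ih (h.mul_left (∏ i ∈ range n, (1 - X ^ f i)))
    convert this using 1
    ring

lemma one_sub_ne (n : ℕ) : (1 - (X : ℤ⟦X⟧) ^ (n + 1)) ≠ 0 := by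
  intro h
  have := congrArg (coeff 0) h
  simp [coeff_X_pow] at this

lemma QD_mod (R : ℕ) : (X : ℤ⟦X⟧) ^ (8 * R) ∣ QQ R * DD (8 * R) - 1 := by
  have h := QD R
  rw [show ∏ r ∈ range (2 * R), (1 - (X : ℤ⟦X⟧) ^ (8 * r + 6)) =
      (∏ r ∈ range R, (1 - (X : ℤ⟦X⟧) ^ (8 * r + 6))) *
      ∏ r ∈ range R, (1 - (X : ℤ⟦X⟧) ^ (8 * (R + r) + 6)) by rw [two_mul, prod_range_add],
    show ∏ r ∈ range (4 * R), (1 - (X : ℤ⟦X⟧) ^ (4 * r + 4)) =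
      (∏ r ∈ range (2 * R), (1 - (X : ℤ⟦X⟧) ^ (4 * r + 4))) *
      ∏ r ∈ range (2 * R), (1 - (X : ℤ⟦X⟧) ^ (4 * (2 * R + r) + 4)) by
        rw [show 4 * R = 2 * R + 2 * R by ring, prod_range_add]] at h
  have h1 := prod_one_mod (8 * R) R (fun r => 8 * (R + r) + 6) (fun i => by omega)
  have h2 := prod_one_mod (8 * R) (2 * R) (fun r => 4 * (2 * R + r) + 4) (fun i => by omega)
  have n1 : (∏ r ∈ range R, (1 - (X : ℤ⟦X⟧) ^ (8 * r + 6))) ≠ 0 :=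
    prod_ne_zero_iff.2 fun i _ => one_sub_ne _
  have n2 : (∏ r ∈ range (2 * R), (1 - (X : ℤ⟦X⟧) ^ (4 * r + 4))) ≠ 0 :=
    prod_ne_zero_iff.2 fun i _ => one_sub_ne _
  have h3 : QQ R * DD (8 * R) = (∏ r ∈ range R, (1 - (X : ℤ⟦X⟧) ^ (8 * (R + r) + 6))) *
      ∏ r ∈ range (2 * R), (1 - (X : ℤ⟦X⟧) ^ (4 * (2 * R + r) + 4)) := by
    apply mul_right_cancel₀ (mul_ne_zero n1 n2)
    rw [h]; ac_rfl
  rw [h3]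
  have := dvd_add (h1.mul_right (∏ r ∈ range (2 * R), (1 - (X : ℤ⟦X⟧) ^ (4 * (2 * R + r) + 4)))) h2
  convert this using 1
  ring

open scoped PowerSeries.WithPiTopology in
lemma coeff_QQ (N : ℕ) : ∀ᶠ R in Filter.atTop,
    coeff N (QQ R) = (#(Nat.Partition.restricted N PP) : ℤ) := by
  let _ : TopologicalSpace ℤ := ⊥
  have _ : DiscreteTopology ℤ := ⟨rfl⟩
  have h := Nat.Partition.hasProd_powerSeriesMk_card_restricted ℤ PP
  have h1 := h.tendsto_prod_nat
  rw [WithPiTopology.tendsto_iff_coeff_tendsto] at h1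
  have h2 := h1 N
  rw [nhds_discrete, Filter.tendsto_pure] at h2
  have h3 : Filter.Tendsto (fun R : ℕ => 8 * R) Filter.atTop Filter.atTop :=
    Filter.tendsto_atTop_mono (fun n => by show n ≤ 8 * n; omega) Filter.tendsto_id
  filter_upwards [h3.eventually h2, Filter.eventually_gt_atTop N] with R hR hN
  rw [coeff_mk] at hR
  rw [← hR]
  set F := ∏ i ∈ range (8 * R), if PP (i + 1) then ∑' j : ℕ, (X : ℤ⟦X⟧) ^ ((i + 1) * j) else 1
    with hF
  have hFD : F * DD (8 * R) = 1 := by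
    rw [hF, DD, ← prod_mul_distrib]
    apply prod_eq_one
    intro i _
    split_ifs
    · simp_rw [pow_mul]
      exact WithPiTopology.tsum_pow_mul_one_sub_of_constantCoeff_eq_zero (by simp)
    · simp
  have hd : (X : ℤ⟦X⟧) ^ (8 * R) ∣ QQ R - F := by
    have := (QD_mod R).mul_left F
    convert this using 1
    linear_combination (-QQ R) * hFD
  rw [X_pow_dvd_iff] at hd
  have := hd N (by omega)
  rw [map_sub, sub_eq_zero] at this
  exact this

/-- valid lists; the flag says whether the head is required to be even -/
def VV : Bool → List ℕ → Prop
  | _, [] => True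
  | p, x :: l => 0 < x ∧ (p = true → Even x) ∧ (∀ y ∈ l.head?, y < x) ∧ VV (!p) l

/-- the enumeration of valid lists with head at most `M` -/
def LL : Bool → ℕ → Finset (List ℕ)
  | _, 0 => {[]}
  | p, M + 1 => LL p M ∪ (if p = true → Even (M + 1) then (LL (!p) M).image (List.cons (M + 1)) else ∅)

lemma mem_LL (M : ℕ) : ∀ (p : Bool) (l : List ℕ),
    l ∈ LL p M ↔ VV p l ∧ ∀ y ∈ l.head?, y ≤ M := by
  induction M with
  | zero =>
    intro p l
    cases l with
    | nil => simp [LL, VV]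
    | cons x l => simp [LL, VV]; omega
  | succ M ih =>
    intro p l
    rw [LL, mem_union, ih]
    cases l with
    | nil => simp [VV]
    | cons x l =>
      have key : (x :: l ∈ (if p = true → Even (M + 1) then (LL (!p) M).image (List.cons (M + 1))
          else ∅)) ↔ x = M + 1 ∧ VV p (x :: l) := by
        split_ifs with h
        · simp only [mem_image, ih, List.cons.injEq]
          constructor
          · rintro ⟨l', ⟨h1, h2⟩, h3, rfl⟩
            subst h3
            exact ⟨rfl, by omega, h, fun y hy => by have := h2 y hy; omega, h1⟩
          · rintro ⟨rfl, h1, h2, h3, h4⟩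
            exact ⟨l, ⟨h4, fun y hy => by have := h3 y hy; omega⟩, rfl, rfl⟩
        · simp only [notMem_empty, false_iff]
          rintro ⟨rfl, h1, h2, -⟩
          exact h h2
      rw [key]
      simp only [List.head?_cons, Option.mem_def, Option.some.injEq, forall_eq']
      constructor
      · rintro (⟨h1, h2⟩ | ⟨h1, h2⟩)
        · exact ⟨h1, by omega⟩
        · exact ⟨h2, by omega⟩
      · rintro ⟨h1, h2⟩
        rcases Nat.lt_or_ge M x with h | h
        · exact Or.inr ⟨by omega, h1⟩
        · exact Or.inl ⟨h1, h⟩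

/-- generating series of `LL` -/
noncomputable def GG (p : Bool) (M : ℕ) : ℤ⟦X⟧ := ∑ l ∈ LL p M, X ^ l.sum

lemma GG_succ (p : Bool) (M : ℕ) : GG p (M + 1) = GG p M +
    (if p = true → Even (M + 1) then X ^ (M + 1) * GG (!p) M else 0) := by
  unfold GG
  rw [LL, sum_union]
  · congr 1
    split_ifs
    · rw [sum_image (by intro a _ b _ h; simpa using h), mul_sum]
      exact sum_congr rfl fun l _ => by simp [pow_add]
    · simp
  · rw [disjoint_left]
    intro l h1 h2
    split_ifs at h2
    · obtain ⟨l', h3, rfl⟩ := mem_image.1 h2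
      have := ((mem_LL _ _ _).1 h1).2 (M + 1) (by simp)
      omega
    · simp at h2

lemma GG_ab (m : ℕ) : GG true (2 * m) = (ab ((X : ℤ⟦X⟧) ^ 2) X m).1 ∧
    GG false (2 * m + 1) = (ab ((X : ℤ⟦X⟧) ^ 2) X m).2 := by
  induction m with
  | zero =>
    constructor
    · simp [GG, LL, ab]
    · rw [GG_succ]; simp [GG, LL, ab]
  | succ m ih =>
    have e1 : GG true (2 * m + 1) = GG true (2 * m) := by
      rw [GG_succ, if_neg (by simp), add_zero]
    have e2 : GG true (2 * (m + 1)) = GG true (2 * m) + X ^ (2 * m + 2) * GG false (2 * m + 1) := by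
      rw [show 2 * (m + 1) = 2 * m + 1 + 1 by ring, GG_succ, e1, if_pos (by intro _; exact ⟨m + 1, by ring⟩)]
      rfl
    have e3 : GG false (2 * (m + 1)) = GG false (2 * m + 1) + X ^ (2 * m + 2) * GG true (2 * m) := by
      rw [show 2 * (m + 1) = 2 * m + 1 + 1 by ring, GG_succ, if_pos (by simp), Bool.not_false, e1]
    have e4 : GG false (2 * (m + 1) + 1) = GG false (2 * (m + 1))
        + X ^ (2 * m + 3) * GG true (2 * (m + 1)) := by
      rw [GG_succ, if_pos (by simp), Bool.not_false]
      rfl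
    have e5 : GG true (2 * (m + 1)) = (ab ((X : ℤ⟦X⟧) ^ 2) X (m + 1)).1 := by
      rw [e2, ab_one, ih.1, ih.2]; ring
    refine ⟨e5, ?_⟩
    rw [e4, e3, e5, ab_two, ih.1, ih.2]; ring

lemma coeff_GG (N M : ℕ) (h : N ≤ M) :
    coeff N (GG true M) = (Nat.card {l : List ℕ // VV true l ∧ l.sum = N} : ℤ) := by
  have : Nat.card {l : List ℕ // VV true l ∧ l.sum = N} = #((LL true M).filter (fun l => l.sum = N)) := by
    refine Nat.subtype_card _ ?_
    intro l
    rw [mem_filter, mem_LL]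
    refine ⟨fun h => ⟨h.1.1, h.2⟩, fun h' => ⟨⟨h'.1, fun y hy => ?_⟩, h'.2⟩⟩
    have h1 := List.le_sum_of_mem (List.mem_of_mem_head? hy)
    omega
  rw [this, GG, map_sum, card_filter]
  push_cast
  refine sum_congr rfl fun l _ => ?_
  rw [coeff_X_pow]
  simp [eq_comm]

lemma VV_ofFn (k : ℕ) : ∀ (p : Bool) (f : Fin k → ℕ), VV p (List.ofFn f) ↔
    (∀ i, 0 < f i) ∧ (∀ i j : Fin k, (j : ℕ) = (i : ℕ) + 1 → f j < f i) ∧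
    (∀ m : Fin k, ((m : ℕ) + p.toNat) % 2 = 1 → Even (f m)) := by
  induction k with
  | zero => intro p f; simp [VV]
  | succ k ih =>
    intro p f
    rw [List.ofFn_succ, VV, ih]
    have hh : (∀ y ∈ (List.ofFn fun i : Fin k => f i.succ).head?, y < f 0) ↔
        ∀ j : Fin k, (j : ℕ) = 0 → f j.succ < f 0 := by
      cases k with
      | zero => simp
      | succ k =>
        simp only [List.ofFn_succ, List.head?_cons, Option.mem_def, Option.some.injEq, forall_eq']
        constructor
        · intro h j hj
          rwa [show j = 0 from Fin.ext hj]
        · intro h; exact h 0 rfl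
    have hp : ∀ n : ℕ, ((n + (!p).toNat) % 2 = 1) ↔ ((n + 1 + p.toNat) % 2 = 1) := by
      intro n; cases p <;> simp <;> omega
    have hp' : (p = true) ↔ ((0 + p.toNat) % 2 = 1) := by cases p <;> simp
    rw [hh]
    simp only [Fin.forall_fin_succ (n := k), Fin.val_succ, Fin.val_zero, hp, hp']
    simp only [Nat.add_right_cancel_iff]
    constructor
    · rintro ⟨h1, h2, h3, h4, h5, h6⟩
      refine ⟨⟨h1, h4⟩, ⟨⟨by simp, fun i hi => h3 i (by omega)⟩, fun i => ⟨by simp, h5 i⟩⟩, h2, h6⟩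
    · rintro ⟨⟨h1, h2⟩, ⟨⟨-, h3⟩, h4⟩, h5, h6⟩
      exact ⟨h1, h5, fun j hj => h3 j (by omega), h2, fun i => (h4 i).2, h6⟩

/-- The number of finite sequences `λ₁ > λ₂ > ⋯ > λ_k > 0` of positive integers with
sum `N` in which every odd-indexed part `λ_{2i-1}` is even (here `p.2` is 0-based, so
the 1-based index of `p.2 m` is `m + 1`) equals the number of partitions of `N` into
parts congruent to `2`, `3`, or `7` modulo `8`. -/
theorem distinct_odd_indexed_even (N : ℕ) :
    Nat.card {p : Σ k : ℕ, Fin k → ℕ //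
        (∀ i : Fin p.1, 0 < p.2 i) ∧
        (∀ i j : Fin p.1, (j : ℕ) = (i : ℕ) + 1 → p.2 j < p.2 i) ∧
        (∀ m : Fin p.1, ((m : ℕ) + 1) % 2 = 1 → Even (p.2 m)) ∧
        ∑ i, p.2 i = N} =
    Nat.card {p : N.Partition //
        ∀ x ∈ p.parts, x % 8 = 2 ∨ x % 8 = 3 ∨ x % 8 = 7} := by
  have e : {p : Σ k : ℕ, Fin k → ℕ //
        (∀ i : Fin p.1, 0 < p.2 i) ∧
        (∀ i j : Fin p.1, (j : ℕ) = (i : ℕ) + 1 → p.2 j < p.2 i) ∧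
        (∀ m : Fin p.1, ((m : ℕ) + 1) % 2 = 1 → Even (p.2 m)) ∧
        ∑ i, p.2 i = N} ≃ {l : List ℕ // VV true l ∧ l.sum = N} := by
    refine Equiv.subtypeEquiv List.equivSigmaTuple.symm ?_
    rintro ⟨k, f⟩
    have := VV_ofFn k true f
    simp only [List.equivSigmaTuple, Equiv.coe_fn_symm_mk, List.sum_ofFn]
    rw [this]
    simp only [Bool.toNat_true]
    tauto
  rw [Nat.card_congr e]
  obtain ⟨R, h1, h2⟩ := ((coeff_QQ N).and (Filter.eventually_gt_atTop N)).exists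
  have h3 := coeff_GG N (2 * (4 * R)) (by omega)
  have h4 := ab_QQ R
  rw [← (GG_ab (4 * R)).1, X_pow_dvd_iff] at h4
  have h5 := h4 N (by omega)
  rw [map_sub, h1, h3, sub_eq_zero] at h5
  have h6 : Nat.card {l : List ℕ // VV true l ∧ l.sum = N} = #(Nat.Partition.restricted N PP) := by
    exact_mod_cast h5
  rw [h6, Nat.Partition.restricted, Nat.card_eq_fintype_card, Fintype.card_subtype]
end
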